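/- arXiv:1705.03707 — 3 statements merged into one kernel-verified Lean document; each statement's English description precedes it below -/
import Mathlib

section
/- For any integers k ≥ 3 and 1 ≤ ℓ < k/2 there exists ρ > 0 such that the following holds for all sufficiently large k-uniform hypergraphs H: if V(H) = A* ∪ B* is a partition and L₀, L₁ ⊆ B* are two disjoint ℓ-sets such that (i) |B*| = (2k−2ℓ−1)|A*| + ℓ, (ii) d(v, B*^(k−1)) ≥ (1−ρ)·C(|B*|, k−1) for every v ∈ A*, (iii) d(v, A*^(1)B*^(k−2)) ≥ (1−ρ)·|A*|·C(|B*|, k−2) for every v ∈ B*, and (iv) d(L₀, A*^(1)B*^(k−ℓ−1)) ≥ (1−ρ)·|A*|·C(|B*|, k−ℓ−1) and d(L₁, A*^(1)B*^(k−ℓ−1)) ≥ (1−ρ)·|A*|·C(|B*|, k−ℓ−1), then H contains a Hamiltonian ℓ-path with L₀ and L₁ as ends. -/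
open Finset

/-- `E` is the edge set of a `k`-uniform hypergraph on vertex set `Fin n`:
every edge is a `k`-element set of vertices. -/
def Uniform (n k : ℕ) (E : Finset (Finset (Fin n))) : Prop :=
  ∀ e ∈ E, e.card = k

/-- The degree `d(S)` of a vertex set `S`: the number of edges containing `S`. -/
def deg {n : ℕ} (E : Finset (Finset (Fin n))) (S : Finset (Fin n)) : ℕ :=
  (E.filter fun e => S ⊆ e).card

/-- The minimum `s`-degree `δ_s(H)`: the minimum of `d(S)` over all `s`-element
vertex sets `S`. -/
noncomputable def minDeg (n : ℕ) (E : Finset (Finset (Fin n))) (s : ℕ) : ℕ :=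
  sInf {d | ∃ S : Finset (Fin n), S.card = s ∧ deg E S = d}

/-- `d(L, X^(i) Y^(j))`: the number of edges of the form `L ∪ I ∪ J` with
`I ∈ X^(i)`, `J ∈ Y^(j)` (take `Y = ∅`, `j = 0` when `Y^(j)` is omitted). -/
def degIn {n : ℕ} (E : Finset (Finset (Fin n))) (L X Y : Finset (Fin n)) (i j : ℕ) : ℕ :=
  (E.filter fun e =>
    L ⊆ e ∧ e \ L ⊆ X ∪ Y ∧ ((e \ L) ∩ X).card = i ∧ ((e \ L) ∩ Y).card = j).card

/-- The `i`-th edge of an ℓ-cycle given by the cyclic ordering `f` of the `n`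
vertices: `k` cyclically consecutive vertices starting at position `i * (k - ℓ)`. -/
def cycEdge (n k ℓ : ℕ) (f : ℕ → Fin n) (i : ℕ) : Finset (Fin n) :=
  (Finset.range k).image fun j => f ((i * (k - ℓ) + j) % n)

/-- `H = (Fin n, E)` contains a Hamiltonian ℓ-cycle: there is a cyclic ordering of
all `n` vertices such that each of the `n / (k - ℓ)` windows of `k` consecutive
vertices (consecutive windows overlapping in `ℓ` vertices) is an edge, and two
consecutive edges share exactly `ℓ` vertices. -/
def HasHamCycle (n k ℓ : ℕ) (E : Finset (Finset (Fin n))) : Prop :=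
  ∃ f : ℕ → Fin n, Set.InjOn f (Set.Iio n) ∧
    (∀ i < n / (k - ℓ), cycEdge n k ℓ f i ∈ E) ∧
    (∀ i < n / (k - ℓ),
      (cycEdge n k ℓ f i ∩ cycEdge n k ℓ f ((i + 1) % (n / (k - ℓ)))).card = ℓ)

/-- The `i`-th edge of an ℓ-path given by the linear ordering `f`. -/
def pathEdge (n k ℓ : ℕ) (f : ℕ → Fin n) (i : ℕ) : Finset (Fin n) :=
  (Finset.range k).image fun j => f (i * (k - ℓ) + j)

/-- `f` is (the linear ordering of the vertices of) an ℓ-path with `t` edges all of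
which belong to `E`: the path has `t * (k - ℓ) + ℓ` vertices, every edge consists of
`k` consecutive vertices and two consecutive edges intersect in exactly `ℓ` vertices. -/
def IsPath (n k ℓ t : ℕ) (E : Finset (Finset (Fin n))) (f : ℕ → Fin n) : Prop :=
  Set.InjOn f (Set.Iio (t * (k - ℓ) + ℓ)) ∧ ∀ i < t, pathEdge n k ℓ f i ∈ E

/-- The vertex set of the ℓ-path described by `f` with `t` edges. -/
def pathVerts (n k ℓ t : ℕ) (f : ℕ → Fin n) : Finset (Fin n) :=
  (Finset.range (t * (k - ℓ) + ℓ)).image f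

/-- The first end (first `ℓ` vertices) of the ℓ-path described by `f`. -/
def pathEnd0 (n ℓ : ℕ) (f : ℕ → Fin n) : Finset (Fin n) :=
  (Finset.range ℓ).image f

/-- The last end (last `ℓ` vertices) of the ℓ-path described by `f` with `t` edges. -/
def pathEnd1 (n k ℓ t : ℕ) (f : ℕ → Fin n) : Finset (Fin n) :=
  (Finset.Ico (t * (k - ℓ)) (t * (k - ℓ) + ℓ)).image f

/-- The extremal hypergraph `X_{k,ℓ}(n)` on `Fin n`.  If `n` is an odd multiple of
`k - ℓ`, take `A` to be the first `⌊n / (2(k-ℓ))⌋` vertices and all `k`-sets meeting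
`A` as edges.  If `n` is an even multiple of `k - ℓ`, take `A` to be the first
`n / (2(k-ℓ)) - 1` vertices, fix the `ℓ + 1` following vertices (which lie in
`B = V ∖ A`), and take as edges all `k`-sets meeting `A` together with all `k`-subsets
of `B` containing all `ℓ + 1` fixed vertices. -/
def Xedges (n k ℓ : ℕ) : Finset (Finset (Fin n)) :=
  if Odd (n / (k - ℓ)) then
    (Finset.powersetCard k (Finset.univ : Finset (Fin n))).filter fun e =>
      ∃ v ∈ e, (v : ℕ) < n / (2 * (k - ℓ))
  else
    (Finset.powersetCard k (Finset.univ : Finset (Fin n))).filter fun e =>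
      (∃ v ∈ e, (v : ℕ) < n / (2 * (k - ℓ)) - 1) ∨
      ((∀ v ∈ e, n / (2 * (k - ℓ)) - 1 ≤ (v : ℕ)) ∧
        ∀ w : Fin n, n / (2 * (k - ℓ)) - 1 ≤ (w : ℕ) → (w : ℕ) < n / (2 * (k - ℓ)) + ℓ →
          w ∈ e)

/-- `e(B)`: the number of edges lying entirely inside `B`. -/
def edgesIn {n : ℕ} (E : Finset (Finset (Fin n))) (B : Finset (Fin n)) : ℕ :=
  (E.filter fun e => e ⊆ B).card

/-- `(A, B)` is an `(ℓ,ξ)`-extremal partition of the vertex set: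
`|A| = ⌈n/(2(k-ℓ))⌉ - 1`, `|B| = ⌊(2(k-ℓ)-1)n/(2(k-ℓ)) + 1⌋` and
`e(B) ≤ ξ · C(n,k)`. -/
def IsExtremalPartition (n k ℓ : ℕ) (E : Finset (Finset (Fin n))) (ξ : ℝ)
    (A B : Finset (Fin n)) : Prop :=
  Disjoint A B ∧ A ∪ B = Finset.univ ∧
  A.card = ⌈(n : ℝ) / (2 * ((k - ℓ : ℕ) : ℝ))⌉₊ - 1 ∧
  B.card = ⌊(2 * ((k - ℓ : ℕ) : ℝ) - 1) * (n : ℝ) / (2 * ((k - ℓ : ℕ) : ℝ)) + 1⌋₊ ∧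
  (edgesIn E B : ℝ) ≤ ξ * (n.choose k : ℝ)

/-- `H` is `(ℓ,ξ)`-extremal. -/
def IsExtremal (n k ℓ : ℕ) (E : Finset (Finset (Fin n))) (ξ : ℝ) : Prop :=
  ∃ A B, IsExtremalPartition n k ℓ E ξ A B

/-- `(A, B)` is a minimal `(ℓ,ξ)`-extremal partition: among all `(ℓ,ξ)`-extremal
partitions it minimises `e(B)`. -/
def IsMinExtremalPartition (n k ℓ : ℕ) (E : Finset (Finset (Fin n))) (ξ : ℝ)
    (A B : Finset (Fin n)) : Prop :=
  IsExtremalPartition n k ℓ E ξ A B ∧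
  ∀ A' B' : Finset (Fin n), IsExtremalPartition n k ℓ E ξ A' B' →
    edgesIn E B ≤ edgesIn E B'

open scoped Classical in
/-- `A_ε`: the set of vertices `v` with `d(v, B^(k-1)) ≥ (1-ε)·C(|B|, k-1)`. -/
noncomputable def Aeps (n k : ℕ) (E : Finset (Finset (Fin n))) (B : Finset (Fin n)) (ε : ℝ) :
    Finset (Fin n) :=
  Finset.univ.filter fun v =>
    (1 - ε) * (B.card.choose (k - 1) : ℝ) ≤ (degIn E {v} B ∅ (k - 1) 0 : ℝ)

open scoped Classical in
/-- `B_ε`: the set of vertices `v` with `d(v, B^(k-1)) ≤ ε·C(|B|, k-1)`. -/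
noncomputable def Beps (n k : ℕ) (E : Finset (Finset (Fin n))) (B : Finset (Fin n)) (ε : ℝ) :
    Finset (Fin n) :=
  Finset.univ.filter fun v =>
    (degIn E {v} B ∅ (k - 1) 0 : ℝ) ≤ ε * (B.card.choose (k - 1) : ℝ)

/-- `V_ε = V ∖ (A_ε ∪ B_ε)`. -/
noncomputable def Veps (n k : ℕ) (E : Finset (Finset (Fin n))) (B : Finset (Fin n)) (ε : ℝ) :
    Finset (Fin n) :=
  Finset.univ \ (Aeps n k E B ε ∪ Beps n k E B ε)

/-- `L` is an ε-typical ℓ-set: `L ⊆ B_ε`, `|L| = ℓ` and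
`d(L, B^(k-ℓ)) ≤ ε·C(|B|, k-ℓ)`. -/
def IsTypical (n k ℓ : ℕ) (E : Finset (Finset (Fin n))) (B : Finset (Fin n)) (ε : ℝ)
    (L : Finset (Fin n)) : Prop :=
  L.card = ℓ ∧ L ⊆ Beps n k E B ε ∧
    (degIn E L B ∅ (k - ℓ) 0 : ℝ) ≤ ε * (B.card.choose (k - ℓ) : ℝ)

theorem sum_deg_union_le {n k : ℕ} {E : Finset (Finset (Fin n))} (hE : Uniform n k E)
    (U : Finset (Fin n)) (r : ℕ) :
    ∑ T ∈ powersetCard r (univ : Finset (Fin n)), deg E (U ∪ T) ≤ 2 ^ k * deg E U := by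
  simp only [deg, card_filter]
  rw [sum_comm, mul_sum]
  refine sum_le_sum fun e he => ?_
  by_cases hU : U ⊆ e
  · simp only [union_subset_iff, hU, true_and, if_true, mul_one]
    rw [← card_filter, ← hE e he, ← card_powerset]
    exact card_le_card fun T hT => mem_powerset.2 (mem_filter.1 hT).2
  · simp [union_subset_iff, hU]

open scoped Classical in
/-- Markov's inequality for the degrees of the sets `U ∪ T` with `|T| = r`. -/
theorem card_large_deg_mul_le {n k : ℕ} {E : Finset (Finset (Fin n))} (hE : Uniform n k E)
    (U : Finset (Fin n)) (r : ℕ) (θ : ℝ) :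
    (#{T ∈ powersetCard r (univ : Finset (Fin n)) | θ < deg E (U ∪ T)} : ℝ) * θ
      ≤ 2 ^ k * deg E U := by
  have h := sum_deg_union_le hE U r
  calc (#{T ∈ powersetCard r (univ : Finset (Fin n)) | θ < deg E (U ∪ T)} : ℝ) * θ
      = ∑ T ∈ powersetCard r (univ : Finset (Fin n)) with θ < deg E (U ∪ T), θ := by
        rw [sum_const, nsmul_eq_mul]
    _ ≤ ∑ T ∈ powersetCard r (univ : Finset (Fin n)) with θ < deg E (U ∪ T),
          (deg E (U ∪ T) : ℝ) := sum_le_sum fun T hT => (mem_filter.1 hT).2.le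
    _ ≤ ∑ T ∈ powersetCard r (univ : Finset (Fin n)), (deg E (U ∪ T) : ℝ) :=
        sum_le_sum_of_subset_of_nonneg (filter_subset _ _) fun _ _ _ => Nat.cast_nonneg _
    _ ≤ 2 ^ k * deg E U := by exact_mod_cast h

theorem card_le_sum_deg {n k : ℕ} (hk : 1 ≤ k) {E : Finset (Finset (Fin n))}
    (hE : Uniform n k E) : deg E ∅ ≤ ∑ v : Fin n, deg E {v} := by
  simp only [deg, card_filter]
  rw [sum_comm]
  refine sum_le_sum fun e he => ?_
  simp only [empty_subset, if_true, singleton_subset_iff, ← card_filter, filter_univ_mem]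
  rw [hE e he]
  exact hk

theorem deg_add_degIn_le {n : ℕ} {E F : Finset (Finset (Fin n))} (hEF : Disjoint F E)
    (L X Y : Finset (Fin n)) (i j : ℕ)
    (hF : ∀ e ∈ F, L ⊆ e →
      e \ L ⊆ X ∪ Y ∧ ((e \ L) ∩ X).card = i ∧ ((e \ L) ∩ Y).card = j) :
    deg F L + degIn E L X Y i j ≤ X.card.choose i * Y.card.choose j := by
  rw [deg, degIn, ← card_union_of_disjoint (hEF.mono (filter_subset _ _) (filter_subset _ _)),
    ← card_powersetCard, ← card_powersetCard, ← card_product]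
  have key : ∀ e ∈ F.filter (fun e => L ⊆ e) ∪ E.filter (fun e =>
      L ⊆ e ∧ e \ L ⊆ X ∪ Y ∧ ((e \ L) ∩ X).card = i ∧ ((e \ L) ∩ Y).card = j),
      L ⊆ e ∧ e \ L ⊆ X ∪ Y ∧ ((e \ L) ∩ X).card = i ∧ ((e \ L) ∩ Y).card = j := by
    intro e he
    rcases mem_union.1 he with he | he
    · exact ⟨(mem_filter.1 he).2, hF e (mem_filter.1 he).1 (mem_filter.1 he).2⟩
    · exact (mem_filter.1 he).2
  refine card_le_card_of_injOn (fun e => ((e \ L) ∩ X, (e \ L) ∩ Y)) ?_ ?_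
  · intro e he
    obtain ⟨-, -, h1, h2⟩ := key e he
    exact mem_coe.2 (mem_product.2 ⟨mem_powersetCard.2 ⟨inter_subset_right, h1⟩,
      mem_powersetCard.2 ⟨inter_subset_right, h2⟩⟩)
  · intro e he e' he' h
    obtain ⟨h1, h2, -⟩ := key e he
    obtain ⟨h1', h2', -⟩ := key e' he'
    simp only [Prod.mk.injEq] at h
    rw [← sdiff_union_of_subset h1, ← sdiff_union_of_subset h1',
      ← inter_eq_left.2 h2, ← inter_eq_left.2 h2', inter_union_distrib_left,
      inter_union_distrib_left, h.1, h.2]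

open scoped Classical in
/-- One step of the greedy choice: a set `S ⊆ X` of small degree, such that only a small
proportion (in weight) of the vertices `v` makes `insert v S` a set of large degree. -/
theorem exists_good_set {n k ℓ a : ℕ} (hk : ℓ + 1 ≤ k) {F : Finset (Finset (Fin n))}
    (hF : Uniform n k F) {ρ ε δ : ℝ} (hε : 0 < ε) (hδ : 0 < δ) (ha : 2 * ℓ ≤ a) (ha0 : 0 < a)
    (hn : n ≤ 2 * k * a)
    (hdeg : ∀ v : Fin n, (deg F {v} : ℝ) ≤ ρ * a ^ (k - 1))
    (hρ : 2 ^ k * (2 * k) * ρ / ε + 2 ^ k * ρ / (ε * δ) < 1 / (2 ^ ℓ * (ℓ.factorial : ℝ)))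
    (X : Finset (Fin n)) (hX : a ≤ X.card) (w : Fin n → ℝ) (hw : ∀ v, 0 < w v) :
    ∃ S ∈ powersetCard ℓ X, (deg F S : ℝ) ≤ ε * a ^ (k - ℓ) ∧
      ∑ v with ε * (a : ℝ) ^ (k - ℓ - 1) < deg F (insert v S), w v ≤ δ * ∑ v, w v := by
  by_contra! hcon
  have haR : (0 : ℝ) < a := by exact_mod_cast ha0
  set W := ∑ v, w v with hW
  have hWpos : 0 < W := by
    obtain ⟨x, hx⟩ := card_pos.1 (ha0.trans_le hX)
    exact sum_pos (fun v _ => hw v) ⟨x, mem_univ x⟩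
  set N₁ := {S ∈ powersetCard ℓ (univ : Finset (Fin n)) | ε * (a : ℝ) ^ (k - ℓ) < deg F S}
  set N₂ := {S ∈ powersetCard ℓ (univ : Finset (Fin n)) | δ * W <
    ∑ v with ε * (a : ℝ) ^ (k - ℓ - 1) < deg F (insert v S), w v}
  have hcover : powersetCard ℓ X ⊆ N₁ ∪ N₂ := by
    intro S hS
    have hS' : S ∈ powersetCard ℓ (univ : Finset (Fin n)) :=
      powersetCard_mono (subset_univ X) hS
    by_cases h : (deg F S : ℝ) ≤ ε * a ^ (k - ℓ)
    · exact mem_union_right _ (mem_filter.2 ⟨hS', hcon S hS h⟩)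
    · exact mem_union_left _ (mem_filter.2 ⟨hS', not_le.1 h⟩)
  have hpow : (a : ℝ) ^ k = a ^ ℓ * a ^ (k - ℓ) := by rw [← pow_add]; congr 1; omega
  have hpow1 : (a : ℝ) ^ (k - 1) = a ^ ℓ * a ^ (k - ℓ - 1) := by
    rw [← pow_add]; congr 1; omega
  have hpow2 : (a : ℝ) ^ k = a * a ^ (k - 1) := by rw [← pow_succ']; congr 1; omega
  have h₁ : (#N₁ : ℝ) ≤ 2 ^ k * (2 * k) * ρ / ε * a ^ ℓ := by
    have h := card_large_deg_mul_le hF ∅ ℓ (ε * (a : ℝ) ^ (k - ℓ))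
    simp only [empty_union] at h
    have h0 : (deg F ∅ : ℝ) ≤ 2 * k * ρ * a ^ k := by
      have h1 := card_le_sum_deg (by omega) hF
      have hρ0 : 0 ≤ ρ * (a : ℝ) ^ (k - 1) := by
        obtain ⟨x, hx⟩ := card_pos.1 (ha0.trans_le hX)
        exact (Nat.cast_nonneg _).trans (hdeg x)
      calc (deg F ∅ : ℝ) ≤ ∑ v : Fin n, (deg F {v} : ℝ) := by exact_mod_cast h1
        _ ≤ ∑ v : Fin n, ρ * (a : ℝ) ^ (k - 1) := sum_le_sum fun v _ => hdeg v
        _ = n * (ρ * a ^ (k - 1)) := by simp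
        _ ≤ (2 * k * a : ℝ) * (ρ * a ^ (k - 1)) :=
            mul_le_mul_of_nonneg_right (by exact_mod_cast hn) hρ0
        _ = 2 * k * ρ * a ^ k := by rw [hpow2]; ring
    have h2 : (#N₁ : ℝ) * (ε * a ^ (k - ℓ)) ≤
        (2 ^ k * (2 * k) * ρ / ε * a ^ ℓ) * (ε * a ^ (k - ℓ)) := by
      refine h.trans ((mul_le_mul_of_nonneg_left h0 (by positivity)).trans (le_of_eq ?_))
      rw [hpow]
      field_simp
    exact le_of_mul_le_mul_right h2 (by positivity)
  have h₂ : (#N₂ : ℝ) ≤ 2 ^ k * ρ / (ε * δ) * a ^ ℓ := by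
    have hv : ∀ v : Fin n, (#{S ∈ powersetCard ℓ (univ : Finset (Fin n)) |
        ε * (a : ℝ) ^ (k - ℓ - 1) < deg F (insert v S)} : ℝ) ≤ 2 ^ k * ρ / ε * a ^ ℓ := by
      intro v
      have h := card_large_deg_mul_le hF {v} ℓ (ε * (a : ℝ) ^ (k - ℓ - 1))
      simp only [singleton_union] at h
      have h2 : (#{S ∈ powersetCard ℓ (univ : Finset (Fin n)) |
          ε * (a : ℝ) ^ (k - ℓ - 1) < deg F (insert v S)} : ℝ) * (ε * a ^ (k - ℓ - 1)) ≤
          (2 ^ k * ρ / ε * a ^ ℓ) * (ε * a ^ (k - ℓ - 1)) := by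
        refine h.trans ((mul_le_mul_of_nonneg_left (hdeg v) (by positivity)).trans
          (le_of_eq ?_))
        rw [hpow1]
        field_simp
      exact le_of_mul_le_mul_right h2 (by positivity)
    have h2 : (#N₂ : ℝ) * (δ * W) ≤ (2 ^ k * ρ / (ε * δ) * a ^ ℓ) * (δ * W) := by
      calc (#N₂ : ℝ) * (δ * W) = ∑ S ∈ N₂, δ * W := by rw [sum_const, nsmul_eq_mul]
        _ ≤ ∑ S ∈ N₂, ∑ v with ε * (a : ℝ) ^ (k - ℓ - 1) < deg F (insert v S), w v :=
            sum_le_sum fun S hS => (mem_filter.1 hS).2.le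
        _ ≤ ∑ S ∈ powersetCard ℓ (univ : Finset (Fin n)),
              ∑ v with ε * (a : ℝ) ^ (k - ℓ - 1) < deg F (insert v S), w v :=
            sum_le_sum_of_subset_of_nonneg (filter_subset _ _)
              fun _ _ _ => sum_nonneg fun v _ => (hw v).le
        _ = ∑ v, ∑ S ∈ powersetCard ℓ (univ : Finset (Fin n)) with
              ε * (a : ℝ) ^ (k - ℓ - 1) < deg F (insert v S), w v := by
            simp only [sum_filter]
            rw [sum_comm]
        _ ≤ ∑ v, (2 ^ k * ρ / ε * a ^ ℓ) * w v := by
            refine sum_le_sum fun v _ => ?_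
            rw [sum_const, nsmul_eq_mul]
            exact mul_le_mul_of_nonneg_right (hv v) (hw v).le
        _ = (2 ^ k * ρ / (ε * δ) * a ^ ℓ) * (δ * W) := by
            rw [← mul_sum, ← hW]
            field_simp
    exact le_of_mul_le_mul_right h2 (by positivity)
  have hlow : 1 / (2 ^ ℓ * (ℓ.factorial : ℝ)) * (a : ℝ) ^ ℓ ≤ (X.card.choose ℓ : ℝ) := by
    have h := Nat.pow_le_choose (α := ℝ) ℓ a
    have h3 : (a.choose ℓ : ℝ) ≤ (X.card.choose ℓ : ℝ) := by
      exact_mod_cast Nat.choose_le_choose ℓ hX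
    have h4 : (a : ℝ) / 2 ≤ ((a + 1 - ℓ : ℕ) : ℝ) := by
      have : (a : ℝ) ≤ 2 * ((a + 1 - ℓ : ℕ) : ℝ) := by
        exact_mod_cast (by omega : a ≤ 2 * (a + 1 - ℓ))
      linarith
    have h5 : ((a : ℝ) / 2) ^ ℓ ≤ ((a + 1 - ℓ : ℕ) : ℝ) ^ ℓ :=
      pow_le_pow_left₀ (by positivity) h4 ℓ
    refine le_trans ?_ h3
    refine le_trans ?_ h
    rw [le_div_iff₀ (by positivity)]
    refine le_trans (le_of_eq ?_) h5
    rw [div_pow]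
    field_simp
  have hcard : (X.card.choose ℓ : ℝ) ≤ #N₁ + #N₂ := by
    rw [← card_powersetCard]
    exact_mod_cast (card_le_card hcover).trans (card_union_le _ _)
  have := mul_lt_mul_of_pos_right hρ (pow_pos haR ℓ)
  rw [add_mul] at this
  linarith

open scoped Classical in
theorem exists_good_sequence {n k ℓ a : ℕ} (hk : ℓ + 1 ≤ k) {F : Finset (Finset (Fin n))}
    (hF : Uniform n k F) {ρ ε δ : ℝ} (hε : 0 < ε) (hδ : 0 < δ) (ha : 2 * ℓ ≤ a) (ha0 : 0 < a)
    (hn : n ≤ 2 * k * a)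
    (hdeg : ∀ v : Fin n, (deg F {v} : ℝ) ≤ ρ * a ^ (k - 1))
    (hρ : 2 ^ k * (2 * k) * ρ / ε + 2 ^ k * ρ / (ε * δ) < 1 / (2 ^ ℓ * (ℓ.factorial : ℝ)))
    (X : Finset (Fin n)) (m : ℕ) (hX : a + m * ℓ ≤ X.card + ℓ) :
    ∃ T : ℕ → Finset (Fin n), (∀ j < m, T j ⊆ X ∧ (T j).card = ℓ ∧
        (deg F (T j) : ℝ) ≤ ε * a ^ (k - ℓ)) ∧
      (∀ i < m, ∀ j < m, i ≠ j → Disjoint (T i) (T j)) ∧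
      ∑ v, (2 : ℝ) ^ #{j ∈ range m | ε * (a : ℝ) ^ (k - ℓ - 1) < deg F (insert v (T j))}
        ≤ n * (1 + δ) ^ m := by
  induction m with
  | zero => exact ⟨fun _ => ∅, by simp, by simp, by simp⟩
  | succ m ih =>
    obtain ⟨T, h1, h2, h3⟩ := ih (by nlinarith)
    set Y := X \ (range m).biUnion T with hY
    have hYcard : a ≤ Y.card := by
      have h4 : ((range m).biUnion T).card ≤ m * ℓ := by
        refine (card_biUnion_le).trans ?_
        rw [sum_congr rfl fun j hj => (h1 j (mem_range.1 hj)).2.1]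
        simp
      have h5 := le_card_sdiff ((range m).biUnion T) X
      rw [← hY] at h5
      rw [add_mul, one_mul] at hX
      omega
    obtain ⟨S, hS, hS1, hS2⟩ := exists_good_set hk hF hε hδ ha ha0 hn hdeg hρ Y hYcard
      (fun v => (2 : ℝ) ^
        #{j ∈ range m | ε * (a : ℝ) ^ (k - ℓ - 1) < deg F (insert v (T j))})
      (fun v => by positivity)
    rw [mem_powersetCard] at hS
    have hold : ∀ j < m, Function.update T m S j = T j := fun j hj =>
      Function.update_of_ne hj.ne _ _
    have hSd : ∀ j < m, Disjoint S (T j) := fun j hj => by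
      refine disjoint_of_subset_left hS.1 (disjoint_of_subset_right ?_ sdiff_disjoint)
      exact subset_biUnion_of_mem T (mem_range.2 hj)
    refine ⟨Function.update T m S, ?_, ?_, ?_⟩
    · intro j hj
      rcases Nat.lt_succ_iff_lt_or_eq.1 hj with hj | rfl
      · rw [hold j hj]; exact h1 j hj
      · rw [Function.update_self]
        exact ⟨hS.1.trans sdiff_subset, hS.2, hS1⟩
    · intro i hi j hj hij
      rcases Nat.lt_succ_iff_lt_or_eq.1 hi with hi | rfl <;>
        rcases Nat.lt_succ_iff_lt_or_eq.1 hj with hj | rfl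
      · rw [hold i hi, hold j hj]; exact h2 i hi j hj hij
      · rw [hold i hi, Function.update_self]; exact (hSd i hi).symm
      · rw [hold j hj, Function.update_self]; exact hSd j hj
      · exact absurd rfl hij
    · have hstep : ∀ v, (2 : ℝ) ^ #{j ∈ range (m + 1) |
          ε * (a : ℝ) ^ (k - ℓ - 1) < deg F (insert v (Function.update T m S j))} =
          2 ^ #{j ∈ range m | ε * (a : ℝ) ^ (k - ℓ - 1) < deg F (insert v (T j))} +
          if ε * (a : ℝ) ^ (k - ℓ - 1) < deg F (insert v S) then
            2 ^ #{j ∈ range m | ε * (a : ℝ) ^ (k - ℓ - 1) < deg F (insert v (T j))}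
          else 0 := by
        intro v
        have hfil : {j ∈ range m | ε * (a : ℝ) ^ (k - ℓ - 1) <
            deg F (insert v (Function.update T m S j))} =
            {j ∈ range m | ε * (a : ℝ) ^ (k - ℓ - 1) < deg F (insert v (T j))} :=
          filter_congr fun j hj => by rw [hold j (mem_range.1 hj)]
        rw [range_add_one, filter_insert, Function.update_self, hfil]
        split_ifs with h
        · rw [card_insert_of_notMem (by simp), pow_succ]; ring
        · simp
      rw [sum_congr rfl fun v _ => hstep v, sum_add_distrib, ← sum_filter, pow_succ]
      nlinarith
open scoped Classical in
/-- The number of ways to choose blocks `τ`, with two of the choices prescribed, so that the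
transversal of these blocks completes a fixed set `U` to an edge of `F`. -/
theorem card_transversal_le {n k s a : ℕ} {F : Finset (Finset (Fin n))} (hF : Uniform n k F)
    (hk : 1 ≤ k) (g : Fin a → Fin s → Fin n) (hg : ∀ p, Function.Injective fun j => g j p)
    (i j : Fin a) (c : Fin (s + 1)) (U : Finset (Fin n)) (I : Finset (Fin s)) {ε : ℝ}
    (hI : ∀ p ∈ I, c + p.succ ≠ 0) (hU : (deg F U : ℝ) ≤ ε * a ^ #I) :
    (#{τ : Fin (s + 1) → Fin a | τ 0 = i ∧ τ c = j ∧
        U ∪ I.image (fun p => g (τ (c + p.succ)) p) ∈ F} : ℝ) ≤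
      ε * k ^ s * a ^ (s + 1 - #({0, c} : Finset (Fin (s + 1)))) := by
  set D : Finset (Fin (s + 1)) := {0, c} with hD
  set J : Finset (Fin (s + 1)) := I.image fun p => c + p.succ with hJ
  have hsucc : Function.Injective fun p : Fin s => c + p.succ := fun p q h =>
    Fin.succ_injective _ (add_left_cancel h)
  have hJcard : #J = #I := card_image_of_injective _ hsucc
  have hJD : Disjoint J D := by
    rw [disjoint_left]
    intro x hx hxD
    obtain ⟨p, hp, rfl⟩ := mem_image.1 hx
    rw [hD, mem_insert, mem_singleton] at hxD
    rcases hxD with h | h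
    · exact hI p hp h
    · exact Fin.succ_ne_zero p (add_eq_left.1 h)
  let Z : Finset (Fin n) → Fin (s + 1) → Finset (Fin a) := fun e x =>
    if x = 0 then {i} else if x = c then {j} else
      ({t | ∀ p ∈ I, c + p.succ = x → g t p ∈ e} : Finset (Fin a))
  have hsub : ({τ : Fin (s + 1) → Fin a | τ 0 = i ∧ τ c = j ∧
      U ∪ I.image (fun p => g (τ (c + p.succ)) p) ∈ F} : Finset _) ⊆
      (F.filter fun e => U ⊆ e).biUnion fun e => Fintype.piFinset (Z e) := by
    intro τ hτ
    obtain ⟨h0, hc, he⟩ := (mem_filter.1 hτ).2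
    refine mem_biUnion.2 ⟨_, mem_filter.2 ⟨he, subset_union_left⟩, ?_⟩
    rw [Fintype.mem_piFinset]
    intro x
    simp only [Z]
    split_ifs with hx hx'
    · rw [hx, h0]; exact mem_singleton_self _
    · rw [hx', hc]; exact mem_singleton_self _
    · refine mem_filter.2 ⟨mem_univ _, fun p hp hpx => ?_⟩
      rw [← hpx]
      exact mem_union_right _ (mem_image_of_mem _ hp)
  have hZ : ∀ e ∈ F, #(Fintype.piFinset (Z e)) ≤ k ^ s * a ^ (s + 1 - #D - #I) := by
    intro e he
    rw [Fintype.card_piFinset]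
    calc ∏ x, #(Z e x) ≤ ∏ x, (if x ∈ J then k else if x ∈ D then 1 else a) := by
          refine prod_le_prod' fun x _ => ?_
          by_cases hxJ : x ∈ J
          · have hxD := disjoint_left.1 hJD hxJ
            rw [hD, mem_insert, mem_singleton, not_or] at hxD
            obtain ⟨p, hp, rfl⟩ := mem_image.1 hxJ
            simp only [Z, if_neg hxD.1, if_neg hxD.2, if_pos hxJ]
            rw [← hF e he]
            refine card_le_card_of_injOn (fun t => g t p) (fun t ht => ?_) (hg p).injOn
            exact (mem_filter.1 (mem_coe.1 ht)).2 p hp rfl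
          · rw [if_neg hxJ]
            by_cases hxD : x ∈ D
            · rw [if_pos hxD]
              rw [hD, mem_insert, mem_singleton] at hxD
              simp only [Z]
              split_ifs with h h'
              · simp
              · simp
              · exact absurd hxD (by tauto)
            · rw [if_neg hxD]
              simpa using card_le_univ (Z e x)
      _ = k ^ #I * a ^ (s + 1 - #D - #I) := by
          rw [prod_ite, prod_ite, prod_const, prod_const, prod_const, one_pow, one_mul]
          congr 2
          · rw [← hJcard]; congr 1; ext; simp
          · rw [← hJcard, Nat.sub_sub, add_comm #D, ← card_union_of_disjoint hJD,
              filter_filter]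
            have hcompl := card_compl (J ∪ D)
            rw [Fintype.card_fin] at hcompl
            rw [← hcompl]
            congr 1; ext; simp
      _ ≤ k ^ s * a ^ (s + 1 - #D - #I) := by
          refine Nat.mul_le_mul_right _ (Nat.pow_le_pow_right hk ?_)
          simpa using card_le_univ I
  have hcount : #{τ : Fin (s + 1) → Fin a | τ 0 = i ∧ τ c = j ∧
      U ∪ I.image (fun p => g (τ (c + p.succ)) p) ∈ F} ≤
      deg F U * (k ^ s * a ^ (s + 1 - #D - #I)) := by
    refine (card_le_card hsub).trans (card_biUnion_le_card_mul _ _ _ fun e he => ?_)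
    exact hZ e (mem_filter.1 he).1
  have hle : #I + #D ≤ s + 1 := by
    rw [← hJcard, ← card_union_of_disjoint hJD]
    simpa using card_le_univ (J ∪ D)
  calc _ ≤ (deg F U : ℝ) * (k ^ s * a ^ (s + 1 - #D - #I)) := by exact_mod_cast hcount
    _ ≤ (ε * a ^ #I) * (k ^ s * a ^ (s + 1 - #D - #I)) := by gcongr
    _ = ε * k ^ s * a ^ (s + 1 - #D) := by
      rw [show s + 1 - #D = #I + (s + 1 - #D - #I) by omega, pow_add]
      rw [show #I + (s + 1 - #D - #I) - #I = s + 1 - #D - #I by omega]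
      ring

open scoped Classical in
theorem card_two_fixed_le {s a : ℕ} (i j : Fin a) (c : Fin (s + 1)) (hc : c ≠ 0) :
    #{τ : Fin (s + 1) → Fin a | τ 0 = i ∧ τ c = j} ≤ a ^ (s - 1) := by
  have hsub : ({τ : Fin (s + 1) → Fin a | τ 0 = i ∧ τ c = j} : Finset _) ⊆
      Fintype.piFinset fun x => if x ∈ ({0, c} : Finset (Fin (s + 1))) then {if x = 0 then i else j}
        else univ := by
    intro τ hτ
    obtain ⟨h0, h1⟩ := (mem_filter.1 hτ).2
    rw [Fintype.mem_piFinset]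
    intro x
    by_cases hx : x = 0
    · subst hx; simp [h0]
    · by_cases hx' : x = c
      · subst hx'; simp [h1, hc]
      · simp [hx, hx']
  refine (card_le_card hsub).trans (le_of_eq ?_)
  rw [Fintype.card_piFinset]
  calc _ = ∏ x, (if x ∈ ({0, c} : Finset (Fin (s + 1))) then 1 else a) :=
        prod_congr rfl fun x _ => by split_ifs <;> simp
    _ = a ^ (s - 1) := by
        rw [prod_ite, prod_const_one, one_mul, prod_const]
        congr 1
        rw [filter_not, filter_univ_mem, card_univ_sdiff, card_pair hc.symm, Fintype.card_fin]
        omega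

open scoped Classical in
theorem card_not_injective_le {s a : ℕ} (i : Fin a) :
    #{τ : Fin (s + 1) → Fin a | τ 0 = i ∧ ¬ Function.Injective τ} ≤
      (s + 1) * (s + 1) * a ^ (s - 1) := by
  have hsub : ({τ : Fin (s + 1) → Fin a | τ 0 = i ∧ ¬ Function.Injective τ} : Finset _) ⊆
      ({xy : Fin (s + 1) × Fin (s + 1) | xy.1 ≠ xy.2 ∧ xy.2 ≠ 0} : Finset _).biUnion
        fun xy => {τ : Fin (s + 1) → Fin a | τ 0 = i ∧ τ xy.1 = τ xy.2} := by
    intro τ hτ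
    obtain ⟨h0, hinj⟩ := (mem_filter.1 hτ).2
    rw [Function.Injective] at hinj
    push Not at hinj
    obtain ⟨x, y, hxy, hne⟩ := hinj
    simp only [mem_biUnion, mem_filter, mem_univ, true_and, Prod.exists]
    by_cases hy : y = 0
    · exact ⟨y, x, ⟨hne.symm, fun hx => hne (hx.trans hy.symm)⟩, h0, hxy.symm⟩
    · exact ⟨x, y, ⟨hne, hy⟩, h0, hxy⟩
  refine (card_le_card hsub).trans ((card_biUnion_le_card_mul _ _ (a ^ (s - 1)) ?_).trans ?_)
  · rintro ⟨x, y⟩ hxy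
    obtain ⟨hne, hy⟩ := (mem_filter.1 hxy).2
    refine le_trans ?_ (card_two_fixed_le i i y hy)
    refine card_le_card_of_injOn (fun τ => Function.update τ y i) ?_ ?_
    · intro τ hτ
      have h := (mem_filter.1 (mem_coe.1 hτ)).2
      simp [Function.update_of_ne hy.symm, h.1]
    · intro τ hτ τ' hτ' h
      have h1 := (mem_filter.1 (mem_coe.1 hτ)).2.2
      have h1' := (mem_filter.1 (mem_coe.1 hτ')).2.2
      have hz : ∀ z, z ≠ y → τ z = τ' z := fun z hz => by
        simpa [Function.update_of_ne hz] using congrFun h z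
      funext z
      by_cases hzy : z = y
      · subst hzy
        exact h1.symm.trans ((hz x hne).trans h1')
      · exact hz z hzy
  · refine Nat.mul_le_mul_right _ ((card_le_univ _).trans (le_of_eq ?_))
    simp

open scoped Classical in
theorem card_window_le {n k s a r : ℕ} {F : Finset (Finset (Fin n))} (hF : Uniform n k F)
    (hk : 1 ≤ k) (g : Fin a → Fin s → Fin n) (hg : ∀ p, Function.Injective fun j => g j p)
    (i : Fin a) (c : Fin (s + 1)) (P : Finset (Fin s)) (hP : #P = r)
    (S : Fin a → Finset (Fin n)) {ε : ℝ} (hε : 0 ≤ ε)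
    (hgood : ∀ j, (deg F (S j) : ℝ) ≤ ε * a ^ r)
    (hpair : ∀ v, (#{j | ε * (a : ℝ) ^ (r - 1) < deg F (insert v (S j))} : ℝ) ≤ ε * a) :
    (#{τ : Fin (s + 1) → Fin a | τ 0 = i ∧
        S (τ c) ∪ P.image (fun p => g (τ (c + p.succ)) p) ∈ F} : ℝ) ≤
      2 * (ε * k ^ s) * a ^ s := by
  by_cases hc : c = 0
  · subst hc
    have h := card_transversal_le hF hk g hg i i 0 (S i) P (ε := ε)
      (fun p _ => by simp [Fin.succ_ne_zero]) (by rw [hP]; exact hgood i)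
    refine le_trans (Nat.cast_le.2 (card_le_card fun τ hτ => ?_)) (h.trans ?_)
    · obtain ⟨h1, h2⟩ := (mem_filter.1 hτ).2
      exact mem_filter.2 ⟨mem_univ _, h1, h1, h1 ▸ h2⟩
    have hs : s + 1 - #({0, 0} : Finset (Fin (s + 1))) = s := by simp
    rw [hs]
    have : 0 ≤ ε * k ^ s * (a : ℝ) ^ s := by positivity
    linarith
  · have hs : 1 ≤ s := by
      rcases Nat.eq_zero_or_pos s with rfl | h
      · exact absurd (Fin.ext (by omega)) hc
      · exact h
    have hD : s + 1 - #({0, c} : Finset (Fin (s + 1))) = s - 1 := by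
      rw [card_pair (Ne.symm hc)]; omega
    have hk1 : (1 : ℝ) ≤ (k : ℝ) ^ s := one_le_pow₀ (by exact_mod_cast hk)
    set N : Fin a → Finset (Fin (s + 1) → Fin a) := fun j => {τ | τ 0 = i ∧ τ c = j ∧
      S j ∪ P.image (fun p => g (τ (c + p.succ)) p) ∈ F} with hN
    have hsum : (#{τ : Fin (s + 1) → Fin a | τ 0 = i ∧
        S (τ c) ∪ P.image (fun p => g (τ (c + p.succ)) p) ∈ F} : ℝ) ≤ ∑ j, (#(N j) : ℝ) := by
      have hsub : ({τ : Fin (s + 1) → Fin a | τ 0 = i ∧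
          S (τ c) ∪ P.image (fun p => g (τ (c + p.succ)) p) ∈ F} : Finset _) ⊆
          univ.biUnion N := by
        intro τ hτ
        have h := (mem_filter.1 hτ).2
        exact mem_biUnion.2 ⟨τ c, mem_univ _, mem_filter.2 ⟨mem_univ _, h.1, rfl, h.2⟩⟩
      exact_mod_cast (card_le_card hsub).trans card_biUnion_le
    have hpow : (a : ℝ) ^ s = a * a ^ (s - 1) := by rw [← pow_succ']; congr 1; omega
    refine hsum.trans ?_
    by_cases hq : ∃ q ∈ P, c + q.succ = 0
    · obtain ⟨q, hqP, hq0⟩ := hq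
      have hne : ∀ p ∈ P.erase q, c + p.succ ≠ 0 := fun p hp h0 =>
        (mem_erase.1 hp).1 (Fin.succ_injective _ (add_left_cancel (h0.trans hq0.symm)))
      have hcardE : #(P.erase q) = r - 1 := by rw [card_erase_of_mem hqP, hP]
      set v := g i q
      set Bad : Finset (Fin a) := {j | ε * (a : ℝ) ^ (r - 1) < deg F (insert v (S j))}
      have hNj : ∀ j, (#(N j) : ℝ) ≤ (if j ∈ Bad then (a : ℝ) ^ (s - 1) else 0) +
          ε * k ^ s * a ^ (s - 1) := by
        intro j
        split_ifs with hj
        · have h1 : #(N j) ≤ a ^ (s - 1) := by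
            refine le_trans (card_le_card fun τ hτ => ?_) (card_two_fixed_le i j c hc)
            have h := (mem_filter.1 hτ).2
            exact mem_filter.2 ⟨mem_univ _, h.1, h.2.1⟩
          have h2 : (#(N j) : ℝ) ≤ (a : ℝ) ^ (s - 1) := by exact_mod_cast h1
          have : 0 ≤ ε * k ^ s * (a : ℝ) ^ (s - 1) := by positivity
          linarith
        · have hj' : (deg F (insert v (S j)) : ℝ) ≤ ε * a ^ (r - 1) := by
            by_contra h
            exact hj (mem_filter.2 ⟨mem_univ _, not_le.1 h⟩)
          have h := card_transversal_le hF hk g hg i j c (insert v (S j)) (P.erase q)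
            (ε := ε) hne (by rw [hcardE]; exact hj')
          rw [hD] at h
          rw [zero_add]
          refine le_trans ?_ h
          refine Nat.cast_le.2 (card_le_card fun τ hτ => ?_)
          obtain ⟨h1, h2, h3⟩ := (mem_filter.1 hτ).2
          refine mem_filter.2 ⟨mem_univ _, h1, h2, ?_⟩
          rwa [← insert_erase hqP, image_insert, hq0, h1, union_insert, ← insert_union] at h3
      refine (sum_le_sum fun j _ => hNj j).trans ?_
      rw [sum_add_distrib, ← sum_filter, sum_const, sum_const, nsmul_eq_mul, nsmul_eq_mul,
        card_univ, Fintype.card_fin, filter_univ_mem]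
      have hb := mul_le_mul_of_nonneg_right (hpair v) (by positivity : 0 ≤ (a : ℝ) ^ (s - 1))
      have h1 : ε * a * (a : ℝ) ^ (s - 1) ≤ ε * k ^ s * (a * a ^ (s - 1)) := by
        have : 0 ≤ ε * (a * (a : ℝ) ^ (s - 1)) := by positivity
        nlinarith
      rw [hpow]
      calc _ ≤ ε * k ^ s * (a * (a : ℝ) ^ (s - 1)) + a * (ε * k ^ s * a ^ (s - 1)) :=
            add_le_add_left (hb.trans h1) _
        _ = _ := by ring
    · push Not at hq
      have hNj : ∀ j, (#(N j) : ℝ) ≤ ε * k ^ s * a ^ (s - 1) := by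
        intro j
        have h := card_transversal_le hF hk g hg i j c (S j) P (ε := ε) hq
          (by rw [hP]; exact hgood j)
        rwa [hD] at h
      refine (sum_le_sum fun j _ => hNj j).trans ?_
      rw [sum_const, nsmul_eq_mul, card_univ, Fintype.card_fin, hpow]
      have : 0 ≤ ε * k ^ s * (a * (a : ℝ) ^ (s - 1)) := by positivity
      linarith
open scoped Classical in
theorem exists_transversal {n k s a r : ℕ} {F : Finset (Finset (Fin n))} (hF : Uniform n k F)
    (hk : 1 ≤ k) (hs : 1 ≤ s) (g : Fin a → Fin s → Fin n)
    (hg : ∀ p, Function.Injective fun j => g j p)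
    (P : Fin 2 → Finset (Fin s)) (hP : ∀ h, #(P h) = r)
    (S : Fin 2 → Fin a → Finset (Fin n)) {ε : ℝ} (hε : 0 ≤ ε)
    (hgood : ∀ h j, (deg F (S h j) : ℝ) ≤ ε * a ^ r)
    (hpair : ∀ h v, (#{j | ε * (a : ℝ) ^ (r - 1) < deg F (insert v (S h j))} : ℝ) ≤ ε * a)
    (hεs : 8 * (s + 1) * (ε * k ^ s) ≤ 1) (ha : 2 * (s + 1) * (s + 1) < a) (i : Fin a) :
    ∃ τ : Fin (s + 1) → Fin a, Function.Injective τ ∧ τ 0 = i ∧ ∀ h c,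
      S h (τ c) ∪ (P h).image (fun p => g (τ (c + p.succ)) p) ∉ F := by
  by_contra! hcon
  set Ω : Finset (Fin (s + 1) → Fin a) := {τ | τ 0 = i}
  set N₀ : Finset (Fin (s + 1) → Fin a) := {τ | τ 0 = i ∧ ¬ Function.Injective τ}
  set N : Fin 2 × Fin (s + 1) → Finset (Fin (s + 1) → Fin a) := fun hc =>
    {τ | τ 0 = i ∧ S hc.1 (τ hc.2) ∪ (P hc.1).image (fun p => g (τ (hc.2 + p.succ)) p) ∈ F}
  have hΩ : #Ω = a ^ s := by
    have h : Ω = Fintype.piFinset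
        (Fin.cons (α := fun _ => Finset (Fin a)) ({i} : Finset (Fin a)) fun _ => univ) := by
      ext τ
      simp [Ω, Fintype.mem_piFinset, Fin.forall_fin_succ]
    rw [h, Fintype.card_piFinset, Fin.prod_univ_succ]
    simp
  have hcover : Ω ⊆ N₀ ∪ univ.biUnion N := by
    intro τ hτ
    have h0 := (mem_filter.1 hτ).2
    by_cases hinj : Function.Injective τ
    · obtain ⟨h, c, hc⟩ := hcon τ hinj h0
      exact mem_union_right _ (mem_biUnion.2 ⟨(h, c), mem_univ _,
        mem_filter.2 ⟨mem_univ _, h0, hc⟩⟩)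
    · exact mem_union_left _ (mem_filter.2 ⟨mem_univ _, h0, hinj⟩)
  have hle : (#Ω : ℝ) ≤ #N₀ + ∑ hc, (#(N hc) : ℝ) := by
    exact_mod_cast (card_le_card hcover).trans
      ((card_union_le _ _).trans (Nat.add_le_add_left card_biUnion_le _))
  have hN₀ : (#N₀ : ℝ) ≤ (s + 1) * (s + 1) * a ^ (s - 1) := by
    exact_mod_cast card_not_injective_le (s := s) i
  have hN : ∀ hc, (#(N hc) : ℝ) ≤ 2 * (ε * k ^ s) * a ^ s := fun hc =>
    card_window_le hF hk g hg i hc.2 (P hc.1) (hP hc.1) (S hc.1) hε (hgood hc.1) (hpair hc.1)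
  have hsumN : ∑ hc, (#(N hc) : ℝ) ≤ 2 * (s + 1) * (2 * (ε * k ^ s) * a ^ s) := by
    refine (sum_le_sum fun hc _ => hN hc).trans (le_of_eq ?_)
    rw [sum_const, nsmul_eq_mul, card_univ, Fintype.card_prod, Fintype.card_fin,
      Fintype.card_fin]
    push_cast
    ring
  have haR : (2 * (s + 1) * (s + 1) : ℝ) < a := by exact_mod_cast ha
  have ha0 : (0 : ℝ) < a := lt_of_le_of_lt (by positivity) haR
  have hpow : (a : ℝ) ^ s = a * a ^ (s - 1) := by rw [← pow_succ']; congr 1; omega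
  have h1 := mul_lt_mul_of_pos_right haR (pow_pos ha0 (s - 1))
  have h2 := mul_le_mul_of_nonneg_right hεs (pow_pos ha0 s).le
  rw [hΩ] at hle
  push_cast at hle
  nlinarith

open scoped Classical in
/-- If the sets `S h j` have small degree in `F` then the entries within each column of the
array `g₀` can be permuted so that no window `S h j ∪ {g j p | p ∈ P h}` is an edge of `F`. -/
theorem exists_column_perm {n k s a r : ℕ} {F : Finset (Finset (Fin n))} (hF : Uniform n k F)
    (hk : 1 ≤ k) (hs : 1 ≤ s) (g₀ : Fin a → Fin s → Fin n)
    (hg₀ : ∀ p, Function.Injective fun j => g₀ j p)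
    (P : Fin 2 → Finset (Fin s)) (hP : ∀ h, #(P h) = r)
    (S : Fin 2 → Fin a → Finset (Fin n)) {ε : ℝ} (hε : 0 ≤ ε)
    (hgood : ∀ h j, (deg F (S h j) : ℝ) ≤ ε * a ^ r)
    (hpair : ∀ h v, (#{j | ε * (a : ℝ) ^ (r - 1) < deg F (insert v (S h j))} : ℝ) ≤ ε * a)
    (hεs : 8 * (s + 1) * (ε * k ^ s) ≤ 1) (ha : 2 * (s + 1) * (s + 1) < a) :
    ∃ σ : Fin s → Equiv.Perm (Fin a), ∀ h j,
      S h j ∪ (P h).image (fun p => g₀ (σ p j) p) ∉ F := by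
  set bad : (Fin s → Equiv.Perm (Fin a)) → Finset (Fin a) := fun σ =>
    {j | ∃ h, S h j ∪ (P h).image (fun p => g₀ (σ p j) p) ∈ F} with hbad
  obtain ⟨σ, -, hσ⟩ := exists_min_image univ (fun σ => #(bad σ)) univ_nonempty
  refine ⟨σ, fun h i hi => ?_⟩
  obtain ⟨τ, hinj, h0, hτ⟩ := exists_transversal hF hk hs (fun j p => g₀ (σ p j) p)
    (fun p => (hg₀ p).comp (σ p).injective) P hP S hε hgood hpair hεs ha i
  set σ' : Fin s → Equiv.Perm (Fin a) := fun p =>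
    σ p * (Equiv.addRight p.succ : Equiv.Perm (Fin (s + 1))).viaEmbedding ⟨τ, hinj⟩ with hσ'
  have hin : ∀ c p, σ' p (τ c) = σ p (τ (c + p.succ)) := by
    intro c p
    have h := Equiv.Perm.viaEmbedding_apply
      (Equiv.addRight p.succ : Equiv.Perm (Fin (s + 1))) ⟨τ, hinj⟩ c
    simp only [Function.Embedding.coeFn_mk, Equiv.coe_addRight] at h
    rw [hσ', Equiv.Perm.mul_apply, h]
  have hout : ∀ j, j ∉ Set.range τ → ∀ p, σ' p j = σ p j := by
    intro j hj p
    have h := Equiv.Perm.viaEmbedding_apply_of_notMem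
      (Equiv.addRight p.succ : Equiv.Perm (Fin (s + 1))) ⟨τ, hinj⟩ j hj
    rw [hσ', Equiv.Perm.mul_apply, h]
  have hlt : bad σ' ⊂ bad σ := by
    have hnot : ∀ c, τ c ∉ bad σ' := by
      intro c hc
      obtain ⟨h, hh⟩ := (mem_filter.1 hc).2
      simp only [hin] at hh
      exact hτ h c hh
    refine Finset.ssubset_iff_subset_ne.2 ⟨fun j hj => ?_, fun heq => ?_⟩
    · by_cases hjr : j ∈ Set.range τ
      · obtain ⟨c, rfl⟩ := hjr
        exact absurd hj (hnot c)
      · obtain ⟨h, hh⟩ := (mem_filter.1 hj).2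
        simp only [hout j hjr] at hh
        exact mem_filter.2 ⟨mem_univ _, h, hh⟩
    · refine hnot 0 (heq ▸ ?_)
      rw [h0]
      exact mem_filter.2 ⟨mem_univ _, h, hi⟩
  exact absurd (card_lt_card hlt) (not_lt.2 (hσ σ' (mem_univ _)))

theorem exists_image_range_eq {α : Type*} [LinearOrder α] {S : Finset α} {m : ℕ} (hm : 1 ≤ m)
    (hS : S.card = m) : ∃ e : ℕ → α, (range m).image e = S := by
  refine ⟨fun y => if h : y < m then S.orderEmbOfFin hS ⟨y, h⟩ else S.orderEmbOfFin hS ⟨0, hm⟩, ?_⟩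
  ext v
  rw [← mem_coe (s := S), ← range_orderEmbOfFin S hS]
  simp only [mem_image, mem_range, Set.mem_range]
  constructor
  · rintro ⟨y, hy, rfl⟩
    exact ⟨⟨y, hy⟩, by rw [dif_pos hy]⟩
  · rintro ⟨⟨y, hy⟩, rfl⟩
    exact ⟨y, hy, by rw [dif_pos hy]⟩

/-- Concatenating the `ℓ`-sets `S j` and the rows of `g` in the order `S 0, g 0, S 1, g 1, …, S a`
gives a Hamiltonian `ℓ`-path, provided that the windows of this ordering are edges. -/
theorem exists_hamPath_of_windows {n d ℓ a : ℕ} (hl : 1 ≤ ℓ) (hd : ℓ ≤ d)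
    (hn : n = 2 * a * d + ℓ) {E : Finset (Finset (Fin n))} (S : ℕ → Finset (Fin n))
    (hS : ∀ j ≤ a, (S j).card = ℓ) (g : ℕ → ℕ → Fin n)
    (hcov : ∀ v, (∃ j ≤ a, v ∈ S j) ∨ ∃ j < a, ∃ p < 2 * d - ℓ, g j p = v)
    (hwin₀ : ∀ j < a, (S j ∪ (range d).image (g j)).card = d + ℓ →
      S j ∪ (range d).image (g j) ∈ E)
    (hwin₁ : ∀ j < a, (S (j + 1) ∪ (Ico (d - ℓ) (2 * d - ℓ)).image (g j)).card = d + ℓ →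
      S (j + 1) ∪ (Ico (d - ℓ) (2 * d - ℓ)).image (g j) ∈ E) :
    ∃ t : ℕ, ∃ f : ℕ → Fin n, IsPath n (d + ℓ) ℓ t E f ∧ pathVerts n (d + ℓ) ℓ t f = univ ∧
      pathEnd0 n ℓ f = S 0 ∧ pathEnd1 n (d + ℓ) ℓ t f = S a := by
  have he : ∀ j, ∃ e : ℕ → Fin n, j ≤ a → (range ℓ).image e = S j := fun j => by
    by_cases hj : j ≤ a
    · obtain ⟨e, he⟩ := exists_image_range_eq hl (hS j hj)
      exact ⟨e, fun _ => he⟩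
    · exact ⟨g 0, fun h => absurd h hj⟩
  choose e he using he
  set W := 2 * d with hW
  have hW0 : 0 < W := by omega
  set f : ℕ → Fin n := fun x =>
    if x % W < ℓ then e (x / W) (x % W) else g (x / W) (x % W - ℓ) with hf
  have hdiv : ∀ j y, y < W → (j * W + y) / W = j ∧ (j * W + y) % W = y := fun j y hy => by
    rw [mul_comm, Nat.mul_add_div hW0, Nat.mul_add_mod, Nat.div_eq_of_lt hy, Nat.mod_eq_of_lt hy]
    exact ⟨rfl, rfl⟩
  have hfe : ∀ j y, y < ℓ → f (j * W + y) = e j y := fun j y hy => by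
    obtain ⟨h1, h2⟩ := hdiv j y (by omega)
    simp only [hf, h1, h2, if_pos hy]
  have hfg : ∀ j p, p < W - ℓ → f (j * W + (ℓ + p)) = g j p := fun j p hp => by
    obtain ⟨h1, h2⟩ := hdiv j (ℓ + p) (by omega)
    simp only [hf, h1, h2, if_neg (Nat.not_lt.2 (Nat.le_add_right ℓ p)), Nat.add_sub_cancel_left]
  have hblock : ∀ j ≤ a, (range ℓ).image (fun y => f (j * W + y)) = S j := fun j hj => by
    rw [← he j hj]
    exact image_congr fun y hy => hfe j y (mem_range.1 (mem_coe.1 hy))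
  have hedge₀ : ∀ j < a, pathEdge n (d + ℓ) ℓ f (2 * j) = S j ∪ (range d).image (g j) := by
    intro j hj
    have h1 : 2 * j * (d + ℓ - ℓ) = j * W := by rw [Nat.add_sub_cancel, hW]; ring
    rw [pathEdge, h1, ← hblock j hj.le]
    ext v
    simp only [mem_image, mem_union, mem_range]
    constructor
    · rintro ⟨x, hx, rfl⟩
      by_cases hxl : x < ℓ
      · exact Or.inl ⟨x, hxl, rfl⟩
      · refine Or.inr ⟨x - ℓ, by omega, ?_⟩
        rw [← hfg j _ (by omega), Nat.add_sub_cancel' (by omega)]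
    · rintro (⟨x, hx, rfl⟩ | ⟨p, hp, rfl⟩)
      · exact ⟨x, by omega, rfl⟩
      · exact ⟨ℓ + p, by omega, hfg j p (by omega)⟩
  have hedge₁ : ∀ j < a, pathEdge n (d + ℓ) ℓ f (2 * j + 1) =
      S (j + 1) ∪ (Ico (d - ℓ) (W - ℓ)).image (g j) := by
    intro j hj
    have h1 : (2 * j + 1) * (d + ℓ - ℓ) = j * W + d := by rw [Nat.add_sub_cancel, hW]; ring
    rw [pathEdge, h1, ← hblock (j + 1) hj]
    have h2 : (j + 1) * W = j * W + W := by ring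
    ext v
    simp only [mem_image, mem_union, mem_range, mem_Ico, h2]
    constructor
    · rintro ⟨x, hx, rfl⟩
      by_cases hxd : x < d
      · refine Or.inr ⟨d - ℓ + x, by omega, ?_⟩
        rw [← hfg j _ (by omega)]
        congr 1
        omega
      · refine Or.inl ⟨x - d, by omega, ?_⟩
        congr 1
        omega
    · rintro (⟨x, hx, rfl⟩ | ⟨p, hp, rfl⟩)
      · refine ⟨d + x, by omega, ?_⟩
        congr 1
        omega
      · refine ⟨p + ℓ - d, by omega, ?_⟩
        rw [← hfg j p (by omega)]
        congr 1
        omega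
  have hlen : 2 * a * (d + ℓ - ℓ) + ℓ = n := by rw [Nat.add_sub_cancel, hn]
  have hlen' : a * W + ℓ = n := by rw [hn, hW]; ring
  have hverts : (range n).image f = univ := by
    refine eq_univ_of_forall fun v => ?_
    rcases hcov v with ⟨j, hj, hv⟩ | ⟨j, hj, p, hp, rfl⟩
    · rw [← hblock j hj] at hv
      obtain ⟨y, hy, rfl⟩ := mem_image.1 hv
      have := Nat.mul_le_mul_right W hj
      exact mem_image_of_mem f (mem_range.2 (by rw [mem_range] at hy; omega))
    · rw [← hfg j p hp]
      have := Nat.mul_le_mul_right W (Nat.succ_le_of_lt hj)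
      rw [Nat.succ_mul] at this
      exact mem_image_of_mem f (mem_range.2 (by omega))
  have hinj : Set.InjOn f (Set.Iio n) := by
    have h : Set.InjOn f (range n) := card_image_iff.1 (by rw [hverts]; simp)
    rwa [coe_range] at h
  refine ⟨2 * a, f, ⟨by rwa [hlen], fun i hi => ?_⟩, by rw [pathVerts, hlen, hverts], ?_, ?_⟩
  · have hcard : (pathEdge n (d + ℓ) ℓ f i).card = d + ℓ := by
      rw [pathEdge, card_image_of_injOn, card_range]
      intro x hx y hy hxy
      rw [coe_range, Set.mem_Iio] at hx hy
      have hi' := Nat.mul_le_mul_right (d + ℓ - ℓ) (Nat.succ_le_of_lt hi)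
      rw [Nat.succ_mul] at hi'
      have := hinj (Set.mem_Iio.2 (by omega)) (Set.mem_Iio.2 (by omega)) hxy
      omega
    rcases Nat.even_or_odd' i with ⟨j, rfl | rfl⟩
    · have hj : j < a := by omega
      rw [hedge₀ j hj] at hcard ⊢
      exact hwin₀ j hj hcard
    · have hj : j < a := by omega
      rw [hedge₁ j hj] at hcard ⊢
      exact hwin₁ j hj hcard
  · rw [pathEnd0, ← hblock 0 (Nat.zero_le a)]
    simp
  · have h1 : 2 * a * (d + ℓ - ℓ) = a * W := by rw [Nat.add_sub_cancel, hW]; ring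
    rw [pathEnd1, h1, ← hblock a le_rfl]
    ext v
    simp only [mem_image, mem_Ico, mem_range]
    constructor
    · rintro ⟨x, hx, rfl⟩
      exact ⟨x - a * W, by omega, by congr 1; omega⟩
    · rintro ⟨y, hy, rfl⟩
      exact ⟨a * W + y, by omega, rfl⟩

theorem exists_count_bound (k : ℕ) {ε : ℝ} (hε : 0 < ε) :
    ∃ δ : ℝ, 0 < δ ∧ ∃ a₀ : ℕ, ∀ a : ℕ, a₀ ≤ a → ∀ c : ℕ,
      (2 : ℝ) ^ c ≤ 2 * k * a * (1 + δ) ^ a → (c + 2 : ℝ) ≤ ε * a := by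
  have hlog : ∀ᶠ a : ℕ in Filter.atTop, Real.log a ≤ ε / 8 * a := by
    have h := (Real.isLittleO_log_id_atTop.comp_tendsto tendsto_natCast_atTop_atTop).def
      (show 0 < ε / 8 by positivity)
    filter_upwards [h] with a ha
    simp only [Function.comp, id, Real.norm_eq_abs, Nat.abs_cast] at ha
    exact (le_abs_self _).trans ha
  have hlin : ∀ᶠ a : ℕ in Filter.atTop, 2 * Real.log (2 * k) + 2 ≤ ε / 4 * a := by
    have h := (tendsto_natCast_atTop_atTop (R := ℝ)).const_mul_atTop
      (show 0 < ε / 4 by positivity)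
    exact h.eventually_ge_atTop _
  obtain ⟨a₀, ha₀⟩ := Filter.eventually_atTop.1 ((hlog.and hlin).and (Filter.eventually_ge_atTop 1))
  refine ⟨ε / 8, by positivity, a₀, fun a ha c hc => ?_⟩
  obtain ⟨⟨h1, h2⟩, h3⟩ := ha₀ a ha
  have haR : (0 : ℝ) < a := by exact_mod_cast h3
  have hpos : (0 : ℝ) < 2 * k * a * (1 + ε / 8) ^ a := lt_of_lt_of_le (by positivity) hc
  have hk : (0 : ℝ) < 2 * k := by
    by_contra h
    have hk0 : (2 * k : ℝ) = 0 := le_antisymm (not_lt.1 h) (by positivity)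
    rw [hk0] at hpos
    simp at hpos
  have h4 := Real.log_le_log (by positivity) hc
  rw [Real.log_pow, Real.log_mul (by positivity) (by positivity),
    Real.log_mul hk.ne' haR.ne', Real.log_pow] at h4
  have h5 : Real.log (1 + ε / 8) ≤ ε / 8 := by
    have := Real.log_le_sub_one_of_pos (show 0 < 1 + ε / 8 by positivity)
    linarith
  have h6 := mul_le_mul_of_nonneg_left h5 haR.le
  have h7 := mul_le_mul_of_nonneg_left Real.log_two_gt_d9.le (Nat.cast_nonneg (α := ℝ) c)
  have h8 : (0 : ℝ) ≤ c := Nat.cast_nonneg c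
  nlinarith

theorem exists_array {n a s : ℕ} {A R : Finset (Fin n)} (hAR : Disjoint A R) (hA : A.card = a)
    (hR : R.card = (s - 1) * a) (p₀ : Fin s) :
    ∃ g : Fin a → Fin s → Fin n, (∀ p, Function.Injective fun j => g j p) ∧
      (∀ j p, g j p ∈ A ↔ p = p₀) ∧ ∀ v ∈ A ∪ R, ∃ j p, g j p = v := by
  let eA : Fin a ≃ A := Fintype.equivOfCardEq (by simp [hA])
  let eR : Fin a × {p : Fin s // p ≠ p₀} ≃ R := Fintype.equivOfCardEq (by
    rw [Fintype.card_prod, Fintype.card_subtype_compl, Fintype.card_subtype_eq]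
    simp [hR, mul_comm])
  let g : Fin a → Fin s → Fin n := fun j p => if h : p = p₀ then eA j else eR (j, ⟨p, h⟩)
  have hg₀ : ∀ j, g j p₀ = eA j := fun j => dif_pos rfl
  have hg₁ : ∀ j p (h : p ≠ p₀), g j p = eR (j, ⟨p, h⟩) := fun j p h => dif_neg h
  refine ⟨g, fun p => ?_, fun j p => ?_, fun v hv => ?_⟩
  · by_cases h : p = p₀
    · subst h
      intro j j' hj
      simp only [hg₀] at hj
      exact eA.injective (Subtype.ext hj)
    · intro j j' hj
      simp only [hg₁ _ p h] at hj
      exact congrArg Prod.fst (eR.injective (Subtype.ext hj))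
  · by_cases h : p = p₀
    · subst h
      simp [hg₀]
    · rw [hg₁ _ p h]
      exact iff_of_false (fun hmem => disjoint_left.1 hAR hmem (eR _).2) h
  · rcases mem_union.1 hv with hv | hv
    · exact ⟨eA.symm ⟨v, hv⟩, p₀, by rw [hg₀]; simp⟩
    · refine ⟨(eR.symm ⟨v, hv⟩).1, (eR.symm ⟨v, hv⟩).2.1, ?_⟩
      rw [hg₁ _ _ (eR.symm ⟨v, hv⟩).2.2]
      simp

section MissingEdges

variable {n k : ℕ}

/-- The `k`-sets meeting `A` in exactly one vertex that are not edges. -/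
def missingEdges (k : ℕ) (E : Finset (Finset (Fin n))) (A : Finset (Fin n)) :
    Finset (Finset (Fin n)) :=
  {e ∈ powersetCard k univ | (e ∩ A).card = 1 ∧ e ∉ E}

theorem mem_missingEdges {E : Finset (Finset (Fin n))} {A e : Finset (Fin n)} :
    e ∈ missingEdges k E A ↔ e.card = k ∧ (e ∩ A).card = 1 ∧ e ∉ E := by
  simp [missingEdges]

variable {a : ℕ} {E : Finset (Finset (Fin n))} {A B : Finset (Fin n)} {ρ : ℝ}

theorem deg_missingEdges_left (hk : 1 ≤ k) (hAB : A ∪ B = univ)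
    (hb : B.card ≤ 2 * k * a) (hρ : 0 ≤ ρ) {v : Fin n} (hv : v ∈ A)
    (hdeg : (1 - ρ) * (B.card.choose (k - 1) : ℝ) ≤ degIn E {v} B ∅ (k - 1) 0) :
    (deg (missingEdges k E A) {v} : ℝ) ≤ ρ * (2 * k) ^ k * a ^ (k - 1) := by
  have hdisj : Disjoint (missingEdges k E A) E :=
    disjoint_left.2 fun e he => (mem_missingEdges.1 he).2.2
  have h := deg_add_degIn_le hdisj {v} B ∅ (k - 1) 0 (by
    intro e he hve
    obtain ⟨h1, h2, -⟩ := mem_missingEdges.1 he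
    rw [singleton_subset_iff] at hve
    obtain ⟨w, hw⟩ := card_eq_one.1 h2
    have hsub : e \ {v} ⊆ B := by
      intro x hx
      rw [mem_sdiff, mem_singleton] at hx
      have hxAB : x ∈ A ∪ B := hAB ▸ mem_univ x
      rcases mem_union.1 hxAB with hxA | hxB
      · have hx' : x ∈ e ∩ A := mem_inter.2 ⟨hx.1, hxA⟩
        have hv' : v ∈ e ∩ A := mem_inter.2 ⟨hve, hv⟩
        rw [hw, mem_singleton] at hx' hv'
        exact absurd (hx'.trans hv'.symm) hx.2
      · exact hxB
    refine ⟨by rwa [union_empty], ?_, by simp⟩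
    rw [inter_eq_left.2 hsub, card_sdiff_of_subset (singleton_subset_iff.2 hve), h1,
      card_singleton])
  have h' : (deg (missingEdges k E A) {v} : ℝ) + degIn E {v} B ∅ (k - 1) 0 ≤
      B.card.choose (k - 1) := by exact_mod_cast (by simpa using h)
  have hk1 : (1 : ℝ) ≤ 2 * k := by
    have : (1 : ℝ) ≤ k := by exact_mod_cast hk
    linarith
  calc (deg (missingEdges k E A) {v} : ℝ) ≤ ρ * B.card.choose (k - 1) := by linarith
    _ ≤ ρ * ((2 * k * a : ℝ) ^ (k - 1)) := by
        refine mul_le_mul_of_nonneg_left ?_ hρ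
        exact_mod_cast (Nat.choose_le_pow _ _).trans (Nat.pow_le_pow_left hb _)
    _ = ρ * (2 * k) ^ (k - 1) * a ^ (k - 1) := by rw [mul_pow]; ring
    _ ≤ ρ * (2 * k) ^ k * a ^ (k - 1) := by
        gcongr
        · omega

theorem deg_missingEdges_right (hAB : A ∪ B = univ) (hd : Disjoint A B) (ha : A.card = a)
    (hb : B.card ≤ 2 * k * a) (hρ : 0 ≤ ρ) {L : Finset (Fin n)} {m : ℕ} (hL : L ⊆ B)
    (hLm : L.card = m) (hm : m < k)
    (hdeg : (1 - ρ) * ((A.card : ℝ) * (B.card.choose (k - m - 1) : ℝ)) ≤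
      degIn E L A B 1 (k - m - 1)) :
    (deg (missingEdges k E A) L : ℝ) ≤ ρ * (2 * k) ^ k * a ^ (k - m) := by
  have hdisj : Disjoint (missingEdges k E A) E :=
    disjoint_left.2 fun e he => (mem_missingEdges.1 he).2.2
  have h := deg_add_degIn_le hdisj L A B 1 (k - m - 1) (by
    intro e he hLe
    obtain ⟨h1, h2, -⟩ := mem_missingEdges.1 he
    have hA : (e \ L) ∩ A = e ∩ A := by
      ext x
      simp only [mem_inter, mem_sdiff]
      exact ⟨fun h => ⟨h.1.1, h.2⟩, fun h => ⟨⟨h.1, fun hx =>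
        disjoint_left.1 hd h.2 (hL hx)⟩, h.2⟩⟩
    have hsub : e \ L ⊆ A ∪ B := hAB ▸ subset_univ _
    refine ⟨hsub, by rw [hA, h2], ?_⟩
    have h3 : ((e \ L) ∩ A).card + ((e \ L) ∩ B).card = (e \ L).card := by
      rw [← card_union_of_disjoint (hd.mono inter_subset_right inter_subset_right),
        ← inter_union_distrib_left, inter_eq_left.2 hsub]
    rw [hA, h2, card_sdiff_of_subset hLe, h1, hLm] at h3
    omega)
  have h' : (deg (missingEdges k E A) L : ℝ) + degIn E L A B 1 (k - m - 1) ≤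
      A.card * B.card.choose (k - m - 1) := by exact_mod_cast (by simpa using h)
  have hk1 : (1 : ℝ) ≤ 2 * k := by
    have : (1 : ℝ) ≤ k := by exact_mod_cast (by omega : 1 ≤ k)
    linarith
  calc (deg (missingEdges k E A) L : ℝ) ≤ ρ * (a * B.card.choose (k - m - 1)) := by
        rw [ha] at h' hdeg; linarith
    _ ≤ ρ * (a * (2 * k * a : ℝ) ^ (k - m - 1)) := by
        refine mul_le_mul_of_nonneg_left (mul_le_mul_of_nonneg_left ?_ (Nat.cast_nonneg a)) hρ
        exact_mod_cast (Nat.choose_le_pow _ _).trans (Nat.pow_le_pow_left hb _)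
    _ = ρ * (2 * k) ^ (k - m - 1) * a ^ (k - m) := by
        rw [mul_pow, show k - m = k - m - 1 + 1 by omega, pow_succ, Nat.add_sub_cancel]; ring
    _ ≤ ρ * (2 * k) ^ k * a ^ (k - m) := by
        gcongr
        · omega

end MissingEdges

theorem exists_linking_sets {n d ℓ a : ℕ} (hd : 1 ≤ d) {F : Finset (Finset (Fin n))}
    (hF : Uniform n (d + ℓ) F) {ρ ε δ : ℝ} (hε : 0 < ε) (hδ : 0 < δ) (ha : 2 * ℓ ≤ a) (ha0 : 0 < a)
    (hn : n ≤ 2 * (d + ℓ) * a)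
    (hdeg : ∀ v, (deg F {v} : ℝ) ≤ ρ * a ^ (d + ℓ - 1))
    (hρ : 2 ^ (d + ℓ) * (2 * (d + ℓ : ℕ)) * ρ / ε + 2 ^ (d + ℓ) * ρ / (ε * δ) <
      1 / (2 ^ ℓ * (ℓ.factorial : ℝ)))
    (hcount : ∀ c : ℕ, (2 : ℝ) ^ c ≤ 2 * (d + ℓ : ℕ) * a * (1 + δ) ^ a → (c + 2 : ℝ) ≤ ε * a)
    {B L₀ L₁ : Finset (Fin n)} (hL₀ : L₀ ⊆ B) (hL₁ : L₁ ⊆ B) (hL : Disjoint L₀ L₁)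
    (hL₀ℓ : L₀.card = ℓ) (hL₁ℓ : L₁.card = ℓ) (hB : a + a * ℓ ≤ B.card)
    (hdeg₀ : (deg F L₀ : ℝ) ≤ ε * a ^ d) (hdeg₁ : (deg F L₁ : ℝ) ≤ ε * a ^ d) :
    ∃ S : ℕ → Finset (Fin n), S 0 = L₀ ∧ S a = L₁ ∧
      (∀ j ≤ a, S j ⊆ B ∧ (S j).card = ℓ ∧ (deg F (S j) : ℝ) ≤ ε * a ^ d) ∧
      (∀ i ≤ a, ∀ j ≤ a, i ≠ j → Disjoint (S i) (S j)) ∧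
      ∀ v, (#{j ∈ range (a + 1) | ε * (a : ℝ) ^ (d - 1) < deg F (insert v (S j))} : ℝ) ≤
        ε * a := by
  have hLL : (L₀ ∪ L₁).card = 2 * ℓ := by rw [card_union_of_disjoint hL, hL₀ℓ, hL₁ℓ, two_mul]
  have hX : (B \ (L₀ ∪ L₁)).card = B.card - 2 * ℓ := by
    rw [card_sdiff_of_subset (union_subset hL₀ hL₁), hLL]
  obtain ⟨T, hT, hTd, hTsum⟩ := exists_good_sequence (k := d + ℓ) (by omega) hF hε hδ ha ha0 hn
    hdeg hρ (B \ (L₀ ∪ L₁)) (a - 1) (by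
      have h := Nat.sub_mul a 1 ℓ
      have h' := Nat.mul_le_mul_right ℓ ha0
      omega)
  simp only [Nat.add_sub_cancel] at hT hTsum
  have hTL : ∀ j < a - 1, Disjoint L₀ (T j) ∧ Disjoint L₁ (T j) := fun j hj => by
    have h := (disjoint_sdiff (s := L₀ ∪ L₁) (t := B)).mono_right (hT j hj).1
    exact ⟨h.mono_left subset_union_left, h.mono_left subset_union_right⟩
  set S : ℕ → Finset (Fin n) := fun j => if j = 0 then L₀ else if j = a then L₁ else T (j - 1)
    with hS
  have hS0 : S 0 = L₀ := if_pos rfl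
  have hSa : S a = L₁ := by simp [hS, ha0.ne']
  have hSj : ∀ j, j ≠ 0 → j ≠ a → S j = T (j - 1) := fun j h0 h1 => by
    simp only [hS, if_neg h0, if_neg h1]
  have hlt : ∀ i ≤ a, ∀ j ≤ a, i < j → Disjoint (S i) (S j) := fun i hi j hj hij => by
    rcases eq_or_ne i 0 with rfl | hi0 <;> rcases eq_or_ne j a with rfl | hja
    · rwa [hS0, hSa]
    · rw [hS0, hSj j (by omega) hja]
      exact (hTL _ (by omega)).1
    · rw [hSa, hSj i hi0 (by omega)]
      exact (hTL _ (by omega)).2.symm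
    · rw [hSj i hi0 (by omega), hSj j (by omega) hja]
      exact hTd _ (by omega) _ (by omega) (by omega)
  refine ⟨S, hS0, hSa, fun j hj => ?_, fun i hi j hj hij => ?_, fun v => ?_⟩
  · rcases eq_or_ne j 0 with rfl | hj0
    · rw [hS0]; exact ⟨hL₀, hL₀ℓ, hdeg₀⟩
    rcases eq_or_ne j a with rfl | hja
    · rw [hSa]; exact ⟨hL₁, hL₁ℓ, hdeg₁⟩
    rw [hSj j hj0 hja]
    obtain ⟨h1, h2, h3⟩ := hT (j - 1) (by omega)
    exact ⟨h1.trans sdiff_subset, h2, h3⟩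
  · rcases lt_or_gt_of_ne hij with h | h
    · exact hlt i hi j hj h
    · exact (hlt j hj i hi h).symm
  · set c := #{j ∈ range (a - 1) | ε * (a : ℝ) ^ (d - 1) < deg F (insert v (T j))} with hc
    have h1 : #{j ∈ range (a + 1) | ε * (a : ℝ) ^ (d - 1) < deg F (insert v (S j))} ≤ c + 2 := by
      have hsub : {j ∈ range (a + 1) | ε * (a : ℝ) ^ (d - 1) < deg F (insert v (S j))} ⊆
          {j ∈ range (a - 1) | ε * (a : ℝ) ^ (d - 1) < deg F (insert v (T j))}.image (· + 1) ∪
            {0, a} := by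
        intro j hj
        rw [mem_filter, mem_range] at hj
        by_cases h0 : j = 0
        · simp [h0]
        by_cases h1 : j = a
        · simp [h1]
        rw [hSj j h0 h1] at hj
        refine mem_union_left _ (mem_image.2 ⟨j - 1, mem_filter.2 ⟨mem_range.2 ?_, hj.2⟩, ?_⟩)
        all_goals omega
      refine (card_le_card hsub).trans ((card_union_le _ _).trans ?_)
      exact add_le_add card_image_le card_le_two
    have h2 : (2 : ℝ) ^ c ≤ n * (1 + δ) ^ (a - 1) :=
      (single_le_sum (f := fun v => (2 : ℝ) ^
        #{j ∈ range (a - 1) | ε * (a : ℝ) ^ (d - 1) < deg F (insert v (T j))})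
        (fun _ _ => by positivity) (mem_univ v)).trans hTsum
    have h3 : (2 : ℝ) ^ c ≤ 2 * (d + ℓ : ℕ) * a * (1 + δ) ^ a := by
      refine h2.trans (mul_le_mul (by exact_mod_cast hn) ?_ (by positivity) (by positivity))
      exact pow_le_pow_right₀ (by linarith) (Nat.sub_le a 1)
    exact (by exact_mod_cast h1 : (_ : ℝ) ≤ (c : ℝ) + 2).trans (hcount c h3)

theorem exists_hamPath_of_missingEdges {n d ℓ a : ℕ} (hl : 1 ≤ ℓ) (hld : ℓ < d)
    {E : Finset (Finset (Fin n))} {A B : Finset (Fin n)} (hAB : Disjoint A B)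
    (hAB' : A ∪ B = univ) (hA : A.card = a) (hB : B.card = (2 * d - 1) * a + ℓ)
    {ρ ε δ : ℝ} (hε : 0 < ε) (hδ : 0 < δ) (ha : 2 * ℓ ≤ a)
    (ha' : 2 * (2 * d - ℓ + 1) * (2 * d - ℓ + 1) < a)
    (hεs : 8 * ((2 * d - ℓ : ℕ) + 1) * (ε * (d + ℓ : ℕ) ^ (2 * d - ℓ)) ≤ 1)
    (hdeg : ∀ v, (deg (missingEdges (d + ℓ) E A) {v} : ℝ) ≤ ρ * a ^ (d + ℓ - 1))
    (hρ : 2 ^ (d + ℓ) * (2 * (d + ℓ : ℕ)) * ρ / ε + 2 ^ (d + ℓ) * ρ / (ε * δ) <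
      1 / (2 ^ ℓ * (ℓ.factorial : ℝ)))
    (hcount : ∀ c : ℕ, (2 : ℝ) ^ c ≤ 2 * (d + ℓ : ℕ) * a * (1 + δ) ^ a → (c + 2 : ℝ) ≤ ε * a)
    {L₀ L₁ : Finset (Fin n)} (hL₀ : L₀ ⊆ B) (hL₁ : L₁ ⊆ B) (hL : Disjoint L₀ L₁)
    (hL₀ℓ : L₀.card = ℓ) (hL₁ℓ : L₁.card = ℓ)
    (hdeg₀ : (deg (missingEdges (d + ℓ) E A) L₀ : ℝ) ≤ ε * a ^ d)
    (hdeg₁ : (deg (missingEdges (d + ℓ) E A) L₁ : ℝ) ≤ ε * a ^ d) :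
    ∃ t : ℕ, ∃ f : ℕ → Fin n, IsPath n (d + ℓ) ℓ t E f ∧ pathVerts n (d + ℓ) ℓ t f = univ ∧
      pathEnd0 n ℓ f = L₀ ∧ pathEnd1 n (d + ℓ) ℓ t f = L₁ := by
  obtain ⟨m, rfl⟩ : ∃ m, d = m + 1 := ⟨d - 1, by omega⟩
  set d := m + 1 with hd
  set s := 2 * d - ℓ with hs
  have ha0 : 0 < a := by omega
  have hdm : 2 * d - 1 = 2 * m + 1 := by omega
  have hn : n = 2 * a * d + ℓ := by
    have h := card_union_of_disjoint hAB
    rw [hAB', card_univ, Fintype.card_fin, hA, hB, hdm] at h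
    rw [h, hd]; ring
  have hn' : n ≤ 2 * (d + ℓ) * a := by
    have h : 2 * (d + ℓ) * a = 2 * a * d + 2 * (ℓ * a) := by ring
    have h' := Nat.mul_le_mul_left ℓ ha0
    omega
  have hF : Uniform n (d + ℓ) (missingEdges (d + ℓ) E A) := fun e he => (mem_missingEdges.1 he).1
  have hB' : a + a * ℓ ≤ B.card := by
    have h := Nat.mul_le_mul_right a (show ℓ + 1 ≤ 2 * d - 1 by omega)
    rw [Nat.add_mul, mul_comm ℓ a] at h
    omega
  obtain ⟨S, hS0, hSa, hS, hSd, hbad⟩ := exists_linking_sets (by omega) hF hε hδ ha ha0 hn' hdeg hρ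
    hcount hL₀ hL₁ hL hL₀ℓ hL₁ℓ hB' hdeg₀ hdeg₁
  set R := B \ (range (a + 1)).biUnion S with hR
  have hUB : (range (a + 1)).biUnion S ⊆ B :=
    biUnion_subset.2 fun j hj => (hS j (by rw [mem_range] at hj; omega)).1
  have hRcard : R.card = (s - 1) * a := by
    have hU : ((range (a + 1)).biUnion S).card = (a + 1) * ℓ := by
      rw [card_biUnion fun i hi j hj hij => hSd i (by rw [mem_coe, mem_range] at hi; omega) j
        (by rw [mem_coe, mem_range] at hj; omega) hij,
        sum_congr rfl fun j hj => (hS j (by rw [mem_range] at hj; omega)).2.1]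
      simp
    have h1 : (a + 1) * ℓ = ℓ * a + ℓ := by ring
    have h2 := Nat.sub_mul (2 * d - 1) ℓ a
    rw [hR, card_sdiff_of_subset hUB, hU, hB, show s - 1 = 2 * d - 1 - ℓ by omega, h1]
    omega
  have hp₀ : d - ℓ < s := by omega
  obtain ⟨g₀, hg₀, hg₀A, hg₀R⟩ := exists_array (hAB.mono_right (sdiff_subset : R ⊆ B)) hA hRcard
    ⟨d - ℓ, hp₀⟩
  have hr : ∀ i ∈ range d, i < s := fun i hi => by rw [mem_range] at hi; omega
  have hI : ∀ i ∈ Ico (d - ℓ) s, i < s := fun i hi => (mem_Ico.1 hi).2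
  have hcols : ∀ h : Fin 2, ∀ v, (#{j : Fin a | ε * (a : ℝ) ^ (d - 1) <
      deg (missingEdges (d + ℓ) E A) (insert v (S (j + h)))} : ℝ) ≤ ε * a := fun h v => by
    refine le_trans ?_ (hbad v)
    rw [Nat.cast_le]
    refine card_le_card_of_injOn (fun j : Fin a => (j : ℕ) + h) (fun j hj => ?_) fun i _ j _ hij =>
      Fin.ext (Nat.add_right_cancel hij)
    simp only [coe_filter, mem_univ, true_and, Set.mem_ofPred_eq, mem_range] at hj ⊢
    exact ⟨by omega, hj⟩
  obtain ⟨σ, hσ⟩ := exists_column_perm hF (by omega) (by omega : 1 ≤ s) g₀ hg₀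
    ![(range d).attachFin hr, (Ico (d - ℓ) s).attachFin hI] (r := d) (fun h => by
      fin_cases h
      · simp
      · simp only [Fin.mk_one, Matrix.cons_val_one, Matrix.cons_val_fin_one, card_attachFin,
          Nat.card_Ico]
        omega)
    (fun h j => S (j + h)) hε.le (fun h j => (hS _ (by omega)).2.2) hcols hεs ha'
  let g : ℕ → ℕ → Fin n := fun j p =>
    if h : j < a ∧ p < s then g₀ (σ ⟨p, h.2⟩ ⟨j, h.1⟩) ⟨p, h.2⟩ else g₀ ⟨0, ha0⟩ ⟨d - ℓ, hp₀⟩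
  have hg : ∀ (j : Fin a) (p : Fin s), g j p = g₀ (σ p j) p := fun j p => dif_pos ⟨j.2, p.2⟩
  have hattach : ∀ (Q : Finset ℕ) (hQ : ∀ i ∈ Q, i < s) (j : Fin a),
      (Q.attachFin hQ).image (fun p => g₀ (σ p j) p) = Q.image (g j) := fun Q hQ j => by
    ext v
    simp only [mem_image, mem_attachFin]
    constructor
    · rintro ⟨p, hp, rfl⟩
      exact ⟨p, hp, hg j p⟩
    · rintro ⟨p, hp, rfl⟩
      exact ⟨⟨p, hQ p hp⟩, hp, (hg j ⟨p, hQ p hp⟩).symm⟩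
  have hwin : ∀ (Q : Finset ℕ), (∀ i ∈ Q, i < s) → d - ℓ ∈ Q → ∀ (j : Fin a) (i : ℕ), i ≤ a →
      S i ∪ Q.image (g j) ∉ missingEdges (d + ℓ) E A → (S i ∪ Q.image (g j)).card = d + ℓ →
      S i ∪ Q.image (g j) ∈ E := by
    intro Q hQ hpQ j i hi hnot hcard
    by_contra hE
    refine hnot (mem_missingEdges.2 ⟨hcard, card_eq_one.2 ⟨g j (d - ℓ), ?_⟩, hE⟩)
    have hgA : ∀ p (hp : p < s), g j p ∈ A ↔ p = d - ℓ := fun p hp => by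
      rw [hg j ⟨p, hp⟩, hg₀A, Fin.mk.injEq]
    ext v
    simp only [mem_inter, mem_union, mem_image, mem_singleton]
    constructor
    · rintro ⟨hv | ⟨p, hp, rfl⟩, hvA⟩
      · exact absurd ((hS i hi).1 hv) (disjoint_left.1 hAB hvA)
      · rw [(hgA p (hQ p hp)).1 hvA]
    · rintro rfl
      exact ⟨Or.inr ⟨_, hpQ, rfl⟩, (hgA _ hp₀).2 rfl⟩
  rw [← hS0, ← hSa]
  refine exists_hamPath_of_windows hl hld.le hn S (fun j hj => (hS j hj).2.1) g (fun v => ?_)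
    (fun j hj => hwin _ hr (mem_range.2 (by omega)) ⟨j, hj⟩ j hj.le ?_)
    (fun j hj => hwin _ hI (mem_Ico.2 ⟨le_rfl, hp₀⟩) ⟨j, hj⟩ (j + 1) hj ?_)
  · by_cases hv : v ∈ (range (a + 1)).biUnion S
    · obtain ⟨j, hj, hvj⟩ := mem_biUnion.1 hv
      exact Or.inl ⟨j, by rw [mem_range] at hj; omega, hvj⟩
    · have hvAR : v ∈ A ∪ R := by
        rw [hR, mem_union, mem_sdiff]
        have h := mem_univ v
        rw [← hAB', mem_union] at h
        tauto
      obtain ⟨j, p, rfl⟩ := hg₀R v hvAR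
      refine Or.inr ⟨(σ p).symm j, Fin.is_lt _, p, p.2, ?_⟩
      rw [hg, Equiv.apply_symm_apply]
  · have h := hσ 0 ⟨j, hj⟩
    simp only [Matrix.cons_val_zero] at h
    rw [hattach] at h
    exact h
  · have h := hσ 1 ⟨j, hj⟩
    simp only [Matrix.cons_val_one, Matrix.cons_val_fin_one] at h
    rw [hattach] at h
    exact h

/-- Han–Zhao, Lemma 3.10. For any integers `k ≥ 3` and `1 ≤ ℓ < k/2`
there exists `ρ > 0` such that every sufficiently large `k`-uniform hypergraph `H` with a
partition `V(H) = A* ∪ B*` and two disjoint ℓ-sets `L₀, L₁ ⊆ B*` satisfying (i)–(iv)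
contains a Hamiltonian ℓ-path with `L₀` and `L₁` as ends. -/
theorem statement6 (k ℓ : ℕ) (hk : 3 ≤ k) (hl : 1 ≤ ℓ) (hlk : 2 * ℓ < k) :
    ∃ ρ : ℝ, 0 < ρ ∧ ∃ n₀ : ℕ, ∀ n : ℕ, n₀ ≤ n →
      ∀ E : Finset (Finset (Fin n)), Uniform n k E →
        ∀ Astar Bstar L₀ L₁ : Finset (Fin n),
          Disjoint Astar Bstar → Astar ∪ Bstar = Finset.univ →
          L₀ ⊆ Bstar → L₁ ⊆ Bstar → Disjoint L₀ L₁ → L₀.card = ℓ → L₁.card = ℓ →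
          -- (i)
          Bstar.card = (2 * k - 2 * ℓ - 1) * Astar.card + ℓ →
          -- (ii)
          (∀ v ∈ Astar,
            (1 - ρ) * (Bstar.card.choose (k - 1) : ℝ) ≤
              (degIn E {v} Bstar ∅ (k - 1) 0 : ℝ)) →
          -- (iii)
          (∀ v ∈ Bstar,
            (1 - ρ) * ((Astar.card : ℝ) * (Bstar.card.choose (k - 2) : ℝ)) ≤
              (degIn E {v} Astar Bstar 1 (k - 2) : ℝ)) →
          -- (iv)
          (1 - ρ) * ((Astar.card : ℝ) * (Bstar.card.choose (k - ℓ - 1) : ℝ)) ≤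
            (degIn E L₀ Astar Bstar 1 (k - ℓ - 1) : ℝ) →
          (1 - ρ) * ((Astar.card : ℝ) * (Bstar.card.choose (k - ℓ - 1) : ℝ)) ≤
            (degIn E L₁ Astar Bstar 1 (k - ℓ - 1) : ℝ) →
          ∃ t : ℕ, ∃ f : ℕ → Fin n, IsPath n k ℓ t E f ∧
            pathVerts n k ℓ t f = Finset.univ ∧
            pathEnd0 n ℓ f = L₀ ∧ pathEnd1 n k ℓ t f = L₁ := by
  obtain ⟨d, rfl⟩ : ∃ d, k = d + ℓ := ⟨k - ℓ, by omega⟩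
  set s := 2 * d - ℓ with hs
  have hkR : (0 : ℝ) < (d + ℓ : ℕ) := by exact_mod_cast (by omega : 0 < d + ℓ)
  set ε : ℝ := 1 / (8 * (s + 1) * (d + ℓ : ℕ) ^ s) with hε'
  have hε : 0 < ε := by positivity
  obtain ⟨δ, hδ, a₁, hcount⟩ := exists_count_bound (d + ℓ) hε
  set K : ℝ := 2 ^ (d + ℓ) * (2 * (d + ℓ : ℕ)) / ε + 2 ^ (d + ℓ) / (ε * δ) with hK'
  have hK : 0 < K := by positivity
  set κ : ℝ := 1 / (2 ^ ℓ * (ℓ.factorial : ℝ)) with hκ'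
  have hκ : 0 < κ := by positivity
  set η : ℝ := min ε (κ / (2 * K)) with hη'
  have hη : 0 < η := by positivity
  have hηε : η ≤ ε := min_le_left _ _
  have hηκ : 2 ^ (d + ℓ) * (2 * (d + ℓ : ℕ)) * η / ε + 2 ^ (d + ℓ) * η / (ε * δ) < κ := by
    have h : η * (2 * K) ≤ κ := (le_div_iff₀ (by positivity)).1 (min_le_right _ _)
    have h' : 2 ^ (d + ℓ) * (2 * (d + ℓ : ℕ)) * η / ε + 2 ^ (d + ℓ) * η / (ε * δ) = η * K := by
      rw [hK']; ring
    rw [h']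
    linarith
  have hρη : η / (2 * (d + ℓ : ℕ)) ^ (d + ℓ) * (2 * (d + ℓ : ℕ) : ℝ) ^ (d + ℓ) = η :=
    div_mul_cancel₀ _ (by positivity)
  set a₀ := a₁ + 2 * ℓ + 2 * (s + 1) * (s + 1) + 1 with ha₀
  refine ⟨η / (2 * (d + ℓ : ℕ)) ^ (d + ℓ), by positivity, 2 * (d + ℓ) * a₀,
    fun n hn E _ A B L₀ L₁ hAB hAB' hL₀ hL₁ hL hL₀ℓ hL₁ℓ hB hA' hB' hL₀' hL₁' => ?_⟩
  obtain ⟨a, ha⟩ : ∃ a, A.card = a := ⟨_, rfl⟩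
  rw [ha, show 2 * (d + ℓ) - 2 * ℓ - 1 = 2 * d - 1 by omega] at hB
  have hn' : n = a + B.card := by
    rw [← ha, ← card_union_of_disjoint hAB, hAB', card_univ, Fintype.card_fin]
  have hna : a₀ ≤ a := by
    by_contra h
    have h1 : (2 * d - 1) * a + a = 2 * d * a := by
      rw [Nat.sub_mul, one_mul, Nat.sub_add_cancel (Nat.le_mul_of_pos_left a (by omega))]
    have h2 := Nat.mul_le_mul_left (2 * (d + ℓ)) (Nat.succ_le_of_lt (not_le.1 h))
    have h3 : 2 * (d + ℓ) * (a + 1) = 2 * d * a + 2 * ℓ * a + 2 * d + 2 * ℓ := by ring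
    rw [Nat.succ_eq_add_one] at h2
    omega
  have hBa : B.card ≤ 2 * (d + ℓ) * a := by
    have h1 : 2 * (d + ℓ) * a = 2 * d * a + ℓ * a + ℓ * a := by ring
    have h2 : (2 * d - 1) * a ≤ 2 * d * a := Nat.mul_le_mul_right a (Nat.sub_le _ _)
    have h3 : ℓ * 1 ≤ ℓ * a := Nat.mul_le_mul_left ℓ (by omega)
    omega
  have hdegL : ∀ L : Finset (Fin n), L ⊆ B → L.card = ℓ →
      (1 - η / (2 * (d + ℓ : ℕ)) ^ (d + ℓ)) *
        ((A.card : ℝ) * (B.card.choose (d + ℓ - ℓ - 1) : ℝ)) ≤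
          (degIn E L A B 1 (d + ℓ - ℓ - 1) : ℝ) →
      (deg (missingEdges (d + ℓ) E A) L : ℝ) ≤ ε * a ^ d := by
    intro L hLB hLℓ hdeg
    have h := deg_missingEdges_right hAB' hAB ha hBa (by positivity) hLB hLℓ (by omega) hdeg
    rw [hρη, Nat.add_sub_cancel] at h
    exact h.trans (by gcongr)
  refine exists_hamPath_of_missingEdges (ρ := η) hl (by omega) hAB hAB' ha hB hε hδ (by omega)
    (by rw [← hs]; omega) (le_of_eq ?_) (fun v => ?_) hηκ (hcount a (by omega)) hL₀ hL₁ hL hL₀ℓ hL₁ℓ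
    (hdegL L₀ hL₀ hL₀ℓ hL₀') (hdegL L₁ hL₁ hL₁ℓ hL₁')
  · rw [← hs, hε']
    field_simp
  · have hv := mem_univ v
    rw [← hAB', mem_union] at hv
    rcases hv with hv | hv
    · have h := deg_missingEdges_left (by omega) hAB' hBa (by positivity) hv (hA' v hv)
      rwa [hρη] at h
    · have h := deg_missingEdges_right (ρ := η / (2 * (d + ℓ : ℕ)) ^ (d + ℓ)) hAB' hAB ha hBa
        (by positivity) (singleton_subset_iff.2 hv) (card_singleton v) (by omega)
        (by rw [show d + ℓ - 1 - 1 = d + ℓ - 2 by omega]; exact hB' v hv)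
      rwa [hρη] at h
end

section
/- For all integers k ≥ 3 and 1 ≤ ℓ < k/2 and every δ > 0 there exist ε, θ, ξ > 0 and n₀ such that the following holds. Let n ≥ n₀ be divisible by k−ℓ, let H = (V,E) be an (ℓ,ξ)-extremal k-uniform hypergraph on n vertices with δ_{k−2}(H) > δ_{k−2}(X_{k,ℓ}(n)), let V = A ∪ B be a minimal extremal partition, and define A_ε, B_ε as above. Then for every integer m ≤ k−2 and every m-set M ⊆ B_ε, d(M, A_ε^(1)B_ε^(k−m−1)) + ((k−m)/2)·d(M, B_ε^(k−m)) ≥ (1−δ)·|A_ε|·C(|B_ε|−m, k−m−1); in particular, every ε-typical ℓ-set L ⊆ B_ε satisfies d(L, A_ε^(1)B_ε^(k−ℓ−1)) ≥ (1−2δ)·|A_ε|·C(|B_ε|−ℓ, k−ℓ−1). -/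
open Finset

/-- Only one part: the order of the two parts is irrelevant. -/
lemma degIn_empty_right {n : ℕ} (E : Finset (Finset (Fin n))) (M Y : Finset (Fin n)) (j : ℕ) :
    degIn E M Y ∅ j 0 = degIn E M ∅ Y 0 j := by
  simp [degIn]

lemma sum_degIn_union_le {n : ℕ} (E : Finset (Finset (Fin n))) {M X Y : Finset (Fin n)}
    (hXY : Disjoint X Y) (s i j : ℕ) :
    ∑ N ∈ (Y \ M).powersetCard s, degIn E (M ∪ N) X Y i j ≤
      (j + s).choose s * degIn E M X Y i (j + s) := by
  unfold degIn
  simp_rw [card_filter]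
  rw [sum_comm, mul_sum]
  refine sum_le_sum fun e _ => ?_
  rw [← card_filter]
  have key : ∀ N ∈ (Y \ M).powersetCard s, (M ∪ N ⊆ e ∧ e \ (M ∪ N) ⊆ X ∪ Y ∧
      ((e \ (M ∪ N)) ∩ X).card = i ∧ ((e \ (M ∪ N)) ∩ Y).card = j) →
      (M ⊆ e ∧ e \ M ⊆ X ∪ Y ∧ ((e \ M) ∩ X).card = i ∧ ((e \ M) ∩ Y).card = j + s) ∧
        N ∈ ((e \ M) ∩ Y).powersetCard s := by
    rintro N hN ⟨h1, h2, h3, h4⟩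
    rw [mem_powersetCard] at hN
    obtain ⟨hN1, hN2⟩ := hN
    have hNY : N ⊆ Y := fun v hv => (mem_sdiff.1 (hN1 hv)).1
    have hNM : ∀ v ∈ N, v ∉ M := fun v hv => (mem_sdiff.1 (hN1 hv)).2
    have hX : ∀ v ∈ N, v ∉ X := fun v hv hx => (disjoint_left.1 hXY hx) (hNY hv)
    have hNe : N ⊆ e := subset_union_right.trans h1
    refine ⟨⟨subset_union_left.trans h1, ?_, ?_, ?_⟩, ?_⟩
    · intro v hv
      by_cases hvN : v ∈ N
      · exact mem_union_right _ (hNY hvN)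
      · apply h2
        simp only [mem_sdiff, mem_union] at hv ⊢
        tauto
    · rw [← h3]
      congr 1
      ext v
      have := hX v
      simp only [mem_sdiff, mem_union, mem_inter]
      tauto
    · rw [← h4, ← hN2, ← card_union_of_disjoint]
      · congr 1
        ext v
        have := hNM v
        have := @hNY v
        have := @hNe v
        simp only [mem_sdiff, mem_union, mem_inter]
        tauto
      · rw [disjoint_left]
        intro v hv
        simp only [mem_sdiff, mem_union, mem_inter] at hv
        tauto
    · rw [mem_powersetCard]
      refine ⟨fun v hv => ?_, hN2⟩
      exact mem_inter.2 ⟨mem_sdiff.2 ⟨hNe hv, hNM v hv⟩, hNY hv⟩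
  split_ifs with h
  · rw [mul_one]
    calc _ ≤ (((e \ M) ∩ Y).powersetCard s).card := by
          refine card_le_card fun N hN => ?_
          rw [mem_filter] at hN
          exact (key N hN.1 hN.2).2
      _ = _ := by rw [card_powersetCard, h.2.2.2]
  · rw [mul_zero, Nat.le_zero, card_eq_zero, filter_eq_empty_iff]
    intro N hN hc
    exact h (key N hN hc).1

/-- A lower bound on the pair degrees of all `(k-2)`-subsets of `Y` gives a lower bound on
the degrees of all smaller subsets of `Y`. -/
lemma mul_choose_le_degIn {n k : ℕ} (E : Finset (Finset (Fin n))) {X Y : Finset (Fin n)}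
    (hXY : Disjoint X Y) (c : ℝ)
    (hc : ∀ M ⊆ Y, M.card = k - 2 → c * ((Y.card - (k - 2) : ℕ) : ℝ) ≤
      (degIn E M X Y 1 1 : ℝ) + (degIn E M Y ∅ 2 0 : ℝ))
    {m : ℕ} (hk : 2 ≤ k) (hm : m ≤ k - 2) {M : Finset (Fin n)} (hM : M ⊆ Y) (hMc : M.card = m) :
    c * ((Y.card - m).choose (k - m - 1) : ℝ) ≤
      (degIn E M X Y 1 (k - m - 1) : ℝ) +
        ((k - m : ℕ) : ℝ) / 2 * (degIn E M Y ∅ (k - m) 0 : ℝ) := by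
  obtain ⟨s, rfl⟩ : ∃ s, k = s + m + 2 := ⟨k - 2 - m, by omega⟩
  have e1 : s + m + 2 - m - 1 = s + 1 := by omega
  have e2 : s + m + 2 - m = s + 2 := by omega
  have e3 : s + m + 2 - 2 = s + m := by omega
  rw [e3] at hc
  rw [e1, e2]
  have hcard : (Y \ M).card = Y.card - m := by rw [card_sdiff_of_subset hM, hMc]
  have hsum : ∑ N ∈ (Y \ M).powersetCard s, c * ((Y.card - (s + m) : ℕ) : ℝ) ≤
      ∑ N ∈ (Y \ M).powersetCard s,
        ((degIn E (M ∪ N) X Y 1 1 : ℝ) + (degIn E (M ∪ N) Y ∅ 2 0 : ℝ)) := by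
    refine sum_le_sum fun N hN => ?_
    rw [mem_powersetCard] at hN
    refine hc _ (union_subset hM (hN.1.trans sdiff_subset)) ?_
    rw [card_union_of_disjoint, hMc, hN.2, add_comm]
    exact (disjoint_sdiff.mono_right hN.1)
  rw [sum_const, card_powersetCard, hcard, nsmul_eq_mul, sum_add_distrib] at hsum
  have h1 := sum_degIn_union_le E hXY (M := M) s 1 1
  have h2 := sum_degIn_union_le E (disjoint_empty_left Y) (M := M) s 0 2
  simp_rw [← degIn_empty_right] at h2
  rw [add_comm 1 s, Nat.choose_succ_self_right] at h1
  rw [add_comm 2 s, Nat.choose_symm_add] at h2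
  have h1' : (∑ N ∈ (Y \ M).powersetCard s, (degIn E (M ∪ N) X Y 1 1 : ℝ)) ≤
    ((s : ℝ) + 1) * degIn E M X Y 1 (s + 1) := by exact_mod_cast h1
  have h2' : (∑ N ∈ (Y \ M).powersetCard s, (degIn E (M ∪ N) Y ∅ 2 0 : ℝ)) ≤
    (((s + 2).choose 2 : ℕ) : ℝ) * degIn E M Y ∅ (s + 2) 0 := by exact_mod_cast h2
  rw [Nat.cast_choose_two] at h2'
  have h3 : (((Y.card - m).choose (s + 1) : ℕ) : ℝ) * ((s : ℝ) + 1) =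
      ((Y.card - m).choose s : ℕ) * ((Y.card - (s + m) : ℕ) : ℝ) := by
    have := Nat.choose_succ_right_eq (Y.card - m) s
    rw [show Y.card - m - s = Y.card - (s + m) by omega] at this
    exact_mod_cast this
  have hs : (0 : ℝ) < (s : ℝ) + 1 := by positivity
  refine le_of_mul_le_mul_left ?_ hs
  push_cast at h2' ⊢
  linear_combination hsum + h1' + h2' + c * h3

lemma card_filter_subset_le {n : ℕ} (E : Finset (Finset (Fin n))) (M : Finset (Fin n))
    (P : Finset (Fin n) → Prop) [DecidablePred P] (T : Finset (Finset (Fin n)))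
    (h : ∀ e ∈ E, M ⊆ e → P e → e \ M ∈ T) :
    (E.filter fun e => M ⊆ e ∧ P e).card ≤ T.card := by
  refine card_le_card_of_injOn (fun e => e \ M) ?_ ?_
  · intro e he
    rw [mem_coe, mem_filter] at he
    exact h e he.1 he.2.1 he.2.2
  · intro e he f hf hef
    rw [mem_coe, mem_filter] at he hf
    have hef' : e \ M = f \ M := hef
    rw [← sdiff_union_of_subset he.2.1, ← sdiff_union_of_subset hf.2.1, hef']

lemma degIn_le_choose {n : ℕ} (E : Finset (Finset (Fin n))) (L Y : Finset (Fin n)) (j : ℕ) :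
    degIn E L Y ∅ j 0 ≤ Y.card.choose j := by
  rw [← card_powersetCard]
  refine card_filter_subset_le E L _ _ fun e _ _ h => ?_
  rw [union_empty] at h
  rw [mem_powersetCard]
  exact ⟨h.1, by rw [← h.2.1, inter_eq_left.2 h.1]⟩

/-- The number of `(r+1)`-sets meeting `W`. -/
lemma card_powersetCard_meeting_le {n : ℕ} (W : Finset (Fin n)) (r : ℕ) :
    (((univ : Finset (Fin n)).powersetCard (r + 1)).filter fun P => ∃ w ∈ W, w ∈ P).card ≤
      W.card * n.choose r := by
  have : (((univ : Finset (Fin n)).powersetCard (r + 1)).filter fun P => ∃ w ∈ W, w ∈ P) ⊆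
      W.biUnion fun w => ((univ : Finset (Fin n)).powersetCard r).image fun Q => insert w Q := by
    intro P hP
    simp only [mem_filter, mem_powersetCard, subset_univ, true_and, mem_biUnion, mem_image] at hP ⊢
    obtain ⟨hP, w, hw, hwP⟩ := hP
    exact ⟨w, hw, P.erase w, by rw [card_erase_of_mem hwP]; omega, insert_erase hwP⟩
  refine (card_le_card this).trans ?_
  refine card_biUnion_le_card_mul _ _ _ fun w _ => ?_
  refine card_image_le.trans ?_
  simp

lemma deg_le_degIn_add {n k : ℕ} {E : Finset (Finset (Fin n))} (hE : Uniform n k E) (hk : 2 ≤ k)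
    (X Y : Finset (Fin n)) {M : Finset (Fin n)} (hMc : M.card = k - 2) :
    deg E M ≤ degIn E M X Y 1 1 + degIn E M Y ∅ 2 0 + X.card.choose 2 +
      (univ \ (X ∪ Y)).card * n := by
  classical
  have h1 : (E.filter fun e => M ⊆ e ∧ e \ M ⊆ X).card ≤ X.card.choose 2 := by
    rw [← card_powersetCard]
    refine card_filter_subset_le E M _ _ fun e he hM h => ?_
    rw [mem_powersetCard]
    refine ⟨h, ?_⟩
    rw [card_sdiff_of_subset hM, hE e he, hMc]
    omega
  have h2 : (E.filter fun e => M ⊆ e ∧ ∃ w ∈ univ \ (X ∪ Y), w ∈ e \ M).card ≤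
      (univ \ (X ∪ Y)).card * n := by
    have := card_powersetCard_meeting_le (univ \ (X ∪ Y)) 1
    rw [Nat.choose_one_right] at this
    refine le_trans ?_ this
    refine card_filter_subset_le E M _ _ fun e he hM h => ?_
    rw [mem_filter, mem_powersetCard]
    refine ⟨⟨subset_univ _, ?_⟩, h⟩
    rw [card_sdiff_of_subset hM, hE e he, hMc]
    omega
  refine le_trans ?_ (Nat.add_le_add (Nat.add_le_add_left h1 _) h2)
  unfold deg degIn
  refine le_trans (card_le_card ?_) ((card_union_le _ _).trans (Nat.add_le_add_right
    ((card_union_le _ _).trans (Nat.add_le_add_right (card_union_le _ _) _)) _))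
  intro e he
  rw [mem_filter] at he
  obtain ⟨he, hM⟩ := he
  have hc : (e \ M).card = 2 := by
    rw [card_sdiff_of_subset hM, hE e he, hMc]
    omega
  simp only [mem_union, mem_filter, he, hM, true_and]
  by_cases hw : ∃ w ∈ univ \ (X ∪ Y), w ∈ e \ M
  · exact Or.inr hw
  have hsub : e \ M ⊆ X ∪ Y := by
    intro v hv
    by_contra hv'
    exact hw ⟨v, by simpa using hv', hv⟩
  by_cases hX : e \ M ⊆ X
  · exact Or.inl (Or.inr hX)
  by_cases hY : e \ M ⊆ Y
  · refine Or.inl (Or.inl (Or.inr ⟨by simpa using hY, ?_, by simp⟩))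
    rw [inter_eq_left.2 hY, hc]
  refine Or.inl (Or.inl (Or.inl ⟨hsub, ?_⟩))
  obtain ⟨u, hu, huX⟩ := not_subset.1 hX
  obtain ⟨v, hv, hvY⟩ := not_subset.1 hY
  have huY : u ∈ Y := (mem_union.1 (hsub hu)).resolve_left huX
  have hvX : v ∈ X := (mem_union.1 (hsub hv)).resolve_right hvY
  have huv : u ≠ v := fun h => huX (h ▸ hvX)
  have hP : e \ M = {u, v} := by
    refine (eq_of_subset_of_card_le (insert_subset hu (singleton_subset_iff.2 hv)) ?_).symm
    rw [hc, card_pair huv]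
  rw [hP, insert_inter_of_notMem huX, insert_inter_of_mem huY, singleton_inter_of_mem hvX,
    singleton_inter_of_notMem hvY]
  simp

lemma sum_degIn_singleton_le {n k : ℕ} {E : Finset (Finset (Fin n))} (hE : Uniform n k E)
    (B : Finset (Fin n)) (j : ℕ) :
    ∑ v ∈ B, degIn E {v} B ∅ j 0 ≤ k * edgesIn E B := by
  unfold degIn edgesIn
  simp_rw [card_filter]
  rw [sum_comm, mul_sum]
  refine sum_le_sum fun e he => ?_
  rw [← card_filter]
  have key : ∀ v ∈ B, ({v} ⊆ e ∧ e \ {v} ⊆ B ∪ ∅ ∧ ((e \ {v}) ∩ B).card = j ∧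
      ((e \ {v}) ∩ ∅).card = 0) → e ⊆ B ∧ v ∈ e := by
    rintro v hv ⟨h1, h2, -, -⟩
    refine ⟨fun w hw => ?_, h1 (mem_singleton_self v)⟩
    by_cases hwv : w = v
    · exact hwv ▸ hv
    · simpa using h2 (mem_sdiff.2 ⟨hw, by simpa using hwv⟩)
  split_ifs with h
  · rw [mul_one, ← hE e he]
    refine card_le_card fun v hv => ?_
    rw [mem_filter] at hv
    exact (key v hv.1 hv.2).2
  · rw [mul_zero, Nat.le_zero, card_eq_zero, filter_eq_empty_iff]
    exact fun v hv hc => h (key v hv hc).1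

lemma degIn_empty_one_le_sum {n : ℕ} (E : Finset (Finset (Fin n))) {A B : Finset (Fin n)}
    (hAB : Disjoint A B) (j : ℕ) :
    degIn E ∅ A B 1 j ≤ ∑ v ∈ A, degIn E {v} B ∅ j 0 := by
  unfold degIn
  refine le_trans (card_le_card ?_) card_biUnion_le
  intro e he
  simp only [mem_filter, sdiff_empty, empty_subset, true_and] at he
  obtain ⟨he, hsub, h1, hj⟩ := he
  obtain ⟨v, hv⟩ := card_eq_one.1 h1
  have hvm : v ∈ e ∩ A := hv ▸ mem_singleton_self v
  rw [mem_inter] at hvm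
  have hvB : v ∉ B := disjoint_left.1 hAB hvm.2
  have hsub' : e \ {v} ⊆ B := by
    intro w hw
    rw [mem_sdiff, mem_singleton] at hw
    refine (mem_union.1 (hsub hw.1)).resolve_left fun hwA => hw.2 ?_
    have : w ∈ e ∩ A := mem_inter.2 ⟨hw.1, hwA⟩
    rwa [hv, mem_singleton] at this
  rw [mem_biUnion]
  refine ⟨v, hvm.2, mem_filter.2 ⟨he, singleton_subset_iff.2 hvm.1, by simpa using hsub', ?_,
    by simp⟩⟩
  rw [← hj]
  congr 1
  ext w
  simp only [mem_inter, mem_sdiff, mem_singleton]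
  constructor
  · tauto
  · rintro ⟨h1, h2⟩
    exact ⟨⟨h1, fun h => hvB (h ▸ h2)⟩, h2⟩

lemma degIn_empty_le_edgesIn {n : ℕ} (E : Finset (Finset (Fin n))) (B : Finset (Fin n)) (j : ℕ) :
    degIn E ∅ B ∅ j 0 ≤ edgesIn E B := by
  refine card_le_card fun e he => ?_
  rw [mem_filter] at he ⊢
  exact ⟨he.1, by simpa using he.2.2.1⟩

/-- Passing from `Y` to `B` loses only the edges meeting `Y \ B`. -/
lemma degIn_le_degIn_add {n r : ℕ} (E : Finset (Finset (Fin n))) (L Y B : Finset (Fin n)) :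
    degIn E L Y ∅ (r + 1) 0 ≤ degIn E L B ∅ (r + 1) 0 + (Y \ B).card * n.choose r := by
  have h2 : (E.filter fun e => L ⊆ e ∧ (e \ L).card = r + 1 ∧ ∃ w ∈ Y \ B, w ∈ e \ L).card ≤
      (Y \ B).card * n.choose r := by
    refine le_trans ?_ (card_powersetCard_meeting_le (Y \ B) r)
    refine card_filter_subset_le E L _ _ fun e _ _ h => ?_
    rw [mem_filter, mem_powersetCard]
    exact ⟨⟨subset_univ _, h.1⟩, h.2⟩
  refine le_trans ?_ (Nat.add_le_add_left h2 _)
  unfold degIn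
  refine le_trans (card_le_card ?_) (card_union_le _ _)
  intro e he
  rw [mem_filter] at he
  obtain ⟨he, hL, hY, hc, -⟩ := he
  rw [union_empty] at hY
  rw [inter_eq_left.2 hY] at hc
  simp only [mem_union, mem_filter, he, hL, hc, true_and, union_empty, inter_empty, card_empty,
    and_true]
  by_cases hB : e \ L ⊆ B
  · exact Or.inl ⟨hB, by rw [inter_eq_left.2 hB, hc]⟩
  · obtain ⟨w, hw, hwB⟩ := not_subset.1 hB
    exact Or.inr ⟨w, mem_sdiff.2 ⟨hY hw, hwB⟩, hw⟩

lemma choose_two_le_minDeg_add {n k c : ℕ} {F : Finset (Finset (Fin n))} (hk : 2 ≤ k)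
    (hkn : k ≤ n) (hc : c ≤ n)
    (hF : ∀ e : Finset (Fin n), e.card = k → (∃ v ∈ e, (v : ℕ) < c) → e ∈ F) :
    (n - (k - 2)).choose 2 ≤ minDeg n F (k - 2) + (n - c - (k - 2)).choose 2 := by
  have hne : {d | ∃ S : Finset (Fin n), S.card = k - 2 ∧ deg F S = d}.Nonempty := by
    obtain ⟨S, -, hS⟩ := exists_subset_card_eq (s := (univ : Finset (Fin n))) (n := k - 2)
      (by rw [card_univ, Fintype.card_fin]; omega)
    exact ⟨_, S, hS, rfl⟩
  obtain ⟨S, hS, hd⟩ := Nat.sInf_mem hne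
  unfold minDeg
  rw [← hd]
  have hScard : (univ \ S).card = n - (k - 2) := by
    rw [card_sdiff_of_subset (subset_univ _), card_univ, Fintype.card_fin, hS]
  rw [← hScard, ← card_powersetCard]
  set C : Finset (Fin n) := univ.filter fun v => (v : ℕ) < c with hC
  have hCcard : C.card = c := by
    rw [hC, Fin.card_filter_val_lt]
    omega
  have hbad : (((univ \ S).powersetCard 2).filter fun P => ∀ v ∈ S ∪ P, v ∉ C).card ≤
      (n - c - (k - 2)).choose 2 := by
    by_cases hSC : ∀ v ∈ S, v ∉ C
    · have : (univ \ (C ∪ S)).card = n - c - (k - 2) := by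
        rw [card_sdiff_of_subset (subset_univ _), card_univ, Fintype.card_fin,
          card_union_of_disjoint, hCcard, hS, Nat.sub_sub]
        exact disjoint_right.2 hSC
      rw [← this, ← card_powersetCard]
      refine card_le_card fun P hP => ?_
      rw [mem_filter, mem_powersetCard] at hP
      rw [mem_powersetCard]
      refine ⟨fun v hv => ?_, hP.1.2⟩
      have h1 := hP.2 v (mem_union_right _ hv)
      have h2 := hP.1.1 hv
      simp only [mem_sdiff, mem_univ, true_and, mem_union] at h2 ⊢
      tauto
    · refine le_trans (Nat.le_zero.2 ?_) (Nat.zero_le _)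
      rw [card_eq_zero, filter_eq_empty_iff]
      exact fun P _ h => hSC fun v hv => h v (mem_union_left _ hv)
  have hgood : (((univ \ S).powersetCard 2).filter fun P => ¬ ∀ v ∈ S ∪ P, v ∉ C).card ≤
      deg F S := by
    unfold deg
    refine card_le_card_of_injOn (fun P => S ∪ P) ?_ ?_
    · intro P hP
      rw [mem_coe, mem_filter, mem_powersetCard] at hP
      obtain ⟨⟨hPS, hP2⟩, hv⟩ := hP
      push Not at hv
      obtain ⟨v, hv, hvC⟩ := hv
      rw [mem_coe, mem_filter]
      refine ⟨hF _ ?_ ⟨v, hv, (mem_filter.1 hvC).2⟩, subset_union_left⟩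
      rw [card_union_of_disjoint (disjoint_sdiff.mono_right hPS), hS, hP2]
      omega
    · intro P hP Q hQ hPQ
      rw [mem_coe, mem_filter, mem_powersetCard] at hP hQ
      have hPQ' : S ∪ P = S ∪ Q := hPQ
      rw [← union_sdiff_cancel_left (disjoint_sdiff.mono_right hP.1.1), hPQ',
        union_sdiff_cancel_left (disjoint_sdiff.mono_right hQ.1.1)]
  rw [← card_filter_add_card_filter_not (s := (univ \ S).powersetCard 2)
    (fun P => ∀ v ∈ S ∪ P, v ∉ C)]
  omega

lemma ceil_sub_one_eq {n d : ℕ} (hd : 0 < d) (hdn : d ∣ n) (hn : 0 < n) :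
    ⌈(n : ℝ) / (2 * (d : ℝ))⌉₊ - 1 =
      if Odd (n / d) then n / (2 * d) else n / (2 * d) - 1 := by
  obtain ⟨q, rfl⟩ := hdn
  have hd' : (d : ℝ) ≠ 0 := by positivity
  have h1 : ((d * q : ℕ) : ℝ) / (2 * (d : ℝ)) = (q : ℝ) / 2 := by
    push_cast
    field_simp
  have h2 : d * q / (2 * d) = q / 2 := by
    rw [mul_comm 2 d, Nat.mul_div_mul_left _ _ hd]
  rw [h1, h2, Nat.mul_div_cancel_left _ hd]
  have hq : 0 < q := Nat.pos_of_mul_pos_left hn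
  split_ifs with ho
  · obtain ⟨p, rfl⟩ := ho
    have : ⌈((2 * p + 1 : ℕ) : ℝ) / 2⌉₊ = p + 1 := by
      rw [Nat.ceil_eq_iff (by omega)]
      push_cast
      constructor <;> linarith
    rw [this]
    omega
  · obtain ⟨p, rfl⟩ := Nat.not_odd_iff_even.1 ho
    have : ((p + p : ℕ) : ℝ) / 2 = (p : ℕ) := by
      push_cast
      ring
    rw [this, Nat.ceil_natCast]
    omega

lemma mem_Xedges {n k ℓ : ℕ} {e : Finset (Fin n)} (he : e.card = k)
    (h : ∃ v ∈ e, (v : ℕ) <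
      if Odd (n / (k - ℓ)) then n / (2 * (k - ℓ)) else n / (2 * (k - ℓ)) - 1) :
    e ∈ Xedges n k ℓ := by
  have hmem : e ∈ (univ : Finset (Fin n)).powersetCard k :=
    mem_powersetCard.2 ⟨subset_univ _, he⟩
  unfold Xedges
  split_ifs at h ⊢ with ho
  · exact mem_filter.2 ⟨hmem, h⟩
  · exact mem_filter.2 ⟨hmem, Or.inl h⟩

lemma deg_lower_bound {n k ℓ : ℕ} {E : Finset (Finset (Fin n))} {a : ℕ} (hk : 2 ≤ k)
    (hkl : 0 < k - ℓ) (hdvd : (k - ℓ) ∣ n) (hn : 0 < n)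
    (ha : a = ⌈(n : ℝ) / (2 * ((k - ℓ : ℕ) : ℝ))⌉₊ - 1) (hak : a + k ≤ n)
    (hmin : minDeg n (Xedges n k ℓ) (k - 2) < minDeg n E (k - 2))
    {M : Finset (Fin n)} (hM : M.card = k - 2) :
    (a : ℝ) * (n - ((k : ℝ) - 2) - a) + a * (a - 1) / 2 ≤ deg E M := by
  have h1 : (n - (k - 2)).choose 2 ≤
      minDeg n (Xedges n k ℓ) (k - 2) + (n - a - (k - 2)).choose 2 := by
    refine choose_two_le_minDeg_add hk (by omega) (by omega) fun e he h => ?_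
    rw [ha, ceil_sub_one_eq hkl hdvd hn] at h
    exact mem_Xedges he h
  have h2 : minDeg n E (k - 2) ≤ deg E M := Nat.sInf_le ⟨M, hM, rfl⟩
  have h3 : (n - (k - 2)).choose 2 ≤ deg E M + (n - a - (k - 2)).choose 2 := by omega
  have h4 : (((n - (k - 2)).choose 2 : ℕ) : ℝ) ≤ deg E M + ((n - a - (k - 2)).choose 2 : ℕ) := by
    exact_mod_cast h3
  rw [Nat.cast_choose_two, Nat.cast_choose_two, Nat.cast_sub (show k - 2 ≤ n by omega),
    Nat.cast_sub (show k - 2 ≤ n - a by omega), Nat.cast_sub (show a ≤ n by omega),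
    Nat.cast_sub hk] at h4
  push_cast at h4
  linear_combination h4

lemma choose_le_two_pow_mul_choose {n b j : ℕ} (h : n ≤ 2 * (b + 1 - j)) :
    n.choose j ≤ 2 ^ j * b.choose j := by
  refine Nat.le_of_mul_le_mul_left ?_ (Nat.factorial_pos j)
  rw [← Nat.descFactorial_eq_factorial_mul_choose, mul_left_comm,
    ← Nat.descFactorial_eq_factorial_mul_choose]
  calc n.descFactorial j ≤ n ^ j := Nat.descFactorial_le_pow n j
    _ ≤ (2 * (b + 1 - j)) ^ j := Nat.pow_le_pow_left h j
    _ = 2 ^ j * (b + 1 - j) ^ j := mul_pow _ _ _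
    _ ≤ _ := Nat.mul_le_mul_left _ (Nat.pow_sub_le_descFactorial b j)

lemma mul_choose_succ_le (n j : ℕ) : (j + 1) * n.choose (j + 1) ≤ n * n.choose j := by
  rw [mul_comm, Nat.choose_succ_right_eq, mul_comm]
  exact Nat.mul_le_mul_right _ (Nat.sub_le _ _)

lemma card_sdiff_Beps_mul_le {n k : ℕ} {E : Finset (Finset (Fin n))} (hE : Uniform n k E)
    (B : Finset (Fin n)) (ε : ℝ) :
    ((B \ Beps n k E B ε).card : ℝ) * (ε * (B.card.choose (k - 1) : ℝ)) ≤ k * edgesIn E B := by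
  have h1 : (∑ v ∈ B, (degIn E {v} B ∅ (k - 1) 0 : ℝ)) ≤ k * edgesIn E B := by
    exact_mod_cast sum_degIn_singleton_le hE B (k - 1)
  refine le_trans ?_ h1
  refine le_trans ?_ (sum_le_sum_of_subset_of_nonneg (sdiff_subset (t := Beps n k E B ε))
    fun _ _ _ => Nat.cast_nonneg _)
  rw [← nsmul_eq_mul]
  refine card_nsmul_le_sum _ _ _ fun v hv => ?_
  have := (mem_sdiff.1 hv).2
  simp only [Beps, mem_filter, mem_univ, true_and, not_le] at this
  exact this.le

lemma card_sdiff_Aeps_mul_le {n k : ℕ} (hk : 2 ≤ k) {E : Finset (Finset (Fin n))}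
    {A B : Finset (Fin n)} (hAB : Disjoint A B) (ε : ℝ)
    (hc : ∀ M ⊆ B, M.card = k - 2 → (A.card : ℝ) * ((B.card - (k - 2) : ℕ) : ℝ) ≤
      (degIn E M A B 1 1 : ℝ) + (degIn E M B ∅ 2 0 : ℝ)) :
    ((A \ Aeps n k E B ε).card : ℝ) * (ε * (B.card.choose (k - 1) : ℝ)) ≤
      k / 2 * edgesIn E B := by
  have h0 := mul_choose_le_degIn E hAB (A.card : ℝ) hc hk (Nat.zero_le _) (empty_subset _)
    card_empty
  rw [Nat.sub_zero, Nat.sub_zero] at h0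
  have h1 : (degIn E ∅ A B 1 (k - 1) : ℝ) ≤ ∑ v ∈ A, (degIn E {v} B ∅ (k - 1) 0 : ℝ) := by
    exact_mod_cast degIn_empty_one_le_sum E hAB (k - 1)
  have h2 : (degIn E ∅ B ∅ k 0 : ℝ) ≤ edgesIn E B := by
    exact_mod_cast degIn_empty_le_edgesIn E B k
  have h3 : ∑ v ∈ A, ((B.card.choose (k - 1) : ℝ) - (degIn E {v} B ∅ (k - 1) 0 : ℝ)) ≤
      k / 2 * edgesIn E B := by
    rw [sum_sub_distrib, sum_const, nsmul_eq_mul]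
    have : (k : ℝ) / 2 * degIn E ∅ B ∅ k 0 ≤ k / 2 * edgesIn E B := by gcongr
    linarith
  refine le_trans ?_ h3
  refine le_trans ?_ (sum_le_sum_of_subset_of_nonneg (sdiff_subset (t := Aeps n k E B ε))
    fun v _ _ => sub_nonneg.2 (by exact_mod_cast degIn_le_choose E {v} B (k - 1)))
  rw [← nsmul_eq_mul]
  refine card_nsmul_le_sum _ _ _ fun v hv => ?_
  have := (mem_sdiff.1 hv).2
  simp only [Aeps, mem_filter, mem_univ, true_and, not_le] at this
  linarith

lemma disjoint_Aeps_Beps {n k : ℕ} (E : Finset (Finset (Fin n))) (B : Finset (Fin n)) {ε : ℝ}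
    (hε : ε < 1 / 2) (hB : 0 < B.card.choose (k - 1)) :
    Disjoint (Aeps n k E B ε) (Beps n k E B ε) := by
  rw [disjoint_left]
  intro v hA hB'
  simp only [Aeps, Beps, mem_filter, mem_univ, true_and] at hA hB'
  have hB'' : (0 : ℝ) < (B.card.choose (k - 1) : ℝ) := by exact_mod_cast hB
  nlinarith

lemma pair_degree_numeric {n k a a' b' W d δ η : ℝ} (hδ : 0 ≤ δ) (hη : 0 ≤ η) (hη1 : η ≤ 1 / 8)
    (hηδ : 48 * k * η ≤ δ) (hk : 3 ≤ k) (hn : 16 * k ≤ n) (ha0 : 0 ≤ a) (ha : a ≤ n / 4)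
    (ha' : a' ≤ a + η * n) (ha'n : n ≤ 4 * k * a') (hab : a' + b' ≤ n)
    (hb' : n / 2 ≤ b' - (k - 2)) (hW : W ≤ 2 * (η * n))
    (hd : a * (n - (k - 2) - a) + a * (a - 1) / 2 ≤ d + a' * (a' - 1) / 2 + W * n) :
    (1 - δ) * a' * (b' - (k - 2)) ≤ d := by
  have hn0 : 0 < n := by linarith
  have ha'0 : 0 ≤ a' := by
    by_contra! h
    nlinarith
  have hηn : 0 ≤ η * n := by positivity
  have hηn' : η * n ≤ n / 8 := by nlinarith
  have hs0 : 0 ≤ n - (k - 2) - (a + a' + 1) / 2 := by linarith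
  have hs1 : n - (k - 2) - (a + a' + 1) / 2 ≤ n := by linarith
  have h1 : -(η * n * n) ≤ (a - a') * (n - (k - 2) - (a + a' + 1) / 2) := by
    rcases le_total a' a with h | h
    · have := mul_nonneg (sub_nonneg.2 h) hs0
      have := mul_nonneg hηn hn0.le
      linarith
    · have : (a' - a) * (n - (k - 2) - (a + a' + 1) / 2) ≤ η * n * n :=
        mul_le_mul (by linarith) hs1 hs0 hηn
      linarith
  have h2 : W * n ≤ 2 * (η * n) * n := mul_le_mul_of_nonneg_right hW hn0.le
  have h3 : a' * (b' - (k - 2)) ≤ a' * (n - (k - 2) - a') :=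
    mul_le_mul_of_nonneg_left (by linarith) ha'0
  have h4 : n / 2 * a' ≤ (b' - (k - 2)) * a' := mul_le_mul_of_nonneg_right hb' ha'0
  have h5 : 3 * (η * n * n) ≤ δ * ((b' - (k - 2)) * a') := by
    have e1 : 48 * k * η * (n / 2 * a') ≤ δ * ((b' - (k - 2)) * a') :=
      mul_le_mul hηδ h4 (by positivity) hδ
    have e2 : η * n * n ≤ η * n * (4 * k * a') := mul_le_mul_of_nonneg_left ha'n hηn
    have : 0 ≤ η * n * n := by positivity
    linarith
  linarith

lemma ceil_sub_one_bounds {n k d : ℕ} (hd : 2 ≤ d) (hdk : d ≤ k) (hn : 0 < n) :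
    (n : ℝ) / (2 * k) - 1 ≤ ((⌈(n : ℝ) / (2 * (d : ℝ))⌉₊ - 1 : ℕ) : ℝ) ∧
      ((⌈(n : ℝ) / (2 * (d : ℝ))⌉₊ - 1 : ℕ) : ℝ) ≤ n / 4 := by
  have hn' : (0 : ℝ) < n := by exact_mod_cast hn
  have hd' : (2 : ℝ) ≤ d := by exact_mod_cast hd
  have hdk' : (d : ℝ) ≤ k := by exact_mod_cast hdk
  have hx : 0 < (n : ℝ) / (2 * (d : ℝ)) := by positivity
  rw [Nat.cast_sub (Nat.ceil_pos.2 hx)]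
  have h1 := Nat.le_ceil ((n : ℝ) / (2 * (d : ℝ)))
  have h2 := Nat.ceil_lt_add_one hx.le
  have h3 : (n : ℝ) / (2 * k) ≤ n / (2 * d) := by gcongr
  have h4 : (n : ℝ) / (2 * d) ≤ n / 4 := by
    gcongr
    linarith
  push_cast
  constructor <;> linarith

/-- An exceptional set `S` whose size is controlled by the number of edges inside `B` is small. -/
lemma card_le_of_mul_le {n k b s e : ℕ} {ε η : ℝ} (hk : 1 ≤ k) (hε : 0 < ε) (hη : 0 ≤ η)
    (hb : n ≤ 2 * (b + 1 - (k - 1))) (hbk : k - 1 ≤ b)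
    (hs : (s : ℝ) * (ε * (b.choose (k - 1) : ℝ)) ≤ k * e)
    (he : (e : ℝ) ≤ η * ε / 2 ^ k * (n.choose k : ℝ)) :
    (s : ℝ) ≤ η * n := by
  obtain ⟨j, rfl⟩ : ∃ j, k = j + 1 := ⟨k - 1, by omega⟩
  rw [Nat.add_sub_cancel] at hb hbk hs
  have hC : (0 : ℝ) < b.choose j := by exact_mod_cast Nat.choose_pos hbk
  have h1 : ((j + 1 : ℕ) : ℝ) * (n.choose (j + 1) : ℝ) ≤ n * n.choose j := by
    exact_mod_cast mul_choose_succ_le n j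
  have h2 : (n.choose j : ℝ) ≤ 2 ^ j * b.choose j := by
    exact_mod_cast choose_le_two_pow_mul_choose hb
  refine le_of_mul_le_mul_right ?_ (mul_pos hε hC)
  calc (s : ℝ) * (ε * b.choose j) ≤ (j + 1 : ℕ) * e := hs
    _ ≤ (j + 1 : ℕ) * (η * ε / 2 ^ (j + 1) * (n.choose (j + 1) : ℝ)) := by gcongr
    _ = η * ε / 2 ^ (j + 1) * ((j + 1 : ℕ) * (n.choose (j + 1) : ℝ)) := by ring
    _ ≤ η * ε / 2 ^ (j + 1) * (n * (2 ^ j * b.choose j)) :=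
      mul_le_mul_of_nonneg_left (h1.trans (mul_le_mul_of_nonneg_left h2 n.cast_nonneg))
        (by positivity)
    _ = η * n * (ε * b.choose j) / 2 := by rw [pow_succ]; field_simp
    _ ≤ η * n * (ε * b.choose j) := half_le_self (by positivity)

/-- If `(A', B')` covers the partition `(A, B)` up to few vertices, its sizes are close to those
of `(A, B)`. -/
lemma card_bounds_of_sdiff_small {n : ℕ} {A B A' B' : Finset (Fin n)} {s : ℝ}
    (hunion : A ∪ B = univ) (hd' : Disjoint A' B') (hAsmall : ((A \ A').card : ℝ) ≤ s)
    (hBsmall : ((B \ B').card : ℝ) ≤ s) :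
    ((univ \ (A' ∪ B')).card : ℝ) ≤ 2 * s ∧ ((B' \ B).card : ℝ) ≤ s ∧
      (A'.card : ℝ) ≤ A.card + s ∧ (A.card : ℝ) - s ≤ A'.card ∧
      (B.card : ℝ) - s ≤ B'.card ∧ (A'.card : ℝ) + B'.card ≤ n := by
  have hmemAB : ∀ v, v ∈ A ∨ v ∈ B := fun v => mem_union.1 (hunion ▸ mem_univ v)
  have hW : ((univ \ (A' ∪ B')).card : ℝ) ≤ 2 * (s) := by
    have : (univ \ (A' ∪ B')).card ≤ (A \ A').card + (B \ B').card := by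
      refine (card_le_card fun v hv => ?_).trans (card_union_le _ _)
      have := hmemAB v
      simp only [mem_sdiff, mem_univ, mem_union, true_and] at hv ⊢
      tauto
    have : ((univ \ (A' ∪ B')).card : ℝ) ≤ (A \ A').card + (B \ B').card := by exact_mod_cast this
    linarith
  have hBB : ((B' \ B).card : ℝ) ≤ s := by
    refine le_trans (Nat.cast_le.2 (card_le_card fun v hv => ?_)) hAsmall
    have := hmemAB v
    have := @disjoint_right.1 hd' v
    simp only [mem_sdiff] at hv ⊢
    tauto
  have haU' : (A'.card : ℝ) ≤ A.card + s := by
    have : A'.card ≤ A.card + (B \ B').card := by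
      refine (card_le_card fun v hv => ?_).trans (card_union_le _ _)
      have := hmemAB v
      have := disjoint_left.1 hd' hv
      simp only [mem_union, mem_sdiff]
      tauto
    have : (A'.card : ℝ) ≤ A.card + (B \ B').card := by exact_mod_cast this
    linarith
  have haL' : (A.card : ℝ) - s ≤ A'.card := by
    have : A.card ≤ (A \ A').card + A'.card := card_le_card_sdiff_add_card
    have : (A.card : ℝ) ≤ (A \ A').card + A'.card := by exact_mod_cast this
    linarith
  have hbL' : (B.card : ℝ) - s ≤ B'.card := by
    have : B.card ≤ (B \ B').card + B'.card := card_le_card_sdiff_add_card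
    have : (B.card : ℝ) ≤ (B \ B').card + B'.card := by exact_mod_cast this
    linarith
  have hab' : (A'.card : ℝ) + B'.card ≤ n := by
    have : (A' ∪ B').card ≤ n := (card_le_univ _).trans_eq (Fintype.card_fin n)
    rw [card_union_of_disjoint hd'] at this
    exact_mod_cast this
  exact ⟨hW, hBB, haU', haL', hbL', hab'⟩

/-- A typical set has few edges inside `B'`. -/
lemma typical_degIn_le {n k r b' : ℕ} {E : Finset (Finset (Fin n))} {L B B' : Finset (Fin n)}
    {ε η δ' a' : ℝ} (ha'0 : 0 ≤ a') (hrk' : r + 1 ≤ k) (hBn : B.card ≤ n) (hε0 : 0 ≤ ε) (hη0 : 0 ≤ η)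
    (hkη : k * η = ε) (hεδ : 2 ^ k * (8 * k) * ε = δ') (hδ'0 : 0 ≤ δ')
    (hLt : (degIn E L B ∅ (r + 1) 0 : ℝ) ≤ ε * (B.card.choose (r + 1) : ℝ))
    (hBB : ((B' \ B).card : ℝ) ≤ η * n) (ha'n : (n : ℝ) ≤ 4 * k * a')
    (hb : n ≤ 2 * (b' + 1 - r)) :
    ((r + 1 : ℕ) : ℝ) / 2 * (degIn E L B' ∅ (r + 1) 0 : ℝ) ≤ δ' * a' * b'.choose r := by
  have h1 : (degIn E L B' ∅ (r + 1) 0 : ℝ) ≤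
      degIn E L B ∅ (r + 1) 0 + (B' \ B).card * n.choose r := by
    exact_mod_cast degIn_le_degIn_add E L B' B
  have h2 : ((r + 1 : ℕ) : ℝ) * B.card.choose (r + 1) ≤ n * n.choose r := by
    have : (r + 1) * B.card.choose (r + 1) ≤ n * n.choose r :=
      (Nat.mul_le_mul_left _ (Nat.choose_le_choose _ hBn)).trans (mul_choose_succ_le n r)
    exact_mod_cast this
  have h3 : (n.choose r : ℝ) ≤ 2 ^ r * b'.choose r := by
    exact_mod_cast choose_le_two_pow_mul_choose hb
  have hrk : ((r + 1 : ℕ) : ℝ) ≤ k := by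
    exact_mod_cast hrk'
  have h4 : ((r + 1 : ℕ) : ℝ) / 2 * (degIn E L B' ∅ (r + 1) 0 : ℝ) ≤ ε * n * n.choose r := by
    calc ((r + 1 : ℕ) : ℝ) / 2 * (degIn E L B' ∅ (r + 1) 0 : ℝ)
        ≤ ((r + 1 : ℕ) : ℝ) / 2 * (ε * B.card.choose (r + 1) + η * n * n.choose r) := by
          gcongr
          refine h1.trans ?_
          gcongr
      _ = ε / 2 * (((r + 1 : ℕ) : ℝ) * B.card.choose (r + 1)) +
          ((r + 1 : ℕ) : ℝ) * η / 2 * (n * n.choose r) := by ring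
      _ ≤ ε / 2 * (n * n.choose r) + k * η / 2 * (n * n.choose r) := by gcongr
      _ = ε * n * n.choose r := by rw [hkη]; ring
  refine h4.trans ?_
  calc ε * n * n.choose r ≤ ε * (4 * k * a') * (2 ^ k * b'.choose r) := by
          gcongr
          refine h3.trans ?_
          gcongr
          · norm_num
          · exact (Nat.le_succ r).trans hrk'
    _ = 2 ^ k * (8 * k) * ε * a' * b'.choose r / 2 := by ring
    _ = δ' * a' * b'.choose r / 2 := by rw [hεδ]
    _ ≤ _ := half_le_self (by positivity)

set_option maxHeartbeats 800000 in
/-- Lemma: typical degree. For all integers `k ≥ 3` and `1 ≤ ℓ < k/2`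
and every `δ > 0` there exist `ε, θ, ξ > 0` and `n₀` such that the following holds for
every `n ≥ n₀` divisible by `k-ℓ`, every `(ℓ,ξ)`-extremal `k`-uniform hypergraph `H` on
`n` vertices with `δ_{k-2}(H) > δ_{k-2}(X_{k,ℓ}(n))` and every minimal extremal
partition `V = A ∪ B`: for every `m ≤ k-2` and every `m`-set `M ⊆ B_ε`,
`d(M, A_ε^(1)B_ε^(k-m-1)) + ((k-m)/2)·d(M, B_ε^(k-m)) ≥ (1-δ)|A_ε|·C(|B_ε|-m, k-m-1)`;
in particular every ε-typical ℓ-set `L ⊆ B_ε` satisfies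
`d(L, A_ε^(1)B_ε^(k-ℓ-1)) ≥ (1-2δ)|A_ε|·C(|B_ε|-ℓ, k-ℓ-1)`. -/
theorem statement7 (k ℓ : ℕ) (hk : 3 ≤ k) (hl : 1 ≤ ℓ) (hlk : 2 * ℓ < k)
    (δ : ℝ) (hδ : 0 < δ) :
    ∃ ε θ ξ : ℝ, 0 < ε ∧ 0 < θ ∧ 0 < ξ ∧ ∃ n₀ : ℕ, ∀ n : ℕ, n₀ ≤ n → (k - ℓ) ∣ n →
      ∀ E : Finset (Finset (Fin n)), Uniform n k E →
        ∀ A B : Finset (Fin n), IsMinExtremalPartition n k ℓ E ξ A B →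
          minDeg n (Xedges n k ℓ) (k - 2) < minDeg n E (k - 2) →
          (∀ m : ℕ, m ≤ k - 2 → ∀ M : Finset (Fin n), M ⊆ Beps n k E B ε → M.card = m →
            (1 - δ) * ((Aeps n k E B ε).card : ℝ) *
                (((Beps n k E B ε).card - m).choose (k - m - 1) : ℝ) ≤
              (degIn E M (Aeps n k E B ε) (Beps n k E B ε) 1 (k - m - 1) : ℝ) +
                ((k - m : ℕ) : ℝ) / 2 * (degIn E M (Beps n k E B ε) ∅ (k - m) 0 : ℝ)) ∧
          (∀ L : Finset (Fin n), IsTypical n k ℓ E B ε L →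
            (1 - 2 * δ) * ((Aeps n k E B ε).card : ℝ) *
                (((Beps n k E B ε).card - ℓ).choose (k - ℓ - 1) : ℝ) ≤
              (degIn E L (Aeps n k E B ε) (Beps n k E B ε) 1 (k - ℓ - 1) : ℝ)) := by
  classical
  set δ' : ℝ := min δ 1
  have hδ'0 : 0 < δ' := lt_min hδ one_pos
  have hδ'1 : δ' ≤ 1 := min_le_right _ _
  have hδ'δ : δ' ≤ δ := min_le_left _ _
  have hkR : (3 : ℝ) ≤ k := by exact_mod_cast hk
  have hk0 : (0 : ℝ) < k := by linarith
  set ε : ℝ := δ' / (2 ^ k * (8 * k)) with hεdef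
  have hε0 : 0 < ε := by positivity
  set η : ℝ := ε / k with hηdef
  have hη0 : 0 < η := by positivity
  have hkη : k * η = ε := by rw [hηdef]; field_simp
  have hεδ : 2 ^ k * (8 * k) * ε = δ' := by rw [hεdef]; field_simp
  have hpow : (8 : ℝ) ≤ 2 ^ k := by
    calc (8 : ℝ) = 2 ^ 3 := by norm_num
      _ ≤ 2 ^ k := pow_le_pow_right₀ (by norm_num) hk
  have hε48 : 48 * ε ≤ δ' := by
    rw [← hεδ]
    have : (8 : ℝ) * (8 * 3) ≤ 2 ^ k * (8 * k) := by gcongr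
    nlinarith
  have hηε : 3 * η ≤ ε := by rw [← hkη]; gcongr
  refine ⟨ε, 1, η * ε / 2 ^ k, hε0, one_pos, by positivity, 16 * k, ?_⟩
  intro n hn hdvd E hE A B hAB hmin
  obtain ⟨⟨hdisj, hunion, hAcard, -, heB⟩, -⟩ := hAB
  have hnR : 16 * (k : ℝ) ≤ n := by exact_mod_cast hn
  have hn0 : 0 < n := by omega
  have hn0R : (0 : ℝ) < n := by exact_mod_cast hn0
  have hkl2 : 2 ≤ k - ℓ := by omega
  obtain ⟨haL, haU⟩ := ceil_sub_one_bounds hkl2 (Nat.sub_le k ℓ) hn0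
  rw [← hAcard] at haL haU
  have hABn : A.card + B.card = n := by
    rw [← card_union_of_disjoint hdisj, hunion, card_univ, Fintype.card_fin]
  have hABnR : (A.card : ℝ) + B.card = n := by exact_mod_cast hABn
  have h4a : 4 * A.card ≤ n := by
    have : 4 * (A.card : ℝ) ≤ n := by linarith
    exact_mod_cast this
  have hdeg : ∀ M : Finset (Fin n), M.card = k - 2 →
      (A.card : ℝ) * (n - ((k : ℝ) - 2) - A.card) + A.card * (A.card - 1) / 2 ≤ deg E M :=
    fun M hM => deg_lower_bound (by omega) (by omega) hdvd hn0 hAcard (by omega) hmin hM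
  have hdegle : ∀ X Y M : Finset (Fin n), M.card = k - 2 →
      (deg E M : ℝ) ≤ degIn E M X Y 1 1 + degIn E M Y ∅ 2 0 + X.card * (X.card - 1) / 2 +
        (univ \ (X ∪ Y)).card * n := by
    intro X Y M hM
    rw [← Nat.cast_choose_two]
    exact_mod_cast deg_le_degIn_add hE (by omega) X Y hM
  have hcAB : ∀ M ⊆ B, M.card = k - 2 → (A.card : ℝ) * ((B.card - (k - 2) : ℕ) : ℝ) ≤
      (degIn E M A B 1 1 : ℝ) + (degIn E M B ∅ 2 0 : ℝ) := by
    intro M _ hM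
    have h1 := hdeg M hM
    have h2 := hdegle A B M hM
    rw [hunion, Finset.sdiff_self, card_empty] at h2
    rw [Nat.cast_sub (by omega), Nat.cast_sub (by omega)]
    push_cast at h2 ⊢
    rw [← hABnR] at h1
    linarith
  have hbig : n ≤ 2 * (B.card + 1 - (k - 1)) := by omega
  have hBk : k - 1 ≤ B.card := by omega
  have hBsmall : ((B \ Beps n k E B ε).card : ℝ) ≤ η * n :=
    card_le_of_mul_le (by omega) hε0 hη0.le hbig hBk (card_sdiff_Beps_mul_le hE B ε) heB
  have hAsmall : ((A \ Aeps n k E B ε).card : ℝ) ≤ η * n := by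
    refine card_le_of_mul_le (by omega) hε0 hη0.le hbig hBk
      ((card_sdiff_Aeps_mul_le (by omega) hdisj ε hcAB).trans ?_) heB
    gcongr
    linarith
  have hd' : Disjoint (Aeps n k E B ε) (Beps n k E B ε) :=
    disjoint_Aeps_Beps E B (by linarith) (Nat.choose_pos hBk)
  set A' := Aeps n k E B ε
  set B' := Beps n k E B ε
  obtain ⟨hW, hBB, haU', haL', hbL', hab'⟩ :=
    card_bounds_of_sdiff_small hunion hd' hAsmall hBsmall
  have hη8 : η ≤ 1 / 8 := by linarith
  have hηn : η * n ≤ n / 8 := by nlinarith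
  have hbhalf : (n : ℝ) / 2 ≤ B'.card - ((k : ℝ) - 2) := by linarith
  have ha'n : (n : ℝ) ≤ 4 * k * A'.card := by
    have h1 : (n : ℝ) / (2 * k) - 1 - η * n ≤ A'.card := by linarith
    have h2 : 4 * (k : ℝ) * (n / (2 * k) - 1 - η * n) = 2 * n - 4 * k - 4 * (k * η) * n := by
      field_simp
      ring
    have h3 : 4 * (k : ℝ) * (n / (2 * k) - 1 - η * n) ≤ 4 * k * A'.card := by gcongr
    rw [h2, hkη] at h3
    have h4 : 4 * ε * n ≤ n / 2 := by nlinarith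
    linarith
  have hkB' : k - 2 ≤ B'.card := by
    have : (k : ℝ) ≤ B'.card + 2 := by linarith
    have : k ≤ B'.card + 2 := by exact_mod_cast this
    omega
  have hpair : ∀ M ⊆ B', M.card = k - 2 →
      (1 - δ') * A'.card * ((B'.card - (k - 2) : ℕ) : ℝ) ≤
        (degIn E M A' B' 1 1 : ℝ) + (degIn E M B' ∅ 2 0 : ℝ) := by
    intro M _ hM
    rw [Nat.cast_sub hkB', Nat.cast_sub (by omega), Nat.cast_ofNat]
    refine pair_degree_numeric hδ'0.le hη0.le hη8 ?_ hkR hnR (Nat.cast_nonneg _) haU haU' ha'n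
      hab' hbhalf hW ((hdeg M hM).trans (hdegle A' B' M hM))
    rw [mul_assoc, hkη]
    exact hε48
  have hmain : ∀ m : ℕ, m ≤ k - 2 → ∀ M : Finset (Fin n), M ⊆ B' → M.card = m →
      (1 - δ') * (A'.card : ℝ) * ((B'.card - m).choose (k - m - 1) : ℝ) ≤
        (degIn E M A' B' 1 (k - m - 1) : ℝ) +
          ((k - m : ℕ) : ℝ) / 2 * (degIn E M B' ∅ (k - m) 0 : ℝ) :=
    fun m hm M hM hMc => mul_choose_le_degIn E hd' _ hpair (by omega) hm hM hMc
  refine ⟨fun m hm M hM hMc => le_trans ?_ (hmain m hm M hM hMc), ?_⟩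
  · gcongr
  rintro L ⟨hLc, hLB, hLt⟩
  have hL := hmain ℓ (by omega) L hLB hLc
  obtain ⟨r, hr⟩ : ∃ r, k - ℓ = r + 1 := ⟨k - ℓ - 1, by omega⟩
  rw [hr, Nat.add_sub_cancel] at hL ⊢
  rw [hr] at hLt
  have hb : n ≤ 2 * (B'.card - ℓ + 1 - r) := by
    have : (n : ℝ) + 2 * k ≤ 2 * B'.card + 4 := by linarith
    have : n + 2 * k ≤ 2 * B'.card + 4 := by exact_mod_cast this
    omega
  have h5 := typical_degIn_le (Nat.cast_nonneg A'.card) (by omega) (by omega) hε0.le hη0.le hkη hεδ hδ'0.le hLt hBB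
    ha'n hb
  have h6 : (1 - 2 * δ) * (A'.card : ℝ) * ((B'.card - ℓ).choose r : ℝ) ≤
      (1 - 2 * δ') * (A'.card : ℝ) * ((B'.card - ℓ).choose r : ℝ) := by gcongr
  linarith
end

section
/- For all integers k ≥ 3 and 1 ≤ ℓ < k/2 there exist ε, θ, ξ > 0 and n₀ such that the following holds. Let n ≥ n₀ be divisible by k−ℓ, let H = (V,E) be an (ℓ,ξ)-extremal k-uniform hypergraph on n vertices with δ_{k−2}(H) > δ_{k−2}(X_{k,ℓ}(n)), let V = A ∪ B be a minimal extremal partition, and define A_ε, B_ε as above. Then for any ε-typical ℓ-set L ⊆ B_ε and any U ⊆ V with |U| ≤ εn, there exist a vertex a ∈ A_ε ∖ U and a (k−ℓ−1)-set C ⊆ B_ε ∖ U such that L ∪ {a} ∪ C is an edge of H and every ℓ-subset of C is ε-typical. -/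
open Finset

/-- The degree of `S` counts the sets outside `S` that complete `S` to an edge. -/
lemma deg_eq_card_completions {n k : ℕ} {E : Finset (Finset (Fin n))} (hE : Uniform n k E)
    (S : Finset (Fin n)) :
    deg E S = #{p ∈ powersetCard (k - #S) Sᶜ | S ∪ p ∈ E} := by
  refine Finset.card_nbij' (fun e => e \ S) (fun p => S ∪ p) ?_ ?_ ?_ ?_
  · intro e he
    simp only [coe_filter, Set.mem_ofPred_eq, mem_powersetCard] at he ⊢
    refine ⟨⟨fun x hx => by simp at hx ⊢; exact hx.2, ?_⟩, ?_⟩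
    · rw [card_sdiff_of_subset he.2, hE e he.1]
    · rw [union_sdiff_of_subset he.2]; exact he.1
  · intro p hp
    simp only [coe_filter, Set.mem_ofPred_eq] at hp ⊢
    exact ⟨hp.2, subset_union_left⟩
  · intro e he
    simp only [coe_filter, Set.mem_ofPred_eq] at he ⊢
    exact union_sdiff_of_subset he.2
  · intro p hp
    simp only [coe_filter, Set.mem_ofPred_eq, mem_powersetCard] at hp ⊢
    have : Disjoint S p := (disjoint_compl_right (a := S)).mono_right hp.1.1
    exact union_sdiff_cancel_left this

/-- `d(L, B^(j))` counts the `j`-subsets of `B ∖ L` that complete `L` to an edge. -/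
lemma degIn_eq_card_completions {n : ℕ} (E : Finset (Finset (Fin n))) (L B : Finset (Fin n))
    (j : ℕ) :
    degIn E L B ∅ j 0 = #{p ∈ powersetCard j (B \ L) | L ∪ p ∈ E} := by
  refine Finset.card_nbij' (fun e => e \ L) (fun p => L ∪ p) ?_ ?_ ?_ ?_
  · intro e he
    simp only [coe_filter, Set.mem_ofPred_eq, mem_powersetCard, union_empty] at he ⊢
    obtain ⟨h1, h2, h3, h4, -⟩ := he
    rw [inter_eq_left.2 h3] at h4
    refine ⟨⟨fun x hx => mem_sdiff.2 ⟨h3 hx, (mem_sdiff.1 hx).2⟩, h4⟩, ?_⟩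
    rw [union_sdiff_of_subset h2]; exact h1
  · intro p hp
    simp only [coe_filter, Set.mem_ofPred_eq, mem_powersetCard] at hp ⊢
    obtain ⟨⟨h1, h2⟩, h3⟩ := hp
    have hd : Disjoint L p := disjoint_sdiff.mono_right h1
    have hB : p ⊆ B := h1.trans sdiff_subset
    rw [union_sdiff_cancel_left hd]
    refine ⟨h3, subset_union_left, by simpa using hB, ?_, by simp⟩
    rw [inter_eq_left.2 hB, h2]
  · intro e he
    simp only [coe_filter, Set.mem_ofPred_eq] at he ⊢
    exact union_sdiff_of_subset he.2.1
  · intro p hp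
    simp only [coe_filter, Set.mem_ofPred_eq, mem_powersetCard] at hp ⊢
    exact union_sdiff_cancel_left (disjoint_sdiff.mono_right hp.1.1)

/-- `e(B)` counts the `k`-subsets of `B` that are edges. -/
lemma edgesIn_eq_card {n k : ℕ} {E : Finset (Finset (Fin n))} (hE : Uniform n k E)
    (B : Finset (Fin n)) : edgesIn E B = #{p ∈ powersetCard k B | p ∈ E} := by
  unfold edgesIn
  congr 1
  ext e
  simp only [mem_filter, mem_powersetCard]
  constructor
  · rintro ⟨h1, h2⟩; exact ⟨⟨h2, hE e h1⟩, h1⟩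
  · rintro ⟨⟨h1, _⟩, h2⟩; exact ⟨h2, h1⟩

/-- If `S` has large degree, the non-edges extending `S` by a pair not inside `B` are
outnumbered by the edges extending `S` by a pair inside `B`. -/
lemma card_nonedge_pairs_le {n k : ℕ} (hk : 2 ≤ k) {E : Finset (Finset (Fin n))}
    (hE : Uniform n k E) (B S : Finset (Fin n)) (hS : #S = k - 2)
    (hdeg : (n - (k - 2)).choose 2 ≤ deg E S + (#B - (k - 2)).choose 2) :
    #{p ∈ powersetCard 2 Sᶜ | ¬ p ⊆ B ∧ S ∪ p ∉ E} ≤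
      #{p ∈ powersetCard 2 Sᶜ | p ⊆ B ∧ S ∪ p ∈ E} := by
  have h2 : k - #S = 2 := by omega
  rw [deg_eq_card_completions hE, h2] at hdeg
  have hP : #(powersetCard 2 Sᶜ) = (n - (k - 2)).choose 2 := by
    rw [card_powersetCard, card_compl, Fintype.card_fin, hS]
  have hB : (#B - (k - 2)).choose 2 ≤ #{p ∈ powersetCard 2 Sᶜ | p ⊆ B} := by
    calc _ ≤ (#(B \ S)).choose 2 := Nat.choose_le_choose 2 (by rw [← hS]; exact le_card_sdiff S B)
      _ = #(powersetCard 2 (B \ S)) := (card_powersetCard _ _).symm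
      _ ≤ _ := card_le_card fun p hp => by
        simp only [mem_filter, mem_powersetCard] at hp ⊢
        exact ⟨⟨fun x hx => mem_compl.2 (mem_sdiff.1 (hp.1 hx)).2, hp.2⟩,
          hp.1.trans sdiff_subset⟩
  have e1 := card_filter_add_card_filter_not (s := powersetCard 2 Sᶜ) (fun p => S ∪ p ∈ E)
  have e2 := card_filter_add_card_filter_not (s := {p ∈ powersetCard 2 Sᶜ | S ∪ p ∉ E})
    (fun p => p ⊆ B)
  have e3 := card_filter_add_card_filter_not (s := {p ∈ powersetCard 2 Sᶜ | p ⊆ B})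
    (fun p => S ∪ p ∈ E)
  simp only [filter_filter] at e2 e3
  have e4 : #{p ∈ powersetCard 2 Sᶜ | S ∪ p ∉ E ∧ p ⊆ B} =
      #{p ∈ powersetCard 2 Sᶜ | p ⊆ B ∧ S ∪ p ∉ E} := by simp only [and_comm]
  have e5 : #{p ∈ powersetCard 2 Sᶜ | S ∪ p ∉ E ∧ ¬ p ⊆ B} =
      #{p ∈ powersetCard 2 Sᶜ | ¬ p ⊆ B ∧ S ∪ p ∉ E} := by simp only [and_comm]
  omega

lemma minDeg_le_deg {n s : ℕ} (E : Finset (Finset (Fin n))) {S : Finset (Fin n)}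
    (hS : #S = s) : minDeg n E s ≤ deg E S := Nat.sInf_le ⟨S, hS, rfl⟩

lemma exists_deg_eq_minDeg {n s : ℕ} (E : Finset (Finset (Fin n))) (hs : s ≤ n) :
    ∃ S : Finset (Fin n), #S = s ∧ deg E S = minDeg n E s := by
  obtain ⟨S, -, hS⟩ := exists_subset_card_eq (s := (univ : Finset (Fin n))) (n := s) (by simpa)
  exact Nat.sInf_mem (s := {d | ∃ S : Finset (Fin n), S.card = s ∧ deg E S = d}) ⟨_, S, hS, rfl⟩

/-- The minimum degree of `X_{k,ℓ}(n)` is at least the number of pairs meeting a set of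
the size of its `A`-class. -/
lemma choose_two_le_minDeg_Xedges {n k ℓ : ℕ} (hk : 2 ≤ k) (hn : k - 2 ≤ n) {b : ℕ}
    (hb : n ≤ b + (if Odd (n / (k - ℓ)) then n / (2 * (k - ℓ)) else n / (2 * (k - ℓ)) - 1)) :
    (n - (k - 2)).choose 2 ≤ minDeg n (Xedges n k ℓ) (k - 2) + (b - (k - 2)).choose 2 := by
  obtain ⟨t, ht, hX⟩ : ∃ t, n ≤ b + t ∧ ∀ e : Finset (Fin n), #e = k →
      (∃ v ∈ e, (v : ℕ) < t) → e ∈ Xedges n k ℓ := by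
    refine ⟨_, hb, fun e he hv => ?_⟩
    unfold Xedges
    split_ifs at hv ⊢
    · exact mem_filter.2 ⟨mem_powersetCard.2 ⟨subset_univ _, he⟩, hv⟩
    · exact mem_filter.2 ⟨mem_powersetCard.2 ⟨subset_univ _, he⟩, Or.inl hv⟩
  have hU : Uniform n k (Xedges n k ℓ) := by
    intro e he
    unfold Xedges at he
    split_ifs at he
    · exact (mem_powersetCard.1 (mem_filter.1 he).1).2
    · exact (mem_powersetCard.1 (mem_filter.1 he).1).2
  obtain ⟨S, hS, hd⟩ := exists_deg_eq_minDeg (Xedges n k ℓ) hn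
  rw [← hd, deg_eq_card_completions hU]
  have h2 : k - #S = 2 := by omega
  rw [h2]
  have hP : #(powersetCard 2 Sᶜ) = (n - (k - 2)).choose 2 := by
    rw [card_powersetCard, card_compl, Fintype.card_fin, hS]
  rw [← hP, ← card_filter_add_card_filter_not (s := powersetCard 2 Sᶜ)
    (fun p => S ∪ p ∈ Xedges n k ℓ)]
  gcongr
  have hcard : ∀ p ∈ powersetCard 2 Sᶜ, #(S ∪ p) = k := by
    intro p hp
    rw [mem_powersetCard] at hp
    rw [card_union_of_disjoint ((disjoint_compl_right (a := S)).mono_right hp.1)]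
    omega
  by_cases hm : ∃ v ∈ S, (v : ℕ) < t
  · rw [filter_false_of_mem, card_empty]
    · exact Nat.zero_le _
    · intro p hp hne
      obtain ⟨v, hv, hvt⟩ := hm
      exact hne (hX _ (hcard p hp) ⟨v, mem_union_left _ hv, hvt⟩)
  · push Not at hm
    set T : Finset (Fin n) := {v | t ≤ (v : ℕ)} with hT
    have hTc : #T ≤ b := by
      have h1 : #T ≤ #(Finset.Ico t n) := card_le_card_of_injOn (fun v => (v : ℕ))
        (fun v hv => by simp [hT] at hv ⊢; exact hv) (fun _ _ _ _ h => Fin.ext h)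
      rw [Nat.card_Ico] at h1
      omega
    have hST : S ⊆ T := fun v hv => by simpa [hT] using hm v hv
    calc _ ≤ #(powersetCard 2 (T \ S)) := card_le_card fun p hp => by
            simp only [mem_filter] at hp
            have hp' := mem_powersetCard.1 hp.1
            refine mem_powersetCard.2 ⟨fun x hx => mem_sdiff.2 ⟨?_, mem_compl.1 (hp'.1 hx)⟩, hp'.2⟩
            by_contra hxT
            exact hp.2 (hX _ (hcard p hp.1) ⟨x, mem_union_right _ hx, by simpa [hT] using hxT⟩)
      _ = (#T - (k - 2)).choose 2 := by rw [card_powersetCard, card_sdiff_of_subset hST, hS]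
      _ ≤ _ := Nat.choose_le_choose 2 (by omega)

/-- Averaging the pair count over all `D` with `|L ∪ D| = k - 2`: few edges in the link of `L`
inside `B` force few non-edges `L ∪ {a} ∪ C` with `a ∉ B` and `C ⊆ B`. -/
lemma card_nonedge_stars_le {n k r : ℕ} {E : Finset (Finset (Fin n))} (B L : Finset (Fin n))
    (hr : 1 ≤ r) (hL : #L + r + 1 = k)
    (hpair : ∀ S : Finset (Fin n), #S = k - 2 →
      #{p ∈ powersetCard 2 Sᶜ | ¬ p ⊆ B ∧ S ∪ p ∉ E} ≤
        #{p ∈ powersetCard 2 Sᶜ | p ⊆ B ∧ S ∪ p ∈ E}) :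
    r * #{q ∈ (Bᶜ \ L) ×ˢ powersetCard r (B \ L) | L ∪ {q.1} ∪ q.2 ∉ E} ≤
      (r + 1).choose 2 * degIn E L B ∅ (r + 1) 0 := by
  set Q := {q ∈ (Bᶜ \ L) ×ˢ powersetCard r (B \ L) | L ∪ {q.1} ∪ q.2 ∉ E} with hQ
  have hQmem : ∀ q ∈ Q, (q.1 ∉ B ∧ q.1 ∉ L) ∧ (q.2 ⊆ B \ L ∧ #q.2 = r) ∧
      L ∪ {q.1} ∪ q.2 ∉ E := by
    intro q hq
    simpa [hQ, and_assoc] using hq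
  have hlow : r * #Q ≤ ∑ D ∈ powersetCard (r - 1) (B \ L),
      #{p ∈ powersetCard 2 (L ∪ D)ᶜ | ¬ p ⊆ B ∧ L ∪ D ∪ p ∉ E} := by
    have h1 : r * #Q = #(Q.sigma fun q => q.2) := by
      rw [card_sigma, sum_congr rfl (fun q hq => (hQmem q hq).2.1.2), sum_const, smul_eq_mul,
        mul_comm]
    rw [h1, ← card_sigma]
    refine card_le_card_of_injOn (fun z => ⟨z.1.2.erase z.2, {z.1.1, z.2}⟩) ?_ ?_
    · rintro ⟨⟨a, C⟩, x⟩ hz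
      simp only [coe_sigma, Set.mem_sigma_iff, mem_coe] at hz
      obtain ⟨hq, hx⟩ := hz
      obtain ⟨⟨haB, haL⟩, ⟨hC, hCr⟩, hne⟩ := hQmem _ hq
      simp only at haB haL hC hCr hne hx
      have hxB := mem_sdiff.1 (hC hx)
      simp only [coe_sigma, Set.mem_sigma_iff, mem_coe, mem_filter, mem_powersetCard]
      refine ⟨⟨(erase_subset _ _).trans hC, by rw [card_erase_of_mem hx, hCr]⟩, ⟨?_, ?_⟩, ?_, ?_⟩
      · intro y hy
        simp only [mem_insert, mem_singleton] at hy
        simp only [mem_compl, mem_union, mem_erase, not_or]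
        rcases hy with rfl | rfl
        · exact ⟨haL, fun h => haB (mem_sdiff.1 (hC h.2)).1⟩
        · exact ⟨hxB.2, fun h => h.1 rfl⟩
      · exact card_pair (fun h => haB (h ▸ hxB.1))
      · exact fun h => haB (h (by simp))
      · convert hne using 2
        ext y
        simp only [mem_union, mem_erase, mem_insert, mem_singleton]
        by_cases hyx : y = x
        · subst hyx; simp [hx]
        · simp only [hyx]; tauto
    · rintro ⟨⟨a, C⟩, x⟩ hz ⟨⟨a', C'⟩, x'⟩ hz' heq
      simp only [coe_sigma, Set.mem_sigma_iff, mem_coe] at hz hz'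
      obtain ⟨hq, hx⟩ := hz
      obtain ⟨hq', hx'⟩ := hz'
      obtain ⟨⟨haB, -⟩, ⟨hC, -⟩, -⟩ := hQmem _ hq
      obtain ⟨⟨haB', -⟩, ⟨hC', -⟩, -⟩ := hQmem _ hq'
      simp only at haB haB' hC hC' hx hx'
      have hxB := (mem_sdiff.1 (hC hx)).1
      have hxB' := (mem_sdiff.1 (hC' hx')).1
      simp only [Sigma.mk.injEq, heq_eq_eq] at heq
      obtain ⟨h1, h2⟩ := heq
      have ha : a = a' := by
        have : a ∈ ({a', x'} : Finset (Fin n)) := h2 ▸ by simp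
        rcases mem_insert.1 this with h | h
        · exact h
        · exact absurd ((mem_singleton.1 h) ▸ hxB') haB
      have hxx : x = x' := by
        have : x ∈ ({a', x'} : Finset (Fin n)) := h2 ▸ by simp
        rcases mem_insert.1 this with h | h
        · exact absurd (h ▸ hxB) haB'
        · exact mem_singleton.1 h
      subst ha hxx
      have : C = C' := by rw [← insert_erase hx, h1, insert_erase hx']
      subst this
      rfl
  have hup : ∑ D ∈ powersetCard (r - 1) (B \ L),
      #{p ∈ powersetCard 2 (L ∪ D)ᶜ | p ⊆ B ∧ L ∪ D ∪ p ∈ E} ≤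
        (r + 1).choose 2 * degIn E L B ∅ (r + 1) 0 := by
    rw [degIn_eq_card_completions]
    set F := {p ∈ powersetCard (r + 1) (B \ L) | L ∪ p ∈ E} with hF
    have h1 : (r + 1).choose 2 * #F = #(F.sigma fun f => powersetCard 2 f) := by
      rw [card_sigma, sum_congr rfl (g := fun _ => (r + 1).choose 2), sum_const, smul_eq_mul,
        mul_comm]
      intro f hf
      rw [card_powersetCard, (mem_powersetCard.1 (mem_filter.1 hf).1).2]
    rw [h1, ← card_sigma]
    have hdisj : ∀ z ∈ (powersetCard (r - 1) (B \ L)).sigma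
        (fun D => {p ∈ powersetCard 2 (L ∪ D)ᶜ | p ⊆ B ∧ L ∪ D ∪ p ∈ E}), Disjoint z.1 z.2 := by
      rintro ⟨D, p⟩ hz
      simp only [mem_sigma, mem_filter, mem_powersetCard] at hz
      exact disjoint_right.2 fun x hx hxD => mem_compl.1 (hz.2.1.1 hx) (mem_union_right _ hxD)
    refine card_le_card_of_injOn (fun z => ⟨z.1 ∪ z.2, z.2⟩) ?_ ?_
    · intro z hz
      have hd := hdisj z hz
      obtain ⟨D, p⟩ := z
      simp only [mem_coe, mem_sigma, mem_filter, mem_powersetCard, hF] at hz hd ⊢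
      obtain ⟨⟨hD, hDc⟩, ⟨hp, hpc⟩, hpB, hpE⟩ := hz
      refine ⟨⟨⟨union_subset hD fun x hx => mem_sdiff.2 ⟨hpB hx, fun h =>
        mem_compl.1 (hp hx) (mem_union_left _ h)⟩, ?_⟩, ?_⟩, subset_union_right, hpc⟩
      · rw [card_union_of_disjoint hd]; omega
      · rwa [← union_assoc]
    · intro z hz z' hz' heq
      have hd := hdisj z hz
      have hd' := hdisj z' hz'
      obtain ⟨D, p⟩ := z
      obtain ⟨D', p'⟩ := z'
      simp only [Sigma.mk.injEq, heq_eq_eq] at heq hd hd'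
      obtain ⟨h1, rfl⟩ := heq
      have : D = D' := by
        rw [← union_sdiff_cancel_right hd, h1, union_sdiff_cancel_right hd']
      subst this
      rfl
  refine hlow.trans ((sum_le_sum fun D hD => hpair _ ?_).trans hup)
  rw [mem_powersetCard] at hD
  rw [card_union_of_disjoint (disjoint_sdiff.mono_right hD.1), hD.2]
  omega

/-- Double counting of pairs (`s`-set of `𝓕`, edge in `B` containing it). -/
lemma sum_degIn_le {n k s : ℕ} {E : Finset (Finset (Fin n))} (hE : Uniform n k E)
    (B : Finset (Fin n)) (hs : s ≤ k) {𝓕 : Finset (Finset (Fin n))}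
    (h𝓕 : 𝓕 ⊆ powersetCard s B) :
    ∑ S ∈ 𝓕, degIn E S B ∅ (k - s) 0 ≤ k.choose s * edgesIn E B := by
  have h1 : k.choose s * edgesIn E B =
      #({p ∈ powersetCard k B | p ∈ E}.sigma fun f => powersetCard s f) := by
    rw [edgesIn_eq_card hE, card_sigma, sum_congr rfl (g := fun _ => k.choose s), sum_const,
      smul_eq_mul, mul_comm]
    intro f hf
    rw [card_powersetCard, (mem_powersetCard.1 (mem_filter.1 hf).1).2]
  simp only [degIn_eq_card_completions]
  rw [h1, ← card_sigma]
  have hdisj : ∀ z ∈ 𝓕.sigma (fun S => {p ∈ powersetCard (k - s) (B \ S) | S ∪ p ∈ E}),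
      Disjoint z.1 z.2 := by
    rintro ⟨D, p⟩ hz
    simp only [mem_sigma, mem_filter, mem_powersetCard] at hz
    exact disjoint_sdiff.mono_right hz.2.1.1
  refine card_le_card_of_injOn (fun z => ⟨z.1 ∪ z.2, z.1⟩) ?_ ?_
  · intro z hz
    have hd := hdisj z hz
    obtain ⟨D, p⟩ := z
    simp only [mem_coe, mem_sigma, mem_filter, mem_powersetCard] at hz hd ⊢
    obtain ⟨hD, ⟨hp, hpc⟩, hpE⟩ := hz
    have hD' := mem_powersetCard.1 (h𝓕 hD)
    refine ⟨⟨⟨union_subset hD'.1 (hp.trans sdiff_subset), ?_⟩, hpE⟩, subset_union_left, hD'.2⟩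
    rw [card_union_of_disjoint hd]; omega
  · intro z hz z' hz' heq
    have hd := hdisj z hz
    have hd' := hdisj z' hz'
    obtain ⟨D, p⟩ := z
    obtain ⟨D', p'⟩ := z'
    simp only [Sigma.mk.injEq, heq_eq_eq] at heq hd hd'
    obtain ⟨h1, rfl⟩ := heq
    have : p = p' := by
      rw [← union_sdiff_cancel_left hd, h1, union_sdiff_cancel_left hd']
    subst this
    rfl

/-- The number of `r`-subsets of `B` containing a member of a family of `s`-subsets. -/
lemma card_filter_exists_subset_mul_le {α : Type*} [DecidableEq α] {B : Finset α} {s r : ℕ}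
    (hsr : s ≤ r) {𝓕 : Finset (Finset α)} (h𝓕 : 𝓕 ⊆ powersetCard s B) :
    #{C ∈ powersetCard r B | ∃ S ∈ 𝓕, S ⊆ C} * (#B).choose s ≤
      #𝓕 * (r.choose s * (#B).choose r) := by
  have h1 : #{C ∈ powersetCard r B | ∃ S ∈ 𝓕, S ⊆ C} ≤
      #𝓕 * (#B - s).choose (r - s) := by
    calc _ ≤ #(𝓕.biUnion fun S => {C ∈ powersetCard r B | S ⊆ C}) := by
            refine card_le_card fun C hC => ?_
            simp only [mem_filter, mem_biUnion] at hC ⊢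
            obtain ⟨hC, S, hS, hSC⟩ := hC
            exact ⟨S, hS, hC, hSC⟩
      _ ≤ _ := by
        refine card_biUnion_le_card_mul _ _ _ fun S hS => ?_
        have hS' := mem_powersetCard.1 (h𝓕 hS)
        calc _ ≤ #(powersetCard (r - s) (B \ S)) := by
              refine card_le_card_of_injOn (fun C => C \ S) ?_ ?_
              · intro C hC
                simp only [mem_coe, mem_filter, mem_powersetCard] at hC ⊢
                exact ⟨sdiff_subset_sdiff hC.1.1 subset_rfl, by
                  rw [card_sdiff_of_subset hC.2, hC.1.2, hS'.2]⟩
              · intro C hC C' hC' h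
                simp only [mem_coe, mem_filter] at hC hC' h
                rw [← union_sdiff_of_subset hC.2, h, union_sdiff_of_subset hC'.2]
          _ = _ := by rw [card_powersetCard, card_sdiff_of_subset hS'.1, hS'.2]
  calc _ ≤ #𝓕 * (#B - s).choose (r - s) * (#B).choose s := Nat.mul_le_mul_right _ h1
    _ = _ := by rw [mul_assoc, mul_comm ((#B - s).choose _), ← Nat.choose_mul hsr,
      mul_comm (r.choose s)]

lemma choose_le_four_pow_mul_choose {n b j : ℕ} (h : n ≤ 4 * (b + 1 - j)) :
    n.choose j ≤ 4 ^ j * b.choose j := by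
  have h1 := (Nat.descFactorial_le_pow n j).trans (Nat.pow_le_pow_left h j)
  rw [mul_pow] at h1
  have h2 := h1.trans (Nat.mul_le_mul_left _ (Nat.pow_sub_le_descFactorial b j))
  rw [Nat.descFactorial_eq_factorial_mul_choose, Nat.descFactorial_eq_factorial_mul_choose,
    mul_left_comm] at h2
  exact Nat.le_of_mul_le_mul_left h2 (Nat.factorial_pos j)

lemma two_mul_le_of_mul_le_choose_two_mul {r b Q d : ℕ} (hr : 1 ≤ r) {c : ℝ} (hc : 0 ≤ c)
    (h : r * Q ≤ (r + 1).choose 2 * d) (hd : (d : ℝ) ≤ c * b.choose (r + 1)) :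
    2 * (Q : ℝ) ≤ c * b * b.choose r := by
  have h1 : 2 * (r * Q) ≤ (r + 1) * r * d := by
    have h2 := Nat.add_one_mul_choose_eq r 1
    rw [Nat.choose_one_right] at h2
    calc 2 * (r * Q) ≤ 2 * ((r + 1).choose 2 * d) := by gcongr
      _ = (r + 1).choose 2 * 2 * d := by ring
      _ = _ := by rw [← h2]
  have h3 : 2 * Q ≤ (r + 1) * d := by
    refine Nat.le_of_mul_le_mul_left (c := r) ?_ hr
    calc r * (2 * Q) = 2 * (r * Q) := by ring
      _ ≤ _ := h1
      _ = _ := by ring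
  have h4 : b.choose (r + 1) * (r + 1) ≤ b.choose r * b := by
    rw [Nat.choose_succ_right_eq]; gcongr; omega
  have h3' : 2 * (Q : ℝ) ≤ (r + 1) * d := by exact_mod_cast h3
  have h4' : (b.choose (r + 1) : ℝ) * (r + 1) ≤ b.choose r * b := by exact_mod_cast h4
  calc 2 * (Q : ℝ) ≤ (r + 1) * d := h3'
    _ ≤ (r + 1) * (c * b.choose (r + 1)) := by gcongr
    _ = c * (b.choose (r + 1) * (r + 1)) := by ring
    _ ≤ c * (b.choose r * b) := by gcongr
    _ = _ := by ring

/-- If `B` spans few edges, then few `s`-subsets of `B` have large degree into `B`. -/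
lemma card_high_degree_family_le {n k s : ℕ} {E : Finset (Finset (Fin n))} (hE : Uniform n k E)
    {B : Finset (Fin n)} {ε : ℝ} (hε : 0 < ε) (hs : s ≤ k) (hkB : k ≤ #B)
    (he : (edgesIn E B : ℝ) ≤ ε ^ 2 * (#B).choose k) {𝓕 : Finset (Finset (Fin n))}
    (h𝓕 : 𝓕 ⊆ powersetCard s B)
    (hdeg : ∀ S ∈ 𝓕, ε * (#B).choose (k - s) < degIn E S B ∅ (k - s) 0) :
    (#𝓕 : ℝ) ≤ ε * (#B).choose s := by
  have hpos : (0 : ℝ) < (#B).choose (k - s) := by exact_mod_cast Nat.choose_pos (by omega)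
  have h1 : (#𝓕 : ℝ) * (ε * (#B).choose (k - s)) ≤ k.choose s * edgesIn E B := by
    calc _ = ∑ S ∈ 𝓕, ε * ((#B).choose (k - s) : ℝ) := by rw [sum_const, nsmul_eq_mul]
      _ ≤ ∑ S ∈ 𝓕, (degIn E S B ∅ (k - s) 0 : ℝ) := sum_le_sum fun S hS => (hdeg S hS).le
      _ ≤ _ := by exact_mod_cast sum_degIn_le hE B hs h𝓕
  have h2 : (#B).choose k * k.choose s ≤ (#B).choose s * (#B).choose (k - s) := by
    rw [Nat.choose_mul hs]
    gcongr
    omega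
  have h2' : ((#B).choose k : ℝ) * k.choose s ≤ (#B).choose s * (#B).choose (k - s) := by
    exact_mod_cast h2
  refine le_of_mul_le_mul_right ?_ (mul_pos hε hpos)
  calc _ ≤ (k.choose s : ℝ) * edgesIn E B := h1
    _ ≤ k.choose s * (ε ^ 2 * (#B).choose k) := by gcongr
    _ = ε ^ 2 * ((#B).choose k * k.choose s) := by ring
    _ ≤ ε ^ 2 * ((#B).choose s * (#B).choose (k - s)) := by gcongr
    _ = _ := by ring

/-- If `B` spans few edges, almost all vertices outside `B` lie in `A_ε`. -/
lemma card_compl_sdiff_Aeps_le {n k : ℕ} {E : Finset (Finset (Fin n))} (hE : Uniform n k E)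
    {B : Finset (Fin n)} {ε : ℝ} (hε : 0 < ε) (hk : 2 ≤ k) (hkB : k ≤ #B)
    (he : (edgesIn E B : ℝ) ≤ ε ^ 2 * (#B).choose k)
    (hpair : ∀ S : Finset (Fin n), #S = k - 2 →
      #{p ∈ powersetCard 2 Sᶜ | ¬ p ⊆ B ∧ S ∪ p ∉ E} ≤
        #{p ∈ powersetCard 2 Sᶜ | p ⊆ B ∧ S ∪ p ∈ E}) :
    (#(Bᶜ \ Aeps n k E B ε) : ℝ) ≤ ε * #B := by
  have hpos : (0 : ℝ) < (#B).choose (k - 1) := by exact_mod_cast Nat.choose_pos (by omega)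
  have hk1 : k - 1 + 1 = k := by omega
  have hQ := card_nonedge_stars_le (r := k - 1) B ∅ (by omega) (by simp; omega) hpair
  have hd : degIn E ∅ B ∅ (k - 1 + 1) 0 = edgesIn E B := by
    rw [degIn_eq_card_completions, edgesIn_eq_card hE, hk1]
    simp
  rw [hd] at hQ
  have h2 := two_mul_le_of_mul_le_choose_two_mul (b := #B) (c := ε ^ 2) (by omega)
    (by positivity) hQ (by rwa [hk1])
  simp only [sdiff_empty, empty_union] at h2
  set Q := {q ∈ Bᶜ ×ˢ powersetCard (k - 1) B | {q.1} ∪ q.2 ∉ E} with hQdef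
  set A' := Bᶜ \ Aeps n k E B ε with hA'
  have h3 : ∑ a ∈ A', #{C ∈ powersetCard (k - 1) B | {a} ∪ C ∉ E} ≤ #Q := by
    rw [← card_sigma]
    refine card_le_card_of_injOn (fun z => (z.1, z.2)) ?_ ?_
    · rintro ⟨a, C⟩ hz
      simp only [mem_coe, mem_sigma, mem_filter, hA', mem_sdiff] at hz
      simp only [mem_coe, hQdef, mem_filter, mem_product]
      exact ⟨⟨hz.1.1, hz.2.1⟩, hz.2.2⟩
    · rintro ⟨a, C⟩ - ⟨a', C'⟩ - h
      simp only [Prod.mk.injEq] at h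
      obtain ⟨rfl, rfl⟩ := h
      rfl
  have h4 : ∀ a ∈ A', ε * ((#B).choose (k - 1) : ℝ) ≤
      (#{C ∈ powersetCard (k - 1) B | {a} ∪ C ∉ E} : ℝ) := by
    intro a ha
    simp only [hA', mem_sdiff, mem_compl, Aeps, mem_filter, mem_univ, true_and, not_le] at ha
    obtain ⟨haB, hlt⟩ := ha
    rw [degIn_eq_card_completions, sdiff_singleton_eq_erase, erase_eq_of_notMem haB] at hlt
    have h5 := card_filter_add_card_filter_not (s := powersetCard (k - 1) B)
      (fun C => {a} ∪ C ∈ E)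
    rw [card_powersetCard] at h5
    have h5' : (#{C ∈ powersetCard (k - 1) B | {a} ∪ C ∈ E} : ℝ) +
      #{C ∈ powersetCard (k - 1) B | {a} ∪ C ∉ E} = (#B).choose (k - 1) := by exact_mod_cast h5
    linarith
  have h6 : (#A' : ℝ) * (ε * (#B).choose (k - 1)) ≤ #Q := by
    calc _ = ∑ a ∈ A', ε * ((#B).choose (k - 1) : ℝ) := by rw [sum_const, nsmul_eq_mul]
      _ ≤ ∑ a ∈ A', (#{C ∈ powersetCard (k - 1) B | {a} ∪ C ∉ E} : ℝ) := sum_le_sum h4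
      _ ≤ _ := by exact_mod_cast h3
  have h7 : (0 : ℝ) ≤ #Q := Nat.cast_nonneg _
  refine le_of_mul_le_mul_right ?_ (mul_pos hε hpos)
  calc _ ≤ (#Q : ℝ) := h6
    _ ≤ ε ^ 2 * #B * (#B).choose (k - 1) := by linarith
    _ = _ := by ring

/-- The size of the `A`-class of an extremal partition agrees with that of `X_{k,ℓ}(n)`. -/
lemma ceil_sub_one_bounds_s9 {n q : ℕ} (hq : 1 ≤ q) (hqn : q ∣ n) (hn : 2 * q ≤ n) {a : ℕ}
    (ha : a = ⌈(n : ℝ) / (2 * (q : ℝ))⌉₊ - 1) :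
    a ≤ (if Odd (n / q) then n / (2 * q) else n / (2 * q) - 1) ∧ n ≤ 2 * q * (a + 1) := by
  obtain ⟨m, rfl⟩ := hqn
  have hq0 : (q : ℝ) ≠ 0 := by positivity
  have e1 : ((q * m : ℕ) : ℝ) / (2 * (q : ℝ)) = (m : ℝ) / 2 := by
    push_cast; field_simp
  have e2 : q * m / (2 * q) = m / 2 := by
    rw [mul_comm 2 q, Nat.mul_div_mul_left _ _ hq]
  have e4 : ⌈(m : ℝ) / 2⌉₊ = (m + 1) / 2 := by
    apply le_antisymm
    · rw [Nat.ceil_le]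
      have : m ≤ 2 * ((m + 1) / 2) := by omega
      have : (m : ℝ) ≤ 2 * ((m + 1) / 2 : ℕ) := by exact_mod_cast this
      linarith
    · have h := Nat.le_ceil ((m : ℝ) / 2)
      have h' : (m : ℝ) ≤ (2 * ⌈(m : ℝ) / 2⌉₊ : ℕ) := by push_cast; linarith
      have h'' : m ≤ 2 * ⌈(m : ℝ) / 2⌉₊ := by exact_mod_cast h'
      omega
  have hm : 2 ≤ m := by
    by_contra h
    have : q * m ≤ q * 1 := Nat.mul_le_mul_left q (by omega)
    omega
  rw [e1, e4] at ha
  rw [e2, Nat.mul_div_cancel_left m hq]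
  constructor
  · split_ifs with h
    · obtain ⟨c, rfl⟩ := h; omega
    · rw [Nat.not_odd_iff_even] at h
      obtain ⟨c, rfl⟩ := h; omega
  · calc q * m ≤ q * (2 * (a + 1)) := Nat.mul_le_mul_left q (by omega)
      _ = _ := by ring

/-- A typical set with sparse link in `B` extends by a vertex of `A_ε` and typical vertices of
`B_ε`, avoiding any prescribed small set `U`. -/
lemma exists_typical_extension {n k ℓ : ℕ} (hl : 1 ≤ ℓ) (hlk : 2 * ℓ < k)
    {E : Finset (Finset (Fin n))} (hE : Uniform n k E) {B : Finset (Fin n)} {ε : ℝ} (hε : 0 < ε)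
    (hεk : ε * (20 * k + 2 ^ k) < 1) (hkB : k ≤ #B) (hnB : n ≤ 2 * #B)
    (hnA : n ≤ 4 * k * #Bᶜ) (hn : (k : ℝ) ≤ ε * n)
    (he : (edgesIn E B : ℝ) ≤ ε ^ 2 * (#B).choose k)
    (hpair : ∀ S : Finset (Fin n), #S = k - 2 →
      #{p ∈ powersetCard 2 Sᶜ | ¬ p ⊆ B ∧ S ∪ p ∉ E} ≤
        #{p ∈ powersetCard 2 Sᶜ | p ⊆ B ∧ S ∪ p ∈ E})
    {L U : Finset (Fin n)} (hL : IsTypical n k ℓ E B ε L) (hU : (#U : ℝ) ≤ ε * n) :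
    ∃ a : Fin n, a ∈ Aeps n k E B ε \ U ∧
      ∃ C : Finset (Fin n), C ⊆ Beps n k E B ε \ U ∧ #C = k - ℓ - 1 ∧
        a ∉ C ∧ a ∉ L ∧ Disjoint L C ∧ L ∪ {a} ∪ C ∈ E ∧
        ∀ L' : Finset (Fin n), L' ⊆ C → #L' = ℓ → IsTypical n k ℓ E B ε L' := by
  classical
  obtain ⟨hLc, -, hLdeg⟩ := hL
  obtain ⟨r, hr⟩ : ∃ r, r = k - ℓ - 1 := ⟨_, rfl⟩
  have hr1 : r + 1 = k - ℓ := by omega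
  rw [← hr1] at hLdeg
  rw [← hr]
  by_contra hcon
  set X := L ∪ U ∪ (Bᶜ \ Aeps n k E B ε) with hX
  set Y := (L ∪ U) ∩ B ∪ (B \ Beps n k E B ε) with hY
  set 𝓕₁ : Finset (Finset (Fin n)) := Y.image singleton with h𝓕₁
  set 𝓕₂ : Finset (Finset (Fin n)) :=
    {S ∈ powersetCard ℓ B | ε * ((#B).choose (k - ℓ) : ℝ) < degIn E S B ∅ (k - ℓ) 0} with h𝓕₂
  set P := powersetCard r B with hP
  set P₁ := {C ∈ P | ∃ S ∈ 𝓕₁, S ⊆ C} with hP₁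
  set P₂ := {C ∈ P | ∃ S ∈ 𝓕₂, S ⊆ C} with hP₂
  set Q := {q ∈ (Bᶜ \ L) ×ˢ powersetCard r (B \ L) | L ∪ {q.1} ∪ q.2 ∉ E} with hQ
  have hcover : Bᶜ ×ˢ P ⊆ X ×ˢ P ∪ Bᶜ ×ˢ P₁ ∪ Bᶜ ×ˢ P₂ ∪ Q := by
    rintro ⟨a, C⟩ hq
    have hq' := hq
    by_contra hnot
    simp only [mem_union, mem_product, not_or] at hq hnot
    obtain ⟨⟨⟨h1, h2⟩, h3⟩, h4⟩ := hnot
    obtain ⟨haB, hCP⟩ := hq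
    have hC := mem_powersetCard.1 hCP
    have haX : a ∉ X := fun h => h1 ⟨h, hCP⟩
    simp only [hX, mem_union, mem_sdiff, not_or, not_and, not_not] at haX
    have hCY : ∀ x ∈ C, x ∉ Y := fun x hx hxY => h2 ⟨haB, mem_filter.2 ⟨hCP, {x},
      mem_image_of_mem _ hxY, singleton_subset_iff.2 hx⟩⟩
    have hCY' : ∀ x ∈ C, (x ∉ L ∧ x ∉ U) ∧ x ∈ Beps n k E B ε := by
      intro x hx
      have h5 := hCY x hx
      have hxB := hC.1 hx
      simp only [hY, mem_union, mem_inter, mem_sdiff, hxB, and_true, true_and, not_or,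
        not_not] at h5
      exact h5
    have hdL : Disjoint L C := disjoint_right.2 fun x hx => (hCY' x hx).1.1
    refine hcon ⟨a, mem_sdiff.2 ⟨haX.2 haB, haX.1.2⟩, C,
      fun x hx => mem_sdiff.2 ⟨(hCY' x hx).2, (hCY' x hx).1.2⟩, hC.2,
      fun h => mem_compl.1 haB (hC.1 h), haX.1.1, hdL, ?_, ?_⟩
    · by_contra hne
      refine h4 (mem_filter.2 ⟨mem_product.2 ⟨mem_sdiff.2 ⟨haB, haX.1.1⟩,
        mem_powersetCard.2 ⟨fun x hx => mem_sdiff.2 ⟨hC.1 hx, (hCY' x hx).1.1⟩, hC.2⟩⟩, hne⟩)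
    · intro L' hL'C hL'
      refine ⟨hL', fun x hx => (hCY' x (hL'C hx)).2, ?_⟩
      by_contra hlt
      exact h3 ⟨haB, mem_filter.2 ⟨hCP, L', mem_filter.2
        ⟨mem_powersetCard.2 ⟨hL'C.trans hC.1, hL'⟩, not_le.1 hlt⟩, hL'C⟩⟩
  have hcard : #Bᶜ * #P ≤ #X * #P + #Bᶜ * #P₁ + #Bᶜ * #P₂ + #Q := by
    rw [← card_product, ← card_product, ← card_product, ← card_product]
    refine (card_le_card hcover).trans ((card_union_le _ _).trans ?_)
    gcongr
    refine (card_union_le _ _).trans ?_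
    gcongr
    exact card_union_le _ _
  have hLn : (#L : ℝ) ≤ ε * n := by
    rw [hLc]; refine le_trans ?_ hn; exact_mod_cast (by omega : ℓ ≤ k)
  have hLU : (#(L ∪ U) : ℝ) ≤ 2 * (ε * n) := by
    have : (#(L ∪ U) : ℝ) ≤ #L + #U := by exact_mod_cast card_union_le L U
    linarith
  have hBn : (#B : ℝ) ≤ n := by exact_mod_cast (card_le_univ B).trans_eq (Fintype.card_fin n)
  have hεB : ε * #B ≤ ε * n := by gcongr
  have hXc : (#X : ℝ) ≤ 3 * (ε * n) := by
    have h1 : (#X : ℝ) ≤ #(L ∪ U) + #(Bᶜ \ Aeps n k E B ε) := by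
      exact_mod_cast card_union_le _ _
    have h2 := card_compl_sdiff_Aeps_le hE hε (by omega) hkB he hpair
    linarith
  have hYc : (#Y : ℝ) ≤ 3 * (ε * n) := by
    have h1 : (#Y : ℝ) ≤ #((L ∪ U) ∩ B) + #(B \ Beps n k E B ε) := by
      exact_mod_cast card_union_le _ _
    have h2 : (#((L ∪ U) ∩ B) : ℝ) ≤ #(L ∪ U) := by
      exact_mod_cast card_le_card inter_subset_left
    have h3 := card_high_degree_family_le (s := 1) hE hε (by omega) hkB he
      (𝓕 := (B \ Beps n k E B ε).image singleton) ?_ ?_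
    · rw [card_image_of_injective _ singleton_injective, Nat.choose_one_right] at h3
      linarith
    · intro S hS
      obtain ⟨x, hx, rfl⟩ := mem_image.1 hS
      exact mem_powersetCard.2 ⟨singleton_subset_iff.2 (mem_sdiff.1 hx).1, card_singleton x⟩
    · intro S hS
      obtain ⟨x, hx, rfl⟩ := mem_image.1 hS
      simpa [Beps] using (mem_sdiff.1 hx).2
  have hB0 : (0 : ℝ) < #B := by exact_mod_cast (by omega : 0 < #B)
  have hnB' : (n : ℝ) ≤ 2 * #B := by exact_mod_cast hnB
  have hnA' : (n : ℝ) ≤ 4 * k * #Bᶜ := by exact_mod_cast hnA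
  have hk0 : (0 : ℝ) < k := by exact_mod_cast (by omega : 0 < k)
  have hn0 : (0 : ℝ) < n := by linarith
  have hA0 : (0 : ℝ) < #Bᶜ := by
    by_contra h
    have : (#Bᶜ : ℝ) = 0 := le_antisymm (not_lt.1 h) (Nat.cast_nonneg _)
    rw [this] at hnA'; linarith
  have hM : (#P : ℝ) = (#B).choose r := by rw [hP, card_powersetCard]
  have hM0 : (0 : ℝ) < #P := by rw [hM]; exact_mod_cast Nat.choose_pos (by omega)
  have hrk : (r : ℝ) ≤ k := by exact_mod_cast (by omega : r ≤ k)
  have hP₁c : (#P₁ : ℝ) ≤ 6 * ε * k * #P := by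
    have h1 := card_filter_exists_subset_mul_le (B := B) (s := 1) (r := r) (𝓕 := 𝓕₁)
      (by omega) (by
      intro S hS
      obtain ⟨x, hx, rfl⟩ := mem_image.1 hS
      refine mem_powersetCard.2 ⟨singleton_subset_iff.2 ?_, card_singleton x⟩
      rcases mem_union.1 hx with h | h
      · exact (mem_inter.1 h).2
      · exact (mem_sdiff.1 h).1)
    rw [h𝓕₁, card_image_of_injective _ singleton_injective, ← h𝓕₁, Nat.choose_one_right,
      Nat.choose_one_right] at h1
    have h2 : (#P₁ : ℝ) * #B ≤ #Y * (r * #P) := by rw [hM]; exact_mod_cast h1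
    refine le_of_mul_le_mul_right (h2.trans ?_) hB0
    calc (#Y : ℝ) * (r * #P) ≤ (3 * (ε * (2 * #B))) * (k * #P) := by
          gcongr
          exact hYc.trans (by gcongr)
      _ = _ := by ring
  have hP₂c : (#P₂ : ℝ) ≤ ε * 2 ^ k * #P := by
    have h1 := card_filter_exists_subset_mul_le (B := B) (s := ℓ) (r := r) (𝓕 := 𝓕₂) (by omega)
      (filter_subset _ _)
    have h2 : (#P₂ : ℝ) * (#B).choose ℓ ≤ #𝓕₂ * (r.choose ℓ * #P) := by
      rw [hM]; exact_mod_cast h1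
    have h3 := card_high_degree_family_le (s := ℓ) hE hε (by omega) hkB he (𝓕 := 𝓕₂)
      (filter_subset _ _) (fun S hS => (mem_filter.1 hS).2)
    have h4 : (r.choose ℓ : ℝ) ≤ 2 ^ k := by
      exact_mod_cast (Nat.choose_le_two_pow r ℓ).trans
        (Nat.pow_le_pow_right (by omega) (by omega))
    have h5 : (0 : ℝ) < (#B).choose ℓ := by exact_mod_cast Nat.choose_pos (by omega)
    refine le_of_mul_le_mul_right (h2.trans ?_) h5
    calc (#𝓕₂ : ℝ) * (r.choose ℓ * #P) ≤ (ε * (#B).choose ℓ) * (2 ^ k * #P) := by gcongr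
      _ = _ := by ring
  have hQc : 2 * (#Q : ℝ) ≤ ε * #B * #P := by
    rw [hM]
    exact two_mul_le_of_mul_le_choose_two_mul (by omega) hε.le
      (card_nonedge_stars_le B L (by omega) (by omega) hpair) hLdeg
  have hcard' : (#Bᶜ : ℝ) * #P ≤ #X * #P + #Bᶜ * #P₁ + #Bᶜ * #P₂ + #Q := by
    exact_mod_cast hcard
  have b1 : (#X : ℝ) * #P ≤ 12 * k * ε * (#Bᶜ * #P) := by
    calc (#X : ℝ) * #P ≤ (3 * (ε * (4 * k * #Bᶜ))) * #P := by
          gcongr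
          exact hXc.trans (by gcongr)
      _ = _ := by ring
  have b2 : (#Bᶜ : ℝ) * #P₁ ≤ 6 * k * ε * (#Bᶜ * #P) := by
    calc (#Bᶜ : ℝ) * #P₁ ≤ #Bᶜ * (6 * ε * k * #P) := by gcongr
      _ = _ := by ring
  have b3 : (#Bᶜ : ℝ) * #P₂ ≤ 2 ^ k * ε * (#Bᶜ * #P) := by
    calc (#Bᶜ : ℝ) * #P₂ ≤ #Bᶜ * (ε * 2 ^ k * #P) := by gcongr
      _ = _ := by ring
  have b4 : 2 * (#Q : ℝ) ≤ 4 * k * ε * (#Bᶜ * #P) := by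
    calc 2 * (#Q : ℝ) ≤ ε * #B * #P := hQc
      _ ≤ ε * (4 * k * #Bᶜ) * #P := by gcongr; exact hBn.trans hnA'
      _ = _ := by ring
  have hlt : ε * (20 * k + 2 ^ k) * (#Bᶜ * #P) < 1 * ((#Bᶜ : ℝ) * #P) :=
    mul_lt_mul_of_pos_right hεk (mul_pos hA0 hM0)
  linarith

/-- extending a typical set. For all integers `k ≥ 3` and `1 ≤ ℓ < k/2`
there exist `ε, θ, ξ > 0` and `n₀` such that in the usual extremal setup, for any
ε-typical ℓ-set `L ⊆ B_ε` and any `U ⊆ V` with `|U| ≤ εn` there exist `a ∈ A_ε ∖ U`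
and a `(k-ℓ-1)`-set `C ⊆ B_ε ∖ U` such that `L ∪ {a} ∪ C` is an edge of `H` and
every ℓ-subset of `C` is ε-typical. -/
theorem statement9 (k ℓ : ℕ) (hk : 3 ≤ k) (hl : 1 ≤ ℓ) (hlk : 2 * ℓ < k) :
    ∃ ε θ ξ : ℝ, 0 < ε ∧ 0 < θ ∧ 0 < ξ ∧ ∃ n₀ : ℕ, ∀ n : ℕ, n₀ ≤ n → (k - ℓ) ∣ n →
      ∀ E : Finset (Finset (Fin n)), Uniform n k E →
        ∀ A B : Finset (Fin n), IsMinExtremalPartition n k ℓ E ξ A B →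
          minDeg n (Xedges n k ℓ) (k - 2) < minDeg n E (k - 2) →
          ∀ L : Finset (Fin n), IsTypical n k ℓ E B ε L →
            ∀ U : Finset (Fin n), (U.card : ℝ) ≤ ε * n →
              ∃ a : Fin n, a ∈ Aeps n k E B ε \ U ∧
                ∃ C : Finset (Fin n), C ⊆ Beps n k E B ε \ U ∧ C.card = k - ℓ - 1 ∧
                  a ∉ C ∧ a ∉ L ∧ Disjoint L C ∧
                  L ∪ {a} ∪ C ∈ E ∧
                  ∀ L' : Finset (Fin n), L' ⊆ C → L'.card = ℓ →
                    IsTypical n k ℓ E B ε L' := by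
  have hk0 : (0 : ℝ) < k := by exact_mod_cast (by omega : 0 < k)
  have hK : (0 : ℝ) < 20 * k + 2 ^ k + 1 := by positivity
  set ε : ℝ := 1 / (20 * k + 2 ^ k + 1) with hεdef
  have hε : 0 < ε := by positivity
  have hεK : ε * (20 * k + 2 ^ k + 1) = 1 := by rw [hεdef]; field_simp
  refine ⟨ε, 1, ε ^ 2 / 4 ^ k, hε, one_pos, by positivity, k * (20 * k + 2 ^ k + 1), ?_⟩
  intro n hn hdvd E hE A B hAB hdeg L hL U hU
  obtain ⟨⟨hdisj, hunion, hAc, -, he⟩, -⟩ := hAB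
  have hn4 : 4 * k ≤ n := by
    refine le_trans ?_ hn
    rw [mul_comm 4 k]
    refine Nat.mul_le_mul_left k ?_
    have := Nat.zero_le (2 ^ k)
    linarith
  have hA : A = Bᶜ := by
    rw [← IsCompl.compl_eq (a := B) (b := A)]
    exact ⟨hdisj.symm, codisjoint_iff.2 (by rw [sup_eq_union, union_comm]; exact hunion)⟩
  have hsum : #B + #Bᶜ = n := by rw [card_add_card_compl, Fintype.card_fin]
  rw [hA] at hAc
  obtain ⟨ha, ha'⟩ := ceil_sub_one_bounds_s9 (q := k - ℓ) (by omega) hdvd (by omega) hAc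
  have hq4 : #Bᶜ ≤ n / 4 := by
    have h1 : n / (2 * (k - ℓ)) ≤ n / 4 := Nat.div_le_div_left (by omega) (by omega)
    split_ifs at ha <;> omega
  have hnA : n ≤ 4 * k * #Bᶜ := by
    have h1 : 2 * (k - ℓ) * (#Bᶜ + 1) ≤ 2 * k * (#Bᶜ + 1) := by gcongr; omega
    have h2 : 4 * k * #Bᶜ = 2 * (2 * k * #Bᶜ) := by ring
    have h3 : 2 * k * (#Bᶜ + 1) = 2 * k * #Bᶜ + 2 * k := by ring
    omega
  have hpair : ∀ S : Finset (Fin n), #S = k - 2 →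
      #{p ∈ powersetCard 2 Sᶜ | ¬ p ⊆ B ∧ S ∪ p ∉ E} ≤
        #{p ∈ powersetCard 2 Sᶜ | p ⊆ B ∧ S ∪ p ∈ E} := by
    intro S hS
    refine card_nonedge_pairs_le (by omega) hE B S hS ?_
    have h1 := choose_two_le_minDeg_Xedges (n := n) (k := k) (ℓ := ℓ) (b := #B) (by omega)
      (by omega) (by omega)
    have h2 := minDeg_le_deg E hS
    omega
  have hnR : (k : ℝ) ≤ ε * n := by
    have h1 : (k : ℝ) * (20 * k + 2 ^ k + 1) ≤ n := by exact_mod_cast hn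
    calc (k : ℝ) = ε * (k * (20 * k + 2 ^ k + 1)) := by rw [mul_left_comm, hεK, mul_one]
      _ ≤ _ := by gcongr
  have he' : (edgesIn E B : ℝ) ≤ ε ^ 2 * (#B).choose k := by
    have h1 : (n.choose k : ℝ) ≤ 4 ^ k * (#B).choose k := by
      exact_mod_cast choose_le_four_pow_mul_choose (by omega)
    calc _ ≤ ε ^ 2 / 4 ^ k * (n.choose k : ℝ) := he
      _ ≤ ε ^ 2 / 4 ^ k * (4 ^ k * (#B).choose k) := by gcongr
      _ = _ := by field_simp
  exact exists_typical_extension hl hlk hE hε (by linarith) (by omega) (by omega) hnA hnR he'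
    hpair hL hU
end
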